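/- Let a_n be the coefficient of q^n in ∏_{m=1}^∞ (1 - q^m)^2. Then there exists a real constant C > 0 such that ∑_{n=0}^{N} |a_n| is asymptotically equivalent to C·N/(ln N)^{1/2} as N → ∞, and C = (12/√(3π)) · L, where L is the limit as x → ∞ of the finite product over primes p ≤ x given by ∏_{p ≤ x, p ≡ 5,7,11 (mod 12)} (1 + 1/p)^{-1}(1 - 1/p)^{-1/2} · ∏_{p ≤ x, p ≡ 1 (mod 12)} (1 - 1/p)^{-3/2}. -/

import Mathlib

open Filter

section Tauberian

open MeasureTheory Set

theorem integral_rpow_neg_half_mul_cexp {z : ℂ} (hz : 0 < z.re) :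
    ∫ u in Ioi (0 : ℝ), ((u ^ (-(1 / 2) : ℝ) : ℝ) : ℂ) * Complex.exp (-z * u) =
      Real.sqrt Real.pi * z ^ (-(1 / 2) : ℂ) := by
  have h1 := integral_comp_rpow_Ioi (fun x : ℝ => Complex.exp (-z * x ^ 2))
    (p := 1 / 2) (by norm_num)
  rw [integral_gaussian_complex_Ioi hz] at h1
  have h2 : ((Real.pi : ℂ) / z) ^ (1 / 2 : ℂ) = Real.sqrt Real.pi * z ^ (-(1 / 2) : ℂ) := by
    have hz0 : z ≠ 0 := by rintro rfl; simp at hz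
    rw [div_eq_mul_inv, Complex.cpow_def_of_ne_zero (mul_ne_zero
      (by exact_mod_cast Real.pi_ne_zero) (inv_ne_zero hz0)),
      Complex.log_ofReal_mul Real.pi_pos (inv_ne_zero hz0), Complex.log_inv, add_mul,
      Complex.exp_add]
    · congr 1
      · rw [Real.sqrt_eq_rpow, Real.rpow_def_of_pos Real.pi_pos]
        push_cast
        rfl
      · rw [Complex.cpow_def_of_ne_zero hz0]
        congr 1
        ring
    · have := Complex.abs_arg_lt_pi_div_two_iff.2 (Or.inl hz)
      intro h
      rw [h, abs_of_pos Real.pi_pos] at this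
      linarith [Real.pi_pos]
  rw [← h2]
  have h3 : ∀ u ∈ Ioi (0 : ℝ), ((u ^ (-(1 / 2) : ℝ) : ℝ) : ℂ) * Complex.exp (-z * u) =
      2 * ((|(1 / 2 : ℝ)| * u ^ ((1 / 2 : ℝ) - 1)) •
        Complex.exp (-z * ((u ^ (1 / 2 : ℝ) : ℝ) : ℂ) ^ 2)) := by
    intro u hu
    have : (((u ^ (1 / 2 : ℝ) : ℝ) : ℂ)) ^ 2 = u := by
      norm_cast
      rw [← Real.rpow_natCast, ← Real.rpow_mul (le_of_lt hu)]
      norm_num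
    rw [this, abs_of_pos (by norm_num), Complex.real_smul]
    norm_num
    ring
  rw [setIntegral_congr_fun measurableSet_Ioi h3, integral_const_mul, h1]
  ring

theorem integral_fejer_mul_cexp {l : ℝ} (hl : 0 < l) (w : ℝ) :
    ∫ t in (-l)..l, ((1 - |t| / l : ℝ) : ℂ) * Complex.exp (Complex.I * t * w) =
      ((l * Real.sinc (l * w / 2) ^ 2 : ℝ) : ℂ) := by
  have hinteg : ∀ a b : ℝ, IntervalIntegrable
      (fun t : ℝ => ((1 - |t| / l : ℝ) : ℂ) * Complex.exp (Complex.I * t * w)) volume a b :=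
    fun a b => Continuous.intervalIntegrable (by fun_prop) _ _
  rw [← intervalIntegral.integral_add_adjacent_intervals (hinteg (-l) 0) (hinteg 0 l)]
  have h0 := intervalIntegral.integral_comp_neg (a := 0) (b := l)
    (fun t : ℝ => ((1 - |t| / l : ℝ) : ℂ) * Complex.exp (Complex.I * t * w))
  rw [neg_zero] at h0
  have hneg : ∀ a b : ℝ, IntervalIntegrable
      (fun t : ℝ => ((1 - |-t| / l : ℝ) : ℂ) * Complex.exp (Complex.I * (-t : ℝ) * w)) volume a b :=
    fun a b => Continuous.intervalIntegrable (by fun_prop) _ _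
  rw [← h0, ← intervalIntegral.integral_add (hneg 0 l) (hinteg 0 l)]
  have h1 : Set.EqOn (fun t : ℝ => ((1 - |-t| / l : ℝ) : ℂ) * Complex.exp (Complex.I * (-t : ℝ) * w)
      + ((1 - |t| / l : ℝ) : ℂ) * Complex.exp (Complex.I * t * w))
      (fun t : ℝ => ((2 * ((1 - t / l) * Real.cos (t * w)) : ℝ) : ℂ)) (Set.uIcc 0 l) := by
    intro t ht
    rw [Set.uIcc_of_le hl.le] at ht
    have e : Complex.I * (-t : ℝ) * w = -(t * w : ℝ) * Complex.I := by push_cast; ring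
    have e' : Complex.I * t * w = (t * w : ℝ) * Complex.I := by push_cast; ring
    simp only [abs_neg, abs_of_nonneg ht.1]
    rw [← mul_add, e, e', add_comm, ← Complex.two_cos]
    push_cast
    ring
  rw [intervalIntegral.integral_congr h1, intervalIntegral.integral_ofReal,
    intervalIntegral.integral_const_mul]
  congr 1
  rcases eq_or_ne w 0 with rfl | hw
  · have : ∀ t : ℝ, HasDerivAt (fun t : ℝ => t - t ^ 2 / (2 * l)) (1 - t / l) t := by
      intro t
      have := (hasDerivAt_id t).sub (((hasDerivAt_id t).pow 2).div_const (2 * l))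
      refine this.congr_deriv ?_
      simp
      field_simp
    simp only [mul_zero, Real.cos_zero, mul_one, zero_div, Real.sinc_zero, one_pow]
    rw [intervalIntegral.integral_eq_sub_of_hasDerivAt (fun t _ => this t)
      (Continuous.intervalIntegrable (by fun_prop) _ _)]
    field_simp
    ring
  · have : ∀ t : ℝ, HasDerivAt
        (fun t : ℝ => (1 - t / l) * (Real.sin (t * w) / w) - Real.cos (t * w) / (l * w ^ 2))
        ((1 - t / l) * Real.cos (t * w)) t := by
      intro t
      have a1 : HasDerivAt (fun t : ℝ => t * w) w t := by
        simpa using (hasDerivAt_id t).mul_const w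
      have a2 : HasDerivAt (fun t : ℝ => 1 - t / l) (-(1 / l)) t := by
        simpa using ((hasDerivAt_id t).div_const l).const_sub 1
      have := (a2.mul (a1.sin.div_const w)).sub (a1.cos.div_const (l * w ^ 2))
      refine this.congr_deriv ?_
      field_simp
      ring
    rw [intervalIntegral.integral_eq_sub_of_hasDerivAt (fun t _ => this t)
      (Continuous.intervalIntegrable (by fun_prop) _ _), Real.sinc_of_ne_zero (by positivity)]
    have c : Real.cos (l * w) = 1 - 2 * Real.sin (l * w / 2) ^ 2 := by
      have := Real.cos_sq (l * w / 2)
      have h2 := Real.sin_sq (l * w / 2)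
      rw [show 2 * (l * w / 2) = l * w by ring] at this
      linarith
    simp only [zero_mul, Real.cos_zero, Real.sin_zero, c]
    field_simp
    ring

theorem exists_bound_integral_sqrt_mul_cexp {q q' : ℝ → ℂ} {l : ℝ} (hl : 0 < l)
    (hq : ∀ t ∈ Set.Icc 0 l, HasDerivAt q (q' t) t) (hq' : ContinuousOn q' (Set.Icc 0 l)) :
    ∃ C : ℝ, ∀ v : ℝ, v ≠ 0 →
      ‖∫ t in (0 : ℝ)..l, (Real.sqrt t : ℂ) * q t * Complex.exp (Complex.I * t * v)‖ ≤ C / |v| := by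
  have hu : Set.uIcc 0 l = Set.Icc 0 l := Set.uIcc_of_le hl.le
  have hqc : ContinuousOn q (Set.Icc 0 l) := fun t ht => (hq t ht).continuousAt.continuousWithinAt
  set u : ℝ → ℂ := fun t => (Real.sqrt t : ℂ) * q t
  set u' : ℝ → ℂ := fun t => ((1 / 2 * t ^ (-(1 / 2) : ℝ) : ℝ) : ℂ) * q t + (Real.sqrt t : ℂ) * q' t
  have hui : IntervalIntegrable u' volume 0 l := by
    refine IntervalIntegrable.add ?_ ?_
    · refine IntervalIntegrable.mul_continuousOn ?_ (by rwa [hu])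
      have := (intervalIntegral.intervalIntegrable_rpow' (a := 0) (b := l)
        (r := -(1 / 2)) (by norm_num)).const_mul (1 / 2)
      exact ⟨this.1.ofReal, this.2.ofReal⟩
    · refine ContinuousOn.intervalIntegrable ?_
      rw [hu]
      exact ContinuousOn.mul (Continuous.continuousOn (by fun_prop)) hq'
  have key : ∀ v : ℝ, v ≠ 0 →
      ∫ t in (0 : ℝ)..l, u t * Complex.exp (Complex.I * t * v) =
        u l * (Complex.exp (Complex.I * l * v) / (Complex.I * v)) -
          ∫ t in (0 : ℝ)..l, u' t * (Complex.exp (Complex.I * t * v) / (Complex.I * v)) := by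
    intro v hv
    have hv' : (v : ℂ) ≠ 0 := by exact_mod_cast hv
    rw [intervalIntegral.integral_mul_deriv_eq_deriv_mul_of_hasDerivAt (u := u) (u' := u')
      (v := fun t : ℝ => Complex.exp (Complex.I * t * v) / (Complex.I * v))
      (v' := fun t : ℝ => Complex.exp (Complex.I * t * v))]
    · simp [u]
    · rw [hu]; exact ContinuousOn.mul (by fun_prop) hqc
    · exact Continuous.continuousOn (by fun_prop)
    · intro t ht
      rw [min_eq_left hl.le, max_eq_right hl.le] at ht
      have h1 := (Real.hasDerivAt_sqrt ht.1.ne').ofReal_comp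
      have := h1.mul (hq t ⟨ht.1.le, ht.2.le⟩)
      refine this.congr_deriv ?_
      simp only [u']
      rw [Real.rpow_neg ht.1.le, ← Real.sqrt_eq_rpow]
      congr 3
      field_simp
    · intro t _
      have h1 : HasDerivAt (fun t : ℝ => Complex.I * (t : ℂ) * v) (Complex.I * v) t := by
        have := ((hasDerivAt_id t).ofReal_comp.const_mul Complex.I).mul_const (v : ℂ)
        simpa using this
      have := h1.cexp.div_const (Complex.I * v)
      convert this using 1
      have : Complex.I * (v : ℂ) ≠ 0 := mul_ne_zero Complex.I_ne_zero hv'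
      field_simp
    · exact hui
    · exact Continuous.intervalIntegrable (by fun_prop) _ _
  have hexp : ∀ t v : ℝ, ‖Complex.exp (Complex.I * t * v)‖ = 1 := by
    intro t v
    rw [show Complex.I * t * v = ((t * v : ℝ) : ℂ) * Complex.I by push_cast; ring]
    exact Complex.norm_exp_ofReal_mul_I _
  refine ⟨‖u l‖ + ∫ t in (0 : ℝ)..l, ‖u' t‖, fun v hv => ?_⟩
  change ‖∫ t in (0 : ℝ)..l, u t * Complex.exp (Complex.I * t * v)‖ ≤ _
  rw [key v hv, add_div]
  refine (norm_sub_le _ _).trans (add_le_add ?_ ?_)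
  · rw [norm_mul, norm_div, hexp, norm_mul Complex.I, Complex.norm_I, one_mul, Complex.norm_real]
    simp [div_eq_mul_inv]
  · refine (intervalIntegral.norm_integral_le_integral_norm hl.le).trans (le_of_eq ?_)
    rw [← intervalIntegral.integral_div]
    refine intervalIntegral.integral_congr fun t _ => ?_
    change ‖u' t * _‖ = _
    rw [norm_mul, norm_div, hexp, norm_mul Complex.I, Complex.norm_I, one_mul, Complex.norm_real]
    simp [div_eq_mul_inv]

theorem integral_mul_fejer_eq_integral_laplace {g : ℝ → ℝ} {ε l : ℝ} (hl : 0 < l)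
    (hg : IntegrableOn (fun u => g u * Real.exp (-ε * u)) (Ioi 0)) (v : ℝ) :
    ((∫ u in Ioi (0 : ℝ), g u * Real.exp (-ε * u) * (l * Real.sinc (l * (v - u) / 2) ^ 2) : ℝ) : ℂ)
      = ∫ t in (-l)..l, ((1 - |t| / l : ℝ) : ℂ) * Complex.exp (Complex.I * t * v) *
          ∫ u in Ioi (0 : ℝ), (g u : ℂ) * Complex.exp (-(ε + Complex.I * t) * u) := by
  have hle : -l ≤ l := by linarith
  have hF : ∀ t u : ℝ, ((1 - |t| / l : ℝ) : ℂ) * Complex.exp (Complex.I * t * v) *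
      ((g u : ℂ) * Complex.exp (-(ε + Complex.I * t) * u)) =
      (((1 - |t| / l : ℝ) : ℂ) * ((g u * Real.exp (-ε * u) : ℝ) : ℂ)) *
        Complex.exp (Complex.I * t * (v - u : ℝ)) := by
    intro t u
    have : Complex.exp (Complex.I * t * v) * Complex.exp (-(ε + Complex.I * t) * u) =
        Complex.exp (-ε * u) * Complex.exp (Complex.I * t * (v - u : ℝ)) := by
      rw [← Complex.exp_add, ← Complex.exp_add]
      congr 1
      push_cast
      ring
    push_cast at this ⊢
    linear_combination ((1 - |t| / l : ℂ) * g u) * this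
  have hI : Integrable (fun p : ℝ × ℝ => (((1 - |p.1| / l : ℝ) : ℂ) *
      ((g p.2 * Real.exp (-ε * p.2) : ℝ) : ℂ)) *
        Complex.exp (Complex.I * p.1 * (v - p.2 : ℝ)))
      ((volume.restrict (Ioc (-l) l)).prod (volume.restrict (Ioi 0))) := by
    have h1 : Integrable (fun t : ℝ => ((1 - |t| / l : ℝ) : ℂ)) (volume.restrict (Ioc (-l) l)) := by
      have : IntervalIntegrable (fun t : ℝ => ((1 - |t| / l : ℝ) : ℂ)) volume (-l) l :=
        Continuous.intervalIntegrable (by fun_prop) _ _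
      exact (intervalIntegrable_iff_integrableOn_Ioc_of_le hle).1 this
    have h2 := (h1.mul_prod (Integrable.ofReal (𝕜 := ℂ) hg))
    refine h2.mul_bdd (c := 1) (Continuous.aestronglyMeasurable (by fun_prop)) ?_
    refine Eventually.of_forall fun p => ?_
    rw [show Complex.I * (p.1 : ℂ) * (v - p.2 : ℝ) = ((p.1 * (v - p.2) : ℝ) : ℂ) * Complex.I by
      push_cast; ring, Complex.norm_exp_ofReal_mul_I]
  simp_rw [← integral_const_mul, hF]
  rw [intervalIntegral.integral_of_le hle, integral_integral_swap hI, ← integral_complex_ofReal]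
  refine setIntegral_congr_fun measurableSet_Ioi fun u _ => ?_
  rw [← intervalIntegral.integral_of_le hle, Complex.ofReal_mul _ (l * _),
    ← integral_fejer_mul_cexp hl, ← intervalIntegral.integral_const_mul]
  refine intervalIntegral.integral_congr fun t _ => ?_
  ring

theorem ofReal_mul_cpow_of_pos {r : ℝ} (hr : 0 < r) {z : ℂ} (hz : z ≠ 0) (w : ℂ) :
    ((r : ℂ) * z) ^ w = (r : ℂ) ^ w * z ^ w := by
  have hr' : (r : ℂ) ≠ 0 := by exact_mod_cast hr.ne'
  rw [Complex.cpow_def_of_ne_zero (mul_ne_zero hr' hz), Complex.log_ofReal_mul hr hz, add_mul,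
    Complex.exp_add, Complex.cpow_def_of_ne_zero hr', Complex.cpow_def_of_ne_zero hz,
    Complex.ofReal_log hr.le]

theorem exists_bound_integral_ray {G : ℂ → ℂ} {U : Set ℂ} (hU : IsOpen U)
    (hG : DifferentiableOn ℂ G U) {l : ℝ} (hl : 0 < l) {s : ℂ} (hs : s ≠ 0)
    (hsU : ∀ t ∈ Icc 0 l, (t : ℂ) * s ∈ U) :
    ∃ C : ℝ, ∀ v : ℝ, v ≠ 0 →
      ‖∫ t in (0 : ℝ)..l, ((1 - t / l : ℝ) : ℂ) * Complex.exp (Complex.I * t * v) *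
        (((t : ℂ) * s) ^ (-(1 / 2) : ℂ) * (G (t * s) - G 0))‖ ≤ C / |v| := by
  have h0 : (0 : ℂ) ∈ U := by simpa using hsU 0 ⟨le_rfl, hl.le⟩
  have hQ : DifferentiableOn ℂ (dslope G 0) U :=
    (Complex.differentiableOn_dslope (hU.mem_nhds h0)).2 hG
  set Q := dslope G 0
  have hQ' : ContinuousOn (deriv Q) U := (hQ.deriv hU).continuousOn
  set c : ℂ := s ^ (-(1 / 2) : ℂ) * s
  have hmap : ContinuousOn (fun t : ℝ => deriv Q ((t : ℂ) * s)) (Icc 0 l) :=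
    hQ'.comp (Continuous.continuousOn (by fun_prop)) hsU
  have hmap0 : ContinuousOn (fun t : ℝ => Q ((t : ℂ) * s)) (Icc 0 l) :=
    hQ.continuousOn.comp (Continuous.continuousOn (by fun_prop)) hsU
  have hder : ∀ t ∈ Icc 0 l, HasDerivAt (fun t : ℝ => ((1 - t / l : ℝ) : ℂ) * (c * Q (t * s)))
      (((-(1 / l) : ℝ) : ℂ) * (c * Q (t * s)) +
        ((1 - t / l : ℝ) : ℂ) * (c * (deriv Q (t * s) * s))) t := by
    intro t ht
    have a1 : HasDerivAt (fun t : ℝ => ((1 - t / l : ℝ) : ℂ)) ((-(1 / l) : ℝ) : ℂ) t := by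
      have : HasDerivAt (fun t : ℝ => 1 - t / l) (-(1 / l)) t := by
        simpa using ((hasDerivAt_id t).div_const l).const_sub 1
      exact this.ofReal_comp
    have a2 : HasDerivAt (fun t : ℝ => (t : ℂ) * s) s t := by
      simpa using ((hasDerivAt_id t).ofReal_comp).mul_const s
    have a3 : HasDerivAt Q (deriv Q (t * s)) (t * s) :=
      (hQ.differentiableAt (hU.mem_nhds (hsU t ht))).hasDerivAt
    exact a1.mul ((a3.comp t a2).const_mul c)
  have hcont : ContinuousOn (fun t : ℝ => ((-(1 / l) : ℝ) : ℂ) * (c * Q (t * s)) +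
      ((1 - t / l : ℝ) : ℂ) * (c * (deriv Q (t * s) * s))) (Icc 0 l) := by
    refine ContinuousOn.add ?_ ?_
    · exact ContinuousOn.mul continuousOn_const (continuousOn_const.mul hmap0)
    · exact ContinuousOn.mul (Continuous.continuousOn (by fun_prop))
        (continuousOn_const.mul (hmap.mul continuousOn_const))
  obtain ⟨C, hC⟩ := exists_bound_integral_sqrt_mul_cexp hl hder hcont
  refine ⟨C, fun v hv => ?_⟩
  refine le_of_eq_of_le ?_ (hC v hv)
  congr 1
  refine intervalIntegral.integral_congr fun t ht => ?_
  rw [uIcc_of_le hl.le] at ht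
  rcases ht.1.eq_or_lt with rfl | ht0
  · simp
  · have ht' : (t : ℂ) ≠ 0 := by exact_mod_cast ht0.ne'
    have e1 : G (t * s) - G 0 = t * s * Q (t * s) := by
      have := sub_smul_dslope G 0 (t * s)
      simp only [sub_zero, smul_eq_mul] at this
      exact this.symm
    have e2 : (t : ℂ) ^ (-(1 / 2) : ℂ) * t = Real.sqrt t := by
      rw [Real.sqrt_eq_rpow, Complex.ofReal_cpow ht0.le]
      nth_rewrite 2 [← Complex.cpow_one (t : ℂ)]
      rw [← Complex.cpow_add _ _ ht']
      norm_num
    rw [e1, ofReal_mul_cpow_of_pos ht0 hs, ← e2]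
    simp only [c]
    ring

theorem integrable_of_le_inv_sq {g : ℝ → ℝ} {M : ℝ} (hgm : Measurable g) (hg0 : ∀ w, 0 ≤ g w)
    (hgM : ∀ w, g w ≤ M) (hgM' : ∀ w, g w * w ^ 2 ≤ M) : Integrable g := by
  refine (integrable_inv_one_add_sq.const_mul (2 * M)).mono' hgm.aestronglyMeasurable
    (Eventually.of_forall fun w => ?_)
  rw [Real.norm_eq_abs, abs_of_nonneg (hg0 w), ← div_eq_mul_inv, le_div_iff₀ (by positivity)]
  nlinarith [hgM w, hgM' w]

theorem tendsto_sqrt_mul_integral_rpow_neg_half {g : ℝ → ℝ} {M : ℝ} (hgm : Measurable g)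
    (hg0 : ∀ w, 0 ≤ g w) (hgM : ∀ w, g w ≤ M) (hgM' : ∀ w, g w * w ^ 2 ≤ M) :
    (∀ v : ℝ, IntegrableOn (fun u => u ^ (-(1 / 2) : ℝ) * g (v - u)) (Ioi 0)) ∧
    Tendsto (fun v : ℝ => Real.sqrt v * ∫ u in Ioi (0 : ℝ), u ^ (-(1 / 2) : ℝ) * g (v - u)) atTop
      (nhds (∫ w, g w)) := by
  have hgi : Integrable g := integrable_of_le_inv_sq hgm hg0 hgM hgM'
  have hM : 0 ≤ M := (hg0 0).trans (hgM 0)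
  have hgi' : ∀ v, Integrable (fun u => g (v - u)) := fun v => hgi.comp_sub_left v
  have hp : ∀ b : ℝ, 0 < b → IntegrableOn (fun u : ℝ => u ^ (-(1 / 2) : ℝ)) (Ioc 0 b) := by
    intro b hb
    have := intervalIntegral.intervalIntegrable_rpow' (a := 0) (b := b)
        (r := -(1 / 2)) (by norm_num)
    exact (intervalIntegrable_iff_integrableOn_Ioc_of_le hb.le).1 this
  have hA : ∀ v b : ℝ, 0 < b →
      IntegrableOn (fun u => u ^ (-(1 / 2) : ℝ) * g (v - u)) (Ioc 0 b) := by
    intro v b hb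
    refine Integrable.mul_bdd (c := M) (hp b hb) ?_ (Eventually.of_forall fun u => ?_)
    · exact (hgm.comp (measurable_const.sub measurable_id)).aestronglyMeasurable
    · rw [Real.norm_eq_abs, abs_of_nonneg (hg0 _)]; exact hgM _
  have hB : ∀ v b : ℝ, 0 < b →
      IntegrableOn (fun u => u ^ (-(1 / 2) : ℝ) * g (v - u)) (Ioi b) := by
    intro v b hb
    refine Integrable.bdd_mul (c := b ^ (-(1 / 2) : ℝ)) (hgi' v).integrableOn ?_ ?_
    · exact (by fun_prop : Measurable fun u : ℝ => u ^ (-(1 / 2) : ℝ)).aestronglyMeasurable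
    · refine (ae_restrict_iff' measurableSet_Ioi).2 (Eventually.of_forall fun u hu => ?_)
      have hu' : b < u := hu
      rw [Real.norm_eq_abs, abs_of_nonneg (Real.rpow_nonneg (by linarith) _)]
      exact Real.rpow_le_rpow_of_nonpos hb hu'.le (by norm_num)
  have hAB : ∀ v b : ℝ, 0 < b →
      IntegrableOn (fun u => u ^ (-(1 / 2) : ℝ) * g (v - u)) (Ioi 0) := by
    intro v b hb
    rw [← Ioc_union_Ioi_eq_Ioi hb.le]
    exact (hA v b hb).union (hB v b hb)
  refine ⟨fun v => hAB v 1 one_pos, ?_⟩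
  have hsplit : ∀ v : ℝ, 0 < v →
      Real.sqrt v * (∫ u in Ioc 0 (v / 2), u ^ (-(1 / 2) : ℝ) * g (v - u)) +
        ∫ w, (Iio (v / 2)).indicator (fun w => Real.sqrt v * ((v - w) ^ (-(1 / 2) : ℝ) * g w)) w =
      Real.sqrt v * ∫ u in Ioi (0 : ℝ), u ^ (-(1 / 2) : ℝ) * g (v - u) := by
    intro v hv
    have hv2 : 0 < v / 2 := by linarith
    rw [← Ioc_union_Ioi_eq_Ioi hv2.le, setIntegral_union (by
      rw [Set.disjoint_left]; intro x hx hx'; exact absurd hx.2 (not_le.2 hx')) measurableSet_Ioi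
      (hA v _ hv2) (hB v _ hv2), mul_add]
    congr 1
    rw [← integral_indicator measurableSet_Ioi, ← integral_const_mul,
      ← integral_sub_left_eq_self _ volume v]
    refine integral_congr_ae (Eventually.of_forall fun u => ?_)
    by_cases hu : u ∈ Ioi (v / 2)
    · have : v - u ∈ Iio (v / 2) := by simp only [mem_Ioi, mem_Iio] at *; linarith
      simp [hu, this]
    · have : v - u ∉ Iio (v / 2) := by simp only [mem_Ioi, mem_Iio] at *; linarith
      simp only [indicator_of_notMem hu, indicator_of_notMem this, mul_zero]
  have hT1 : Tendsto (fun v : ℝ =>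
      Real.sqrt v * (∫ u in Ioc 0 (v / 2), u ^ (-(1 / 2) : ℝ) * g (v - u))) atTop (nhds 0) := by
    have hlim : Tendsto (fun v : ℝ => 8 * M / v) atTop (nhds 0) :=
      tendsto_const_nhds.div_atTop tendsto_id
    refine squeeze_zero' (eventually_atTop.2 ⟨1, fun v hv => ?_⟩)
      (eventually_atTop.2 ⟨1, fun v hv => ?_⟩) hlim
    · refine mul_nonneg (Real.sqrt_nonneg _) (setIntegral_nonneg measurableSet_Ioc fun u hu => ?_)
      exact mul_nonneg (Real.rpow_nonneg hu.1.le _) (hg0 _)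
    · have hv0 : 0 < v := by linarith
      have hv2 : 0 < v / 2 := by linarith
      have h1 : ∫ u in Ioc 0 (v / 2), u ^ (-(1 / 2) : ℝ) * g (v - u) ≤
          ∫ u in Ioc 0 (v / 2), u ^ (-(1 / 2) : ℝ) * (4 * M / v ^ 2) := by
        refine setIntegral_mono_on (hA v _ hv2) ((hp _ hv2).mul_const _) measurableSet_Ioc
          fun u hu => ?_
        refine mul_le_mul_of_nonneg_left ?_ (Real.rpow_nonneg hu.1.le _)
        rw [le_div_iff₀ (by positivity)]
        have h2 := hgM' (v - u)
        have h3 : v ^ 2 ≤ 4 * (v - u) ^ 2 := by nlinarith [hu.2]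
        nlinarith [hg0 (v - u)]
      have hinteg : ∫ u in Ioc 0 (v / 2), u ^ (-(1 / 2) : ℝ) =
          ((v / 2) ^ (-(1 / 2) + 1 : ℝ) - 0 ^ (-(1 / 2) + 1 : ℝ)) / (-(1 / 2) + 1) := by
        rw [← intervalIntegral.integral_of_le hv2.le, integral_rpow (Or.inl (by norm_num))]
      rw [integral_mul_const, hinteg] at h1
      have h4 : (v / 2) ^ (-(1 / 2) + 1 : ℝ) ≤ Real.sqrt v := by
        rw [show (-(1 / 2) + 1 : ℝ) = 1 / 2 by norm_num, ← Real.sqrt_eq_rpow]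
        exact Real.sqrt_le_sqrt (by linarith)
      rw [Real.zero_rpow (by norm_num)] at h1
      calc Real.sqrt v * _ ≤ Real.sqrt v * ((2 * Real.sqrt v) * (4 * M / v ^ 2)) := by
            refine mul_le_mul_of_nonneg_left (h1.trans ?_) (Real.sqrt_nonneg _)
            refine mul_le_mul_of_nonneg_right ?_ (by positivity)
            rw [div_le_iff₀ (by norm_num)]
            linarith
        _ = (Real.sqrt v * Real.sqrt v) * (8 * M / v ^ 2) := by ring
        _ = 8 * M / v := by
            rw [Real.mul_self_sqrt hv0.le]
            field_simp
  have hT2 : Tendsto (fun v : ℝ =>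
      ∫ w, (Iio (v / 2)).indicator (fun w => Real.sqrt v * ((v - w) ^ (-(1 / 2) : ℝ) * g w)) w)
      atTop (nhds (∫ w, g w)) := by
    refine tendsto_integral_filter_of_dominated_convergence (fun w => Real.sqrt 2 * g w) ?_ ?_
      (hgi.const_mul _) ?_
    · refine Eventually.of_forall fun v => (Measurable.indicator ?_ measurableSet_Iio).aestronglyMeasurable
      fun_prop
    · refine eventually_atTop.2 ⟨1, fun v hv => Eventually.of_forall fun w => ?_⟩
      by_cases hw : w ∈ Iio (v / 2)
      · have hw' : w < v / 2 := hw
        rw [indicator_of_mem hw, ← mul_assoc, norm_mul, Real.norm_of_nonneg (hg0 w)]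
        refine mul_le_mul_of_nonneg_right ?_ (hg0 w)
        have hvw : 0 < v - w := by linarith
        rw [Real.norm_of_nonneg (by positivity), Real.rpow_neg hvw.le, ← Real.sqrt_eq_rpow,
          ← div_eq_mul_inv, div_le_iff₀ (Real.sqrt_pos.2 hvw), ← Real.sqrt_mul (by norm_num)]
        exact Real.sqrt_le_sqrt (by linarith)
      · rw [indicator_of_notMem hw, norm_zero]
        exact mul_nonneg (Real.sqrt_nonneg _) (hg0 w)
    · refine Eventually.of_forall fun w => ?_
      have h1 : Tendsto (fun v : ℝ => Real.sqrt (1 / (1 - w / v)) * g w) atTop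
          (nhds (Real.sqrt (1 / (1 - 0)) * g w)) := by
        refine Tendsto.mul_const _ ((Real.continuous_sqrt.tendsto _).comp ?_)
        refine Tendsto.div tendsto_const_nhds (tendsto_const_nhds.sub
          (tendsto_const_nhds.div_atTop tendsto_id)) (by norm_num)
      simp only [sub_zero, div_one, Real.sqrt_one, one_mul] at h1
      refine h1.congr' ?_
      filter_upwards [eventually_gt_atTop 0, eventually_gt_atTop (2 * w)] with v hv hvw
      have hw : w ∈ Iio (v / 2) := by simp only [mem_Iio]; linarith
      have hvw : 0 < v - w := by have : w < v / 2 := hw; linarith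
      rw [indicator_of_mem hw, ← mul_assoc, Real.rpow_neg hvw.le, ← Real.sqrt_eq_rpow,
        ← div_eq_mul_inv, ← Real.sqrt_div hv.le]
      congr 2
      field_simp
  have := hT1.add hT2
  rw [zero_add] at this
  refine this.congr' ?_
  filter_upwards [eventually_gt_atTop 0] with v hv using hsplit v hv

theorem tendsto_integral_ray {G : ℂ → ℂ} {U : Set ℂ} (hU : IsOpen U)
    (hG : DifferentiableOn ℂ G U) {l : ℝ} (hl : 0 < l) {s : ℂ} (hs1 : |s.im| = 1)
    (hsU : ∀ t ∈ Icc 0 l, (t : ℂ) * s ∈ U) (v : ℝ) :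
    Tendsto (fun ε : ℝ => ∫ t in (0 : ℝ)..l, ((1 - t / l : ℝ) : ℂ) *
        Complex.exp (Complex.I * t * v) *
        (((ε : ℂ) + t * s) ^ (-(1 / 2) : ℂ) * (G (ε + t * s) - G 0))) (nhdsWithin 0 (Ioi 0))
      (nhds (∫ t in (0 : ℝ)..l, ((1 - t / l : ℝ) : ℂ) * Complex.exp (Complex.I * t * v) *
        (((t : ℂ) * s) ^ (-(1 / 2) : ℂ) * (G (t * s) - G 0)))) := by
  have hScomp : IsCompact ((fun t : ℝ => (t : ℂ) * s) '' Icc 0 l) :=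
    isCompact_Icc.image (by fun_prop)
  have hSU : (fun t : ℝ => (t : ℂ) * s) '' Icc 0 l ⊆ U := by
    rintro _ ⟨t, ht, rfl⟩
    exact hsU t ht
  obtain ⟨δ, hδ, hδU⟩ := hScomp.exists_cthickening_subset_open hU hSU
  obtain ⟨M, hM⟩ := (hScomp.cthickening (r := δ)).exists_bound_of_continuousOn
    (f := fun z => G z - G 0) ((hG.continuousOn.mono hδU).sub continuousOn_const)
  have hM0 : 0 ≤ M := (norm_nonneg _).trans (hM (0 * s) (Metric.self_subset_cthickening _
    ⟨0, ⟨le_rfl, hl.le⟩, by simp⟩))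
  have hmem : ∀ ε : ℝ, 0 ≤ ε → ε ≤ δ → ∀ t ∈ Icc 0 l,
      (ε : ℂ) + t * s ∈ Metric.cthickening δ ((fun t : ℝ => (t : ℂ) * s) '' Icc 0 l) := by
    intro ε hε hεδ t ht
    refine Metric.mem_cthickening_of_dist_le _ ((t : ℂ) * s) _ _ ⟨t, ht, rfl⟩ ?_
    rw [dist_eq_norm, add_sub_cancel_right, Complex.norm_real, Real.norm_of_nonneg hε]
    exact hεδ
  have him : ∀ ε t : ℝ, ((ε : ℂ) + t * s).im = t * s.im := by intro ε t; simp
  have hslit : ∀ ε t : ℝ, t ≠ 0 → (ε : ℂ) + t * s ∈ Complex.slitPlane := by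
    intro ε t ht
    refine Complex.mem_slitPlane_iff.2 (Or.inr ?_)
    rw [him]
    refine mul_ne_zero ht ?_
    intro h
    rw [h] at hs1
    norm_num at hs1
  have hev : ∀ᶠ ε : ℝ in nhdsWithin 0 (Ioi 0), 0 < ε ∧ ε ≤ δ := by
    filter_upwards [self_mem_nhdsWithin, mem_nhdsWithin_of_mem_nhds (Iic_mem_nhds hδ)] with ε h1 h2
    exact ⟨h1, h2⟩
  have hIoc : uIoc 0 l = Ioc 0 l := uIoc_of_le hl.le
  refine intervalIntegral.tendsto_integral_filter_of_dominated_convergence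
    (fun t => t ^ (-(1 / 2) : ℝ) * M) ?_ ?_ ?_ ?_
  · filter_upwards [hev] with ε hε
    rw [hIoc]
    refine ContinuousOn.aestronglyMeasurable ?_ measurableSet_Ioc
    refine ContinuousOn.mul (Continuous.continuousOn (by fun_prop)) (ContinuousOn.mul ?_ ?_)
    · intro t ht
      refine ContinuousAt.continuousWithinAt ?_
      exact ContinuousAt.cpow (by fun_prop) continuousAt_const (hslit ε t ht.1.ne')
    · refine ContinuousOn.sub (hG.continuousOn.comp (Continuous.continuousOn (by fun_prop)) ?_)
        continuousOn_const
      intro t ht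
      exact hδU (hmem ε hε.1.le hε.2 t ⟨ht.1.le, ht.2⟩)
  · filter_upwards [hev] with ε hε
    refine Eventually.of_forall fun t ht => ?_
    rw [hIoc] at ht
    have hn : ‖(ε : ℂ) + t * s‖ ≥ t := by
      have := Complex.abs_im_le_norm ((ε : ℂ) + t * s)
      rw [him, abs_mul, hs1, mul_one] at this
      exact (le_abs_self t).trans this
    have h1 : ‖((1 - t / l : ℝ) : ℂ)‖ ≤ 1 := by
      rw [Complex.norm_real, Real.norm_eq_abs, abs_le]
      have h2 : t / l ≤ 1 := (div_le_one hl).2 ht.2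
      have h3 : 0 ≤ t / l := div_nonneg ht.1.le hl.le
      constructor <;> linarith
    have h2 : ‖Complex.exp (Complex.I * t * v)‖ = 1 := by
      rw [show Complex.I * (t : ℂ) * v = ((t * v : ℝ) : ℂ) * Complex.I by push_cast; ring,
        Complex.norm_exp_ofReal_mul_I]
    have h3 : ‖((ε : ℂ) + t * s) ^ (-(1 / 2) : ℂ)‖ ≤ t ^ (-(1 / 2) : ℝ) := by
      rw [show (-(1 / 2) : ℂ) = ((-(1 / 2) : ℝ) : ℂ) by push_cast; rfl, Complex.norm_cpow_real]
      exact Real.rpow_le_rpow_of_nonpos ht.1 hn (by norm_num)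
    have h4 := hM _ (hmem ε hε.1.le hε.2 t ⟨ht.1.le, ht.2⟩)
    rw [norm_mul, norm_mul, norm_mul, h2, mul_one]
    calc _ ≤ 1 * (t ^ (-(1 / 2) : ℝ) * M) := by
          refine mul_le_mul h1 (mul_le_mul h3 h4 (norm_nonneg _) ?_) (by positivity) zero_le_one
          exact Real.rpow_nonneg ht.1.le _
      _ = _ := one_mul _
  · exact (intervalIntegral.intervalIntegrable_rpow' (by norm_num)).mul_const _
  · refine Eventually.of_forall fun t ht => ?_
    rw [hIoc] at ht
    refine Tendsto.const_mul _ ?_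
    have hc : ContinuousAt (fun ε : ℝ => ((ε : ℂ) + t * s) ^ (-(1 / 2) : ℂ) *
        (G (ε + t * s) - G 0)) 0 := by
      refine ContinuousAt.mul ?_ (ContinuousAt.sub ?_ continuousAt_const)
      · exact ContinuousAt.cpow (by fun_prop) continuousAt_const (hslit 0 t ht.1.ne')
      · refine ContinuousAt.comp (g := G) ?_ (by fun_prop)
        refine hG.continuousOn.continuousAt (hU.mem_nhds ?_)
        simpa using hsU t ⟨ht.1.le, ht.2⟩
    have := hc.tendsto
    simp only [Complex.ofReal_zero, zero_add] at this
    exact this.mono_left nhdsWithin_le_nhds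

theorem exists_tendsto_integral_fejer_sub {β : ℝ → ℝ} {c l : ℝ} (hl : 0 < l)
    (hinteg : ∀ ε > 0, IntegrableOn (fun u => β u * Real.exp (-ε * u)) (Ioi 0))
    {G : ℂ → ℂ} {U : Set ℂ} (hU : IsOpen U) (hGd : DifferentiableOn ℂ G U) (hG0 : G 0 = c)
    (hUl : ∀ t : ℝ, |t| ≤ l → (t : ℂ) * Complex.I ∈ U)
    (hG : ∀ z ∈ U, 0 < z.re → ∫ u in Ioi (0 : ℝ), (β u : ℂ) * Complex.exp (-z * u) =
      z ^ (-(1 / 2) : ℂ) * G z) :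
    ∃ C : ℝ, ∀ v : ℝ, 0 < v → ∃ E : ℝ, |E| ≤ C / v ∧
      Tendsto (fun ε : ℝ => ∫ u in Ioi (0 : ℝ),
        (β u - c / Real.sqrt Real.pi * u ^ (-(1 / 2) : ℝ)) * Real.exp (-ε * u) *
          (l * Real.sinc (l * (v - u) / 2) ^ 2)) (nhdsWithin 0 (Ioi 0)) (nhds E) := by
  have hU1 : ∀ t ∈ Icc 0 l, (t : ℂ) * Complex.I ∈ U := fun t ht =>
    hUl t (by rw [abs_of_nonneg ht.1]; exact ht.2)
  have hU2 : ∀ t ∈ Icc 0 l, (t : ℂ) * -Complex.I ∈ U := fun t ht => by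
    have := hUl (-t) (by rw [abs_neg, abs_of_nonneg ht.1]; exact ht.2)
    simpa using this
  obtain ⟨C1, hC1⟩ := exists_bound_integral_ray hU hGd hl Complex.I_ne_zero hU1
  obtain ⟨C2, hC2⟩ := exists_bound_integral_ray hU hGd hl (neg_ne_zero.2 Complex.I_ne_zero) hU2
  refine ⟨C1 + C2, fun v hv => ?_⟩
  have T1 := tendsto_integral_ray hU hGd hl (s := Complex.I) (by simp) hU1 v
  have T2 := tendsto_integral_ray hU hGd hl (s := -Complex.I) (by simp) hU2 (-v)
  have T := (Complex.continuous_re.tendsto _).comp (T1.add T2)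
  refine ⟨_, ?_, T.congr' ?_⟩
  · refine (Complex.abs_re_le_norm _).trans ((norm_add_le _ _).trans ?_)
    have h1 := hC1 v hv.ne'
    have h2 := hC2 (-v) (neg_ne_zero.2 hv.ne')
    rw [abs_neg] at h2
    rw [abs_of_pos hv] at h1 h2
    rw [add_div]
    exact add_le_add h1 h2
  · have hScomp : IsCompact ((fun t : ℝ => (t : ℂ) * Complex.I) '' Icc (-l) l) :=
      isCompact_Icc.image (by fun_prop)
    have hSU : (fun t : ℝ => (t : ℂ) * Complex.I) '' Icc (-l) l ⊆ U := by
      rintro _ ⟨t, ht, rfl⟩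
      exact hUl t (abs_le.2 ht)
    obtain ⟨δ, hδ, hδU⟩ := hScomp.exists_cthickening_subset_open hU hSU
    filter_upwards [self_mem_nhdsWithin, mem_nhdsWithin_of_mem_nhds (Iic_mem_nhds hδ)] with ε h1 h2
    have hε : 0 < ε := h1
    have hmem : ∀ t ∈ Icc (-l) l, (ε : ℂ) + Complex.I * t ∈ U := by
      intro t ht
      refine hδU (Metric.mem_cthickening_of_dist_le _ ((t : ℂ) * Complex.I) _ _ ⟨t, ht, rfl⟩ ?_)
      rw [dist_eq_norm, mul_comm, add_sub_cancel_right, Complex.norm_real, Real.norm_of_nonneg hε.le]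
      exact h2
    have hre : ∀ t : ℝ, 0 < ((ε : ℂ) + Complex.I * t).re := by intro t; simpa using hε
    have hpi : (Real.sqrt Real.pi) ≠ 0 := (Real.sqrt_pos.2 Real.pi_pos).ne'
    have hp : IntegrableOn (fun u : ℝ => u ^ (-(1 / 2) : ℝ) * Real.exp (-ε * u)) (Ioi 0) := by
      refine integrableOn_rpow_mul_exp_neg_mul_rpow (s := -(1 / 2)) (p := 1) (b := ε) (by norm_num)
        (by norm_num) hε |>.congr_fun (fun u hu => ?_) measurableSet_Ioi
      simp
    have hLap : ∀ t ∈ Icc (-l) l, ∫ u in Ioi (0 : ℝ),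
        ((β u - c / Real.sqrt Real.pi * u ^ (-(1 / 2) : ℝ) : ℝ) : ℂ) *
          Complex.exp (-(ε + Complex.I * t) * u) =
        ((ε : ℂ) + Complex.I * t) ^ (-(1 / 2) : ℂ) * (G (ε + Complex.I * t) - G 0) := by
      intro t ht
      have hbd : ∀ g : ℝ → ℝ, IntegrableOn (fun u => g u * Real.exp (-ε * u)) (Ioi 0) →
          IntegrableOn (fun u => (g u : ℂ) * Complex.exp (-(ε + Complex.I * t) * u)) (Ioi 0) := by
        intro g hg
        have : Integrable (fun u => ((g u * Real.exp (-ε * u) : ℝ) : ℂ) *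
            Complex.exp (-(Complex.I * t) * u)) (volume.restrict (Ioi 0)) := by
          refine Integrable.mul_bdd (c := 1) hg.ofReal
            (Continuous.aestronglyMeasurable (by fun_prop)) ?_
          refine Eventually.of_forall fun u => ?_
          rw [show -(Complex.I * (t : ℂ)) * u = ((-t * u : ℝ) : ℂ) * Complex.I by push_cast; ring,
            Complex.norm_exp_ofReal_mul_I]
        refine this.congr (Eventually.of_forall fun u => ?_)
        simp only [Complex.ofReal_mul, Complex.ofReal_exp, mul_assoc]
        rw [← Complex.exp_add]
        congr 2
        push_cast
        ring
      have i1 := hbd β (hinteg ε hε)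
      have i2 := (hbd _ hp).const_mul ((c / Real.sqrt Real.pi : ℝ) : ℂ)
      have e1 := hG _ (hmem t ht) (hre t)
      have e2 := integral_rpow_neg_half_mul_cexp (hre t)
      calc _ = ∫ u in Ioi (0 : ℝ), ((β u : ℂ) * Complex.exp (-(ε + Complex.I * t) * u) -
            ((c / Real.sqrt Real.pi : ℝ) : ℂ) * (((u ^ (-(1 / 2) : ℝ) : ℝ) : ℂ) *
              Complex.exp (-(ε + Complex.I * t) * u))) := by
            refine setIntegral_congr_fun measurableSet_Ioi fun u _ => ?_
            push_cast
            ring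
        _ = _ := by
            rw [integral_sub i1 i2, e1, integral_const_mul, e2, hG0]
            have : ((Real.sqrt Real.pi : ℝ) : ℂ) ≠ 0 := by exact_mod_cast hpi
            push_cast
            field_simp
    have hD : IntegrableOn (fun u => (β u - c / Real.sqrt Real.pi * u ^ (-(1 / 2) : ℝ)) *
        Real.exp (-ε * u)) (Ioi 0) := by
      refine ((hinteg ε hε).sub (hp.const_mul (c / Real.sqrt Real.pi))).congr
        (Eventually.of_forall fun u => ?_)
      simp only [Pi.sub_apply]
      ring
    have key := integral_mul_fejer_eq_integral_laplace hl hD v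
    have hcont : ContinuousOn (fun t : ℝ => ((1 - |t| / l : ℝ) : ℂ) *
        Complex.exp (Complex.I * t * v) *
        (((ε : ℂ) + Complex.I * t) ^ (-(1 / 2) : ℂ) * (G (ε + Complex.I * t) - G 0)))
        (Icc (-l) l) := by
      refine ContinuousOn.mul (Continuous.continuousOn (by fun_prop)) (ContinuousOn.mul ?_ ?_)
      · intro t ht
        refine ContinuousAt.continuousWithinAt ?_
        exact ContinuousAt.cpow (by fun_prop) continuousAt_const
          (Complex.mem_slitPlane_iff.2 (Or.inl (hre t)))
      · exact ContinuousOn.sub (hGd.continuousOn.comp (Continuous.continuousOn (by fun_prop)) hmem)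
          continuousOn_const
    have key2 : ((∫ u in Ioi (0 : ℝ), (β u - c / Real.sqrt Real.pi * u ^ (-(1 / 2) : ℝ)) *
        Real.exp (-ε * u) * (l * Real.sinc (l * (v - u) / 2) ^ 2) : ℝ) : ℂ) =
        ∫ t in (-l)..l, ((1 - |t| / l : ℝ) : ℂ) *
        Complex.exp (Complex.I * t * v) *
        (((ε : ℂ) + Complex.I * t) ^ (-(1 / 2) : ℂ) * (G (ε + Complex.I * t) - G 0)) := by
      rw [key]
      refine intervalIntegral.integral_congr fun t ht => ?_
      rw [uIcc_of_le (by linarith)] at ht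
      rw [hLap t ht]
    rw [← intervalIntegral.integral_add_adjacent_intervals (b := 0)
      ((hcont.mono (by rw [uIcc_of_le (by linarith)]; exact Icc_subset_Icc le_rfl hl.le)).intervalIntegrable)
      ((hcont.mono (by rw [uIcc_of_le hl.le]; exact Icc_subset_Icc (by linarith) le_rfl)).intervalIntegrable),
      ← neg_zero (G := ℝ), ← intervalIntegral.integral_comp_neg, neg_zero] at key2
    have := congrArg Complex.re key2
    rw [Complex.ofReal_re] at this
    rw [this, Function.comp_apply, add_comm]
    congr 2
    · refine intervalIntegral.integral_congr fun t ht => ?_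
      rw [uIcc_of_le hl.le] at ht
      simp only [abs_neg, abs_of_nonneg ht.1]
      push_cast
      ring_nf
    · refine intervalIntegral.integral_congr fun t ht => ?_
      rw [uIcc_of_le hl.le] at ht
      simp only [abs_of_nonneg ht.1]
      ring_nf

theorem fejer_nonneg {l : ℝ} (hl : 0 < l) (w : ℝ) : 0 ≤ l * Real.sinc (l * w / 2) ^ 2 := by
  positivity

theorem fejer_le {l : ℝ} (hl : 0 < l) (w : ℝ) : l * Real.sinc (l * w / 2) ^ 2 ≤ l + 4 / l := by
  have h1 : Real.sinc (l * w / 2) ^ 2 ≤ 1 := by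
    rw [sq_le_one_iff_abs_le_one]
    exact Real.abs_sinc_le_one _
  have h2 : 0 < 4 / l := by positivity
  nlinarith

theorem fejer_mul_sq_le {l : ℝ} (hl : 0 < l) (w : ℝ) :
    l * Real.sinc (l * w / 2) ^ 2 * w ^ 2 ≤ l + 4 / l := by
  have h2 : 0 < 4 / l := by positivity
  rcases eq_or_ne w 0 with rfl | hw
  · simp only [mul_zero, zero_div, Real.sinc_zero]
    norm_num
    linarith
  · have hlw : l * w / 2 ≠ 0 := by positivity
    rw [Real.sinc_of_ne_zero hlw]
    have : l * (Real.sin (l * w / 2) / (l * w / 2)) ^ 2 * w ^ 2 =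
        4 / l * Real.sin (l * w / 2) ^ 2 := by
      field_simp
      ring
    rw [this]
    nlinarith [Real.sin_sq_le_one (l * w / 2)]

theorem measurable_fejer (l : ℝ) : Measurable fun w : ℝ => l * Real.sinc (l * w / 2) ^ 2 := by
  have := Real.continuous_sinc
  exact Continuous.measurable (by fun_prop)

theorem integrable_fejer {l : ℝ} (hl : 0 < l) :
    Integrable fun w : ℝ => l * Real.sinc (l * w / 2) ^ 2 :=
  integrable_of_le_inv_sq (measurable_fejer l) (fejer_nonneg hl) (fejer_le hl) (fejer_mul_sq_le hl)

theorem integral_fejer {l : ℝ} (hl : 0 < l) :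
    ∫ w : ℝ, l * Real.sinc (l * w / 2) ^ 2 = ∫ w : ℝ, Real.sinc (w / 2) ^ 2 := by
  rw [integral_const_mul, Measure.integral_comp_mul_left (fun w => Real.sinc (w / 2) ^ 2) l,
    abs_of_pos (inv_pos.2 hl), smul_eq_mul, ← mul_assoc, mul_inv_cancel₀ hl.ne', one_mul]

theorem setIntegral_fejer {l : ℝ} (hl : 0 < l) {a : ℝ} (ha : 0 ≤ a) :
    ∫ w in Icc (-a) a, l * Real.sinc (l * w / 2) ^ 2 =
      ∫ w in (-(l * a))..(l * a), Real.sinc (w / 2) ^ 2 := by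
  rw [integral_Icc_eq_integral_Ioc, ← intervalIntegral.integral_of_le (by linarith),
    intervalIntegral.integral_const_mul,
    intervalIntegral.integral_comp_mul_left (fun w => Real.sinc (w / 2) ^ 2) hl.ne', smul_eq_mul,
    ← mul_assoc, mul_inv_cancel₀ hl.ne', one_mul, mul_neg]

theorem integrable_sinc_sq : Integrable fun w : ℝ => Real.sinc (w / 2) ^ 2 := by
  simpa using integrable_fejer one_pos

theorem integral_sinc_sq_pos : 0 < ∫ w : ℝ, Real.sinc (w / 2) ^ 2 := by
  have := Real.continuous_sinc
  refine integral_pos_of_integrable_nonneg_nonzero (x := 0) (by fun_prop) integrable_sinc_sq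
    (fun w => sq_nonneg _) ?_
  simp

/-- Smoothed limit of a function compared against `κ u ^ (-1/2)`. -/
theorem exists_tendsto_integral_fejer {β : ℝ → ℝ} {c l : ℝ} (hl : 0 < l)
    (hinteg : ∀ ε > 0, IntegrableOn (fun u => β u * Real.exp (-ε * u)) (Ioi 0))
    {G : ℂ → ℂ} {U : Set ℂ} (hU : IsOpen U) (hGd : DifferentiableOn ℂ G U) (hG0 : G 0 = c)
    (hUl : ∀ t : ℝ, |t| ≤ l → (t : ℂ) * Complex.I ∈ U)
    (hG : ∀ z ∈ U, 0 < z.re → ∫ u in Ioi (0 : ℝ), (β u : ℂ) * Complex.exp (-z * u) =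
      z ^ (-(1 / 2) : ℂ) * G z) :
    ∃ Λ : ℝ → ℝ, (∀ v : ℝ, 0 < v → Tendsto (fun ε : ℝ => ∫ u in Ioi (0 : ℝ),
        β u * Real.exp (-ε * u) * (l * Real.sinc (l * (v - u) / 2) ^ 2))
          (nhdsWithin 0 (Ioi 0)) (nhds (Λ v))) ∧
      Tendsto (fun v => Real.sqrt v * Λ v) atTop
        (nhds (c / Real.sqrt Real.pi * ∫ w : ℝ, Real.sinc (w / 2) ^ 2)) := by
  obtain ⟨C, hC⟩ := exists_tendsto_integral_fejer_sub hl hinteg hU hGd hG0 hUl hG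
  choose! E hE1 hE2 using hC
  obtain ⟨hJ1, hJ2⟩ := tendsto_sqrt_mul_integral_rpow_neg_half (measurable_fejer l)
    (fejer_nonneg hl) (fejer_le hl) (fejer_mul_sq_le hl)
  set κ := c / Real.sqrt Real.pi
  refine ⟨fun v => E v + κ * ∫ u in Ioi (0 : ℝ), u ^ (-(1 / 2) : ℝ) *
    (l * Real.sinc (l * (v - u) / 2) ^ 2), fun v hv => ?_, ?_⟩
  · have hlim : Tendsto (fun ε : ℝ => ∫ u in Ioi (0 : ℝ), Real.exp (-ε * u) * (u ^ (-(1 / 2) : ℝ) *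
        (l * Real.sinc (l * (v - u) / 2) ^ 2))) (nhdsWithin 0 (Ioi 0))
        (nhds (∫ u in Ioi (0 : ℝ), u ^ (-(1 / 2) : ℝ) *
          (l * Real.sinc (l * (v - u) / 2) ^ 2))) := by
      refine tendsto_integral_filter_of_dominated_convergence _ ?_ ?_ (hJ1 v) ?_
      · refine Eventually.of_forall fun ε => ?_
        exact ((Continuous.aestronglyMeasurable (by fun_prop)).mul (hJ1 v).aestronglyMeasurable)
      · filter_upwards [self_mem_nhdsWithin] with ε hε
        refine (ae_restrict_iff' measurableSet_Ioi).2 (Eventually.of_forall fun u hu => ?_)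
        have hu' : 0 < u := hu
        have hε' : 0 < ε := hε
        have h0 : 0 ≤ u ^ (-(1 / 2) : ℝ) * (l * Real.sinc (l * (v - u) / 2) ^ 2) :=
          mul_nonneg (Real.rpow_nonneg hu'.le _) (fejer_nonneg hl _)
        rw [Real.norm_of_nonneg (mul_nonneg (Real.exp_pos _).le h0)]
        refine mul_le_of_le_one_left h0 (Real.exp_le_one_iff.2 ?_)
        nlinarith
      · refine Eventually.of_forall fun u => ?_
        have : Tendsto (fun ε : ℝ => Real.exp (-ε * u) * (u ^ (-(1 / 2) : ℝ) *
            (l * Real.sinc (l * (v - u) / 2) ^ 2))) (nhds 0) (nhds (Real.exp (-0 * u) *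
            (u ^ (-(1 / 2) : ℝ) * (l * Real.sinc (l * (v - u) / 2) ^ 2)))) :=
          Continuous.tendsto (by fun_prop) 0
        simp only [neg_zero, zero_mul, Real.exp_zero, one_mul] at this
        exact this.mono_left nhdsWithin_le_nhds
    refine ((hE2 v hv).add (hlim.const_mul κ)).congr' ?_
    filter_upwards [self_mem_nhdsWithin] with ε hε
    have hε' : 0 < ε := hε
    have hk : ∀ g : ℝ → ℝ, IntegrableOn g (Ioi 0) → IntegrableOn
        (fun u => g u * (l * Real.sinc (l * (v - u) / 2) ^ 2)) (Ioi 0) := by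
      intro g hg
      refine Integrable.mul_bdd (c := l + 4 / l) hg ?_ (Eventually.of_forall fun u => ?_)
      · exact ((measurable_fejer l).comp (measurable_const.sub measurable_id)).aestronglyMeasurable
      · rw [Real.norm_of_nonneg (fejer_nonneg hl _)]
        exact fejer_le hl _
    have hp : IntegrableOn (fun u : ℝ => u ^ (-(1 / 2) : ℝ) * Real.exp (-ε * u)) (Ioi 0) := by
      refine integrableOn_rpow_mul_exp_neg_mul_rpow (s := -(1 / 2)) (p := 1) (b := ε) (by norm_num)
        (by norm_num) hε' |>.congr_fun (fun u hu => ?_) measurableSet_Ioi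
      simp
    rw [← integral_const_mul, ← integral_add]
    · refine integral_congr_ae (Eventually.of_forall fun u => ?_)
      simp only
      ring
    · refine hk _ (((hinteg ε hε').sub (hp.const_mul κ)).congr (Eventually.of_forall fun u => ?_))
      simp only [Pi.sub_apply]
      ring
    · refine ((hk _ hp).const_mul κ).congr (Eventually.of_forall fun u => ?_)
      simp only
      ring
  · have h1 : Tendsto (fun v => Real.sqrt v * E v) atTop (nhds 0) := by
      have hlim : Tendsto (fun v : ℝ => C / Real.sqrt v) atTop (nhds 0) :=
        tendsto_const_nhds.div_atTop Real.tendsto_sqrt_atTop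
      refine squeeze_zero_norm' ?_ hlim
      filter_upwards [eventually_gt_atTop 0] with v hv
      rw [norm_mul, Real.norm_of_nonneg (Real.sqrt_nonneg _), Real.norm_eq_abs]
      calc _ ≤ Real.sqrt v * (C / v) := mul_le_mul_of_nonneg_left (hE1 v hv) (Real.sqrt_nonneg _)
        _ = C / Real.sqrt v := by
          have h2 : Real.sqrt v ≠ 0 := (Real.sqrt_pos.2 hv).ne'
          nth_rewrite 2 [← Real.mul_self_sqrt hv.le]
          field_simp
    have h2 := h1.add (hJ2.const_mul κ)
    rw [zero_add, integral_fejer hl] at h2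
    refine h2.congr fun v => ?_
    ring

theorem mul_setIntegral_le_of_tendsto {β g Λ : ℝ → ℝ} {M : ℝ} (hβ0 : ∀ u, 0 ≤ β u)
    (hmono : MonotoneOn (fun u => β u * Real.exp u) (Ici 0))
    (hinteg : ∀ ε > 0, IntegrableOn (fun u => β u * Real.exp (-ε * u)) (Ioi 0))
    (hgm : Measurable g) (hg0 : ∀ w, 0 ≤ g w) (hgM : ∀ w, g w ≤ M)
    (hΛ : ∀ v : ℝ, 0 < v → Tendsto (fun ε : ℝ => ∫ u in Ioi (0 : ℝ),
        β u * Real.exp (-ε * u) * g (v - u)) (nhdsWithin 0 (Ioi 0)) (nhds (Λ v)))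
    {a v : ℝ} (ha : 0 < a) (hv : 0 < v) :
    β v * (Real.exp (-(2 * a)) * ∫ w in Icc (-a) a, g w) ≤ Λ (v + a) := by
  have hgi : IntegrableOn g (Icc (-a) a) := by
    refine Measure.integrableOn_of_bounded (M := M) measure_Icc_lt_top.ne hgm.aestronglyMeasurable ?_
    exact Eventually.of_forall fun w => by rw [Real.norm_of_nonneg (hg0 w)]; exact hgM w
  have hgi' : IntegrableOn (fun u => g (v + a - u)) (Icc v (v + 2 * a)) := by
    refine Measure.integrableOn_of_bounded (M := M) measure_Icc_lt_top.ne
      (hgm.comp (measurable_const.sub measurable_id)).aestronglyMeasurable ?_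
    exact Eventually.of_forall fun w => by rw [Real.norm_of_nonneg (hg0 _)]; exact hgM _
  have hshift : ∫ u in Icc v (v + 2 * a), g (v + a - u) = ∫ w in Icc (-a) a, g w := by
    rw [integral_Icc_eq_integral_Ioc, integral_Icc_eq_integral_Ioc,
      ← intervalIntegral.integral_of_le (by linarith), ← intervalIntegral.integral_of_le (by linarith),
      intervalIntegral.integral_comp_sub_left]
    congr 1 <;> ring
  have hle : ∀ ε > 0, Real.exp (-ε * (v + 2 * a)) *
      (β v * (Real.exp (-(2 * a)) * ∫ w in Icc (-a) a, g w)) ≤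
      ∫ u in Ioi (0 : ℝ), β u * Real.exp (-ε * u) * g (v + a - u) := by
    intro ε hε
    have hi : IntegrableOn (fun u => β u * Real.exp (-ε * u) * g (v + a - u)) (Ioi 0) := by
      refine Integrable.mul_bdd (c := M) (hinteg ε hε)
        (hgm.comp (measurable_const.sub measurable_id)).aestronglyMeasurable ?_
      exact Eventually.of_forall fun w => by rw [Real.norm_of_nonneg (hg0 _)]; exact hgM _
    have hsub : Icc v (v + 2 * a) ⊆ Ioi 0 := fun u hu => lt_of_lt_of_le hv hu.1
    calc _ = ∫ u in Icc v (v + 2 * a), Real.exp (-ε * (v + 2 * a)) *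
          (β v * Real.exp (-(2 * a))) * g (v + a - u) := by
          rw [integral_const_mul, hshift]; ring
      _ ≤ ∫ u in Icc v (v + 2 * a), β u * Real.exp (-ε * u) * g (v + a - u) := by
          refine setIntegral_mono_on (hgi'.const_mul _) (hi.mono_set hsub) measurableSet_Icc
            fun u hu => ?_
          refine mul_le_mul_of_nonneg_right ?_ (hg0 _)
          rw [mul_comm]
          have h1 : β v * Real.exp v ≤ β u * Real.exp u := hmono hv.le (mem_Ici.2 (hv.le.trans hu.1)) hu.1
          have h2 : β v * Real.exp (-(2 * a)) ≤ β u := by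
            have h3 : β v * Real.exp (-(2 * a)) ≤ β v * Real.exp (v - u) :=
              mul_le_mul_of_nonneg_left (Real.exp_le_exp.2 (by linarith [hu.2])) (hβ0 v)
            refine h3.trans ?_
            rw [Real.exp_sub, ← mul_div_assoc, div_le_iff₀ (Real.exp_pos _)]
            exact h1
          refine mul_le_mul h2 (Real.exp_le_exp.2 ?_) (Real.exp_pos _).le (hβ0 u)
          nlinarith [hu.2]
      _ ≤ _ := by
          refine setIntegral_mono_set hi ?_ hsub.eventuallyLE
          exact Eventually.of_forall fun u =>
            mul_nonneg (mul_nonneg (hβ0 u) (Real.exp_pos _).le) (hg0 _)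
  have hlim : Tendsto (fun ε : ℝ => Real.exp (-ε * (v + 2 * a)) *
      (β v * (Real.exp (-(2 * a)) * ∫ w in Icc (-a) a, g w))) (nhdsWithin 0 (Ioi 0))
      (nhds (Real.exp (-0 * (v + 2 * a)) *
      (β v * (Real.exp (-(2 * a)) * ∫ w in Icc (-a) a, g w)))) :=
    (Continuous.tendsto (by fun_prop) 0).mono_left nhdsWithin_le_nhds
  simp only [neg_zero, zero_mul, Real.exp_zero, one_mul] at hlim
  refine le_of_tendsto_of_tendsto hlim (hΛ (v + a) (by linarith)) ?_
  filter_upwards [self_mem_nhdsWithin] with ε hε using hle ε hε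

theorem le_mul_setIntegral_add_of_tendsto {β g Λ : ℝ → ℝ} {M B : ℝ} (hβ0 : ∀ u, 0 ≤ β u)
    (hmono : MonotoneOn (fun u => β u * Real.exp u) (Ici 0))
    (hinteg : ∀ ε > 0, IntegrableOn (fun u => β u * Real.exp (-ε * u)) (Ioi 0))
    (hgm : Measurable g) (hg0 : ∀ w, 0 ≤ g w) (hgM : ∀ w, g w ≤ M)
    (hgM' : ∀ w, g w * w ^ 2 ≤ M)
    (hΛ : ∀ v : ℝ, 0 < v → Tendsto (fun ε : ℝ => ∫ u in Ioi (0 : ℝ),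
        β u * Real.exp (-ε * u) * g (v - u)) (nhdsWithin 0 (Ioi 0)) (nhds (Λ v)))
    (hB : ∀ u > 0, β u ≤ B * u ^ (-(1 / 2) : ℝ))
    {a v : ℝ} (ha : 0 < a) (hv : 2 * a < v) :
    Λ (v - a) ≤ β v * (Real.exp (2 * a) * ∫ w in Icc (-a) a, g w) +
      B * ∫ u in Ioi (0 : ℝ), u ^ (-(1 / 2) : ℝ) * (Icc (-a) a)ᶜ.indicator g (v - a - u) := by
  have hgi : Integrable g := integrable_of_le_inv_sq hgm hg0 hgM hgM'
  have hi0 : Integrable ((Icc (-a) a).indicator g) := hgi.indicator measurableSet_Icc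
  have hJ := (tendsto_sqrt_mul_integral_rpow_neg_half (M := M)
    (g := (Icc (-a) a)ᶜ.indicator g) (hgm.indicator measurableSet_Icc.compl)
    (fun w => indicator_nonneg (fun w _ => hg0 w) w)
    (fun w => (indicator_le_self' (fun w _ => hg0 w) w).trans (hgM w))
    (fun w => (mul_le_mul_of_nonneg_right (indicator_le_self' (fun w _ => hg0 w) w)
      (sq_nonneg w)).trans (hgM' w))).1 (v - a)
  have hle : ∀ ε > 0, ∫ u in Ioi (0 : ℝ), β u * Real.exp (-ε * u) * g (v - a - u) ≤
      β v * (Real.exp (2 * a) * ∫ w in Icc (-a) a, g w) +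
      B * ∫ u in Ioi (0 : ℝ), u ^ (-(1 / 2) : ℝ) * (Icc (-a) a)ᶜ.indicator g (v - a - u) := by
    intro ε hε
    have hi : IntegrableOn (fun u => β u * Real.exp (-ε * u) * g (v - a - u)) (Ioi 0) := by
      refine Integrable.mul_bdd (c := M) (hinteg ε hε)
        (hgm.comp (measurable_const.sub measurable_id)).aestronglyMeasurable ?_
      exact Eventually.of_forall fun w => by rw [Real.norm_of_nonneg (hg0 _)]; exact hgM _
    have hi1 : Integrable (fun u => (Icc (-a) a).indicator g (v - a - u)) :=
      hi0.comp_sub_left (v - a)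
    calc _ ≤ ∫ u in Ioi (0 : ℝ), ((β v * Real.exp (2 * a)) * (Icc (-a) a).indicator g (v - a - u) +
          B * (u ^ (-(1 / 2) : ℝ) * (Icc (-a) a)ᶜ.indicator g (v - a - u))) := by
          refine setIntegral_mono_on hi ((hi1.integrableOn.const_mul _).add (hJ.const_mul _))
            measurableSet_Ioi fun u hu => ?_
          have hu0 : 0 < u := hu
          have he : Real.exp (-ε * u) ≤ 1 := Real.exp_le_one_iff.2 (by nlinarith)
          have h0 : β u * Real.exp (-ε * u) * g (v - a - u) ≤ β u * g (v - a - u) :=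
            mul_le_mul_of_nonneg_right (mul_le_of_le_one_right (hβ0 u) he) (hg0 _)
          refine h0.trans ?_
          by_cases hw : v - a - u ∈ Icc (-a) a
          · have hw' : v - a - u ∉ (Icc (-a) a)ᶜ := fun h => h hw
            rw [indicator_of_mem hw, indicator_of_notMem hw', mul_zero, mul_zero, add_zero]
            refine mul_le_mul_of_nonneg_right ?_ (hg0 _)
            have h1 : β u * Real.exp u ≤ β v * Real.exp v :=
              hmono hu0.le (by simp only [mem_Ici]; linarith) (by linarith [hw.1])
            have h3 : β v * Real.exp (v - u) ≤ β v * Real.exp (2 * a) :=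
              mul_le_mul_of_nonneg_left (Real.exp_le_exp.2 (by linarith [hw.2])) (hβ0 v)
            refine le_trans ?_ h3
            rw [Real.exp_sub, ← mul_div_assoc, le_div_iff₀ (Real.exp_pos _)]
            exact h1
          · have hw' : v - a - u ∈ (Icc (-a) a)ᶜ := hw
            rw [indicator_of_notMem hw, indicator_of_mem hw', mul_zero, zero_add, ← mul_assoc]
            exact mul_le_mul_of_nonneg_right (hB u hu0) (hg0 _)
      _ = (β v * Real.exp (2 * a)) * (∫ u in Ioi (0 : ℝ), (Icc (-a) a).indicator g (v - a - u)) +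
          B * ∫ u in Ioi (0 : ℝ), u ^ (-(1 / 2) : ℝ) * (Icc (-a) a)ᶜ.indicator g (v - a - u) := by
          rw [integral_add (hi1.integrableOn.const_mul _) (hJ.const_mul _), integral_const_mul,
            integral_const_mul]
      _ ≤ _ := by
          rw [← mul_assoc]
          refine add_le_add (mul_le_mul_of_nonneg_left ?_
            (mul_nonneg (hβ0 v) (Real.exp_pos _).le)) le_rfl
          calc _ ≤ ∫ u, (Icc (-a) a).indicator g (v - a - u) :=
                setIntegral_le_integral hi1 (Eventually.of_forall fun u =>
                  indicator_nonneg (fun w _ => hg0 w) _)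
            _ = _ := by
                rw [integral_sub_left_eq_self (fun w => (Icc (-a) a).indicator g w) volume (v - a),
                  integral_indicator measurableSet_Icc]
  refine le_of_tendsto (hΛ (v - a) (by linarith)) ?_
  filter_upwards [self_mem_nhdsWithin] with ε hε using hle ε hε

theorem tendsto_sqrt_add_mul {Λ : ℝ → ℝ} {L : ℝ} (h : Tendsto (fun v => Real.sqrt v * Λ v) atTop (nhds L))
    (a : ℝ) : Tendsto (fun v => Real.sqrt v * Λ (v + a)) atTop (nhds L) := by
  have h1 : Tendsto (fun v : ℝ => Real.sqrt (1 - a / v)) atTop (nhds (Real.sqrt (1 - 0))) :=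
    (Real.continuous_sqrt.tendsto _).comp
      (tendsto_const_nhds.sub (tendsto_const_nhds.div_atTop tendsto_id))
  rw [sub_zero, Real.sqrt_one] at h1
  have h2 := (h1.mul h).comp (tendsto_atTop_add_const_right atTop a tendsto_id)
  rw [one_mul] at h2
  refine h2.congr' ?_
  filter_upwards [eventually_gt_atTop 0, eventually_gt_atTop (-a)] with v hv hva
  have hva' : 0 < v + a := by linarith
  simp only [Function.comp_apply, id]
  rw [← mul_assoc, ← Real.sqrt_mul' _ hva'.le]
  congr 2
  field_simp
  ring

/-- A Tauberian theorem of Wiener, Ikehara and Delange, with a singularity of exponent `1/2`. -/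
theorem tendsto_sqrt_mul_of_laplace {β : ℝ → ℝ} {c : ℝ} (hβ0 : ∀ u, 0 ≤ β u)
    (hmono : MonotoneOn (fun u => β u * Real.exp u) (Ici 0))
    (hinteg : ∀ ε > 0, IntegrableOn (fun u => β u * Real.exp (-ε * u)) (Ioi 0))
    (hG : ∀ T : ℝ, 0 < T → ∃ (U : Set ℂ) (G : ℂ → ℂ), IsOpen U ∧ DifferentiableOn ℂ G U ∧
      G 0 = c ∧ (∀ t : ℝ, |t| ≤ T → (t : ℂ) * Complex.I ∈ U) ∧
      ∀ z ∈ U, 0 < z.re → ∫ u in Ioi (0 : ℝ), (β u : ℂ) * Complex.exp (-z * u) =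
        z ^ (-(1 / 2) : ℂ) * G z) :
    Tendsto (fun v => Real.sqrt v * β v) atTop (nhds (c / Real.sqrt Real.pi)) := by
  set κ := c / Real.sqrt Real.pi
  set k0 := ∫ w : ℝ, Real.sinc (w / 2) ^ 2
  have hk0 : 0 < k0 := integral_sinc_sq_pos
  have hA : Tendsto (fun x : ℝ => ∫ w in (-x)..x, Real.sinc (w / 2) ^ 2) atTop (nhds k0) :=
    intervalIntegral_tendsto_integral integrable_sinc_sq tendsto_neg_atTop_atBot tendsto_id
  have hexp : ∀ b : ℝ, Tendsto (fun x : ℝ => Real.exp (b * x⁻¹)) atTop (nhds 1) := by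
    intro b
    have := (Real.continuous_exp.tendsto (b * 0)).comp (tendsto_inv_atTop_zero.const_mul b)
    simpa [Function.comp_def] using this
  have hFe : ∀ x : ℝ, 0 < x → ∫ w in Icc (-x⁻¹) x⁻¹, x ^ 2 * Real.sinc (x ^ 2 * w / 2) ^ 2 =
      ∫ w in (-x)..x, Real.sinc (w / 2) ^ 2 := by
    intro x hx
    rw [setIntegral_fejer (by positivity) (by positivity)]
    congr 2 <;> field_simp
  have upper : ∀ m, κ < m → ∀ᶠ v in atTop, Real.sqrt v * β v < m := by
    intro m hm
    have h1 : Tendsto (fun x : ℝ => m * (Real.exp (-2 * x⁻¹) *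
        ∫ w in (-x)..x, Real.sinc (w / 2) ^ 2)) atTop (nhds (m * (1 * k0))) :=
      ((hexp (-2)).mul hA).const_mul m
    have h2 : κ * k0 < m * (1 * k0) := by nlinarith
    obtain ⟨x, hx1, hx2, hx0⟩ := ((h1.eventually (lt_mem_nhds h2)).and
      ((hA.eventually (lt_mem_nhds hk0)).and (eventually_gt_atTop 0))).exists
    have hl : 0 < x ^ 2 := by positivity
    obtain ⟨U, G, hU, hGd, hG0, hUl, hGe⟩ := hG (x ^ 2) hl
    obtain ⟨Λ, hΛ1, hΛ2⟩ := exists_tendsto_integral_fejer hl hinteg hU hGd hG0 hUl hGe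
    have h3 := tendsto_sqrt_add_mul hΛ2 x⁻¹
    filter_upwards [h3.eventually (gt_mem_nhds hx1), eventually_gt_atTop 0] with v hv1 hv0
    have h4 := mul_setIntegral_le_of_tendsto hβ0 hmono hinteg (measurable_fejer _) (fejer_nonneg hl)
      (fejer_le hl) hΛ1 (inv_pos.2 hx0) hv0
    rw [hFe x hx0, ← neg_mul] at h4
    have h5 := (mul_le_mul_of_nonneg_left h4 (Real.sqrt_nonneg v)).trans_lt hv1
    rw [← mul_assoc] at h5
    exact lt_of_mul_lt_mul_right h5 (mul_nonneg (Real.exp_pos _).le hx2.le)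
  obtain ⟨B, hB⟩ : ∃ B, ∀ u > 0, β u ≤ B * u ^ (-(1 / 2) : ℝ) := by
    obtain ⟨v0, hv0⟩ := eventually_atTop.1 (upper (κ + 1) (by linarith))
    refine ⟨max (κ + 1) (Real.sqrt (max v0 1) * (β (max v0 1) * Real.exp (max v0 1))),
      fun u hu => ?_⟩
    have hsu : 0 < Real.sqrt u := Real.sqrt_pos.2 hu
    rw [Real.rpow_neg hu.le, ← Real.sqrt_eq_rpow, ← div_eq_mul_inv, le_div_iff₀ hsu, mul_comm]
    rcases le_total v0 u with h | h
    · exact (hv0 u h).le.trans (le_max_left _ _)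
    · refine le_trans ?_ (le_max_right _ _)
      have h1 : u ≤ max v0 1 := h.trans (le_max_left _ _)
      refine mul_le_mul (Real.sqrt_le_sqrt h1) ?_ (hβ0 u) (Real.sqrt_nonneg _)
      refine le_trans ?_ (hmono (mem_Ici.2 hu.le) (mem_Ici.2 (hu.le.trans h1)) h1)
      exact le_mul_of_one_le_right (hβ0 u) (Real.one_le_exp hu.le)
  have lower : ∀ m, m < κ → ∀ᶠ v in atTop, m < Real.sqrt v * β v := by
    intro m hm
    have h1 : Tendsto (fun x : ℝ => m * (Real.exp (2 * x⁻¹) *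
        ∫ w in (-x)..x, Real.sinc (w / 2) ^ 2) + B * (k0 - ∫ w in (-x)..x, Real.sinc (w / 2) ^ 2))
        atTop (nhds (m * (1 * k0) + B * (k0 - k0))) :=
      (((hexp 2).mul hA).const_mul m).add ((hA.const_sub k0).const_mul B)
    have h2 : m * (1 * k0) + B * (k0 - k0) < κ * k0 := by nlinarith
    obtain ⟨x, hx1, hx2, hx0⟩ := ((h1.eventually (gt_mem_nhds h2)).and
      ((hA.eventually (lt_mem_nhds hk0)).and (eventually_gt_atTop 0))).exists
    have hl : 0 < x ^ 2 := by positivity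
    obtain ⟨U, G, hU, hGd, hG0, hUl, hGe⟩ := hG (x ^ 2) hl
    obtain ⟨Λ, hΛ1, hΛ2⟩ := exists_tendsto_integral_fejer hl hinteg hU hGd hG0 hUl hGe
    set g : ℝ → ℝ := fun w => x ^ 2 * Real.sinc (x ^ 2 * w / 2) ^ 2 with hg
    have hJ := (tendsto_sqrt_mul_integral_rpow_neg_half (M := x ^ 2 + 4 / x ^ 2)
      (g := (Icc (-x⁻¹) x⁻¹)ᶜ.indicator g)
      ((measurable_fejer (x ^ 2)).indicator measurableSet_Icc.compl)
      (fun w => indicator_nonneg (fun w _ => fejer_nonneg hl w) w)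
      (fun w => (indicator_le_self' (fun w _ => fejer_nonneg hl w) w).trans (fejer_le hl w))
      (fun w => (mul_le_mul_of_nonneg_right (indicator_le_self' (fun w _ => fejer_nonneg hl w) w)
        (sq_nonneg w)).trans (fejer_mul_sq_le hl w))).2
    have hJv : ∫ w, (Icc (-x⁻¹) x⁻¹)ᶜ.indicator g w =
        k0 - ∫ w in (-x)..x, Real.sinc (w / 2) ^ 2 := by
      rw [integral_indicator measurableSet_Icc.compl,
        setIntegral_compl measurableSet_Icc (integrable_fejer hl), hFe x hx0, integral_fejer hl]
    rw [hJv] at hJ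
    have h3 := (tendsto_sqrt_add_mul hΛ2 (-x⁻¹)).sub
      ((tendsto_sqrt_add_mul hJ (-x⁻¹)).const_mul B)
    have h6 := h3.eventually (lt_mem_nhds (lt_sub_iff_add_lt.2 hx1))
    filter_upwards [h6, eventually_gt_atTop (2 * x⁻¹)] with v hv1 hv0
    have h4 := le_mul_setIntegral_add_of_tendsto hβ0 hmono hinteg (measurable_fejer _)
      (fejer_nonneg hl) (fejer_le hl) (fejer_mul_sq_le hl) hΛ1 hB (inv_pos.2 hx0) hv0
    rw [hFe x hx0] at h4
    have h5 := mul_le_mul_of_nonneg_left h4 (Real.sqrt_nonneg v)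
    simp only [← sub_eq_add_neg] at hv1
    refine lt_of_mul_lt_mul_right ?_ (mul_nonneg (Real.exp_pos (2 * x⁻¹)).le hx2.le)
    refine lt_of_lt_of_le hv1 ?_
    rw [sub_le_iff_le_add]
    refine h5.trans (le_of_eq ?_)
    ring
  exact tendsto_order.2 ⟨lower, upper⟩

theorem exists_sum_le_rpow_of_LSeriesSummable {f : ℕ → ℝ} (hf : ∀ n, 0 ≤ f n) {r : ℝ}
    (hr : 0 ≤ r) (hs : LSeriesSummable (fun n => (f n : ℂ)) r) :
    ∃ C : ℝ, 0 ≤ C ∧ ∀ n : ℕ, ∑ k ∈ Finset.Icc 1 n, f k ≤ C * (n : ℝ) ^ r := by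
  refine ⟨∑' n, ‖LSeries.term (fun n => (f n : ℂ)) r n‖, tsum_nonneg fun _ => norm_nonneg _,
    fun n => ?_⟩
  calc _ ≤ ∑ k ∈ Finset.Icc 1 n, ‖LSeries.term (fun n => (f n : ℂ)) r k‖ * (n : ℝ) ^ r := by
        refine Finset.sum_le_sum fun k hk => ?_
        rw [Finset.mem_Icc] at hk
        have hk0 : (0 : ℝ) < k := by exact_mod_cast hk.1
        rw [LSeries.norm_term_eq, if_neg (by omega), Complex.norm_real, Real.norm_of_nonneg (hf k),
          Complex.ofReal_re, div_mul_eq_mul_div, le_div_iff₀ (Real.rpow_pos_of_pos hk0 _)]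
        exact mul_le_mul_of_nonneg_left (Real.rpow_le_rpow hk0.le (by exact_mod_cast hk.2) hr) (hf k)
    _ ≤ _ := by
        rw [← Finset.sum_mul]
        refine mul_le_mul_of_nonneg_right ?_ (by positivity)
        exact hs.norm.sum_le_tsum _ fun _ _ => norm_nonneg _

theorem tendsto_sqrt_log_mul_sum {f : ℕ → ℝ} (hf : ∀ n, 0 ≤ f n) {c : ℝ}
    (hs : ∀ s : ℝ, 1 < s → LSeriesSummable (fun n => (f n : ℂ)) s)
    (hH : ∀ T : ℝ, 0 < T → ∃ (U : Set ℂ) (H : ℂ → ℂ), IsOpen U ∧ DifferentiableOn ℂ H U ∧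
      H 1 = c ∧ (∀ t : ℝ, |t| ≤ T → 1 + (t : ℂ) * Complex.I ∈ U) ∧
      ∀ s ∈ U, 1 < s.re → LSeries (fun n => (f n : ℂ)) s = (s - 1) ^ (-(1 / 2) : ℂ) * H s) :
    Tendsto (fun x : ℝ => Real.sqrt (Real.log x) * ((∑ k ∈ Finset.Icc 1 ⌊x⌋₊, f k) / x)) atTop
      (nhds (c / Real.sqrt Real.pi)) := by
  set S : ℝ → ℝ := fun t => ∑ k ∈ Finset.Icc 1 ⌊t⌋₊, f k with hS
  have hS0 : ∀ t, 0 ≤ S t := fun t => Finset.sum_nonneg fun k _ => hf k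
  have hSm : Monotone S := fun t t' h => Finset.sum_le_sum_of_subset_of_nonneg
    (Finset.Icc_subset_Icc le_rfl (Nat.floor_mono h)) fun k _ _ => hf k
  set β : ℝ → ℝ := fun u => Real.exp (-u) * S (Real.exp u) with hβ
  have hβm : Measurable β :=
    (by fun_prop : Measurable fun u : ℝ => Real.exp (-u)).mul
      (hSm.measurable.comp Real.measurable_exp)
  have key : Tendsto (fun v => Real.sqrt v * β v) atTop (nhds (c / Real.sqrt Real.pi)) := by
    refine tendsto_sqrt_mul_of_laplace (fun u => mul_nonneg (Real.exp_pos _).le (hS0 _)) ?_ ?_ ?_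
    · have : (fun u => β u * Real.exp u) = fun u => S (Real.exp u) := by
        funext u
        simp only [hβ]
        rw [mul_right_comm, ← Real.exp_add]
        simp
      rw [this]
      exact (hSm.comp Real.exp_monotone).monotoneOn _
    · intro ε hε
      obtain ⟨C, hC0, hC⟩ := exists_sum_le_rpow_of_LSeriesSummable hf (r := 1 + ε / 2)
        (by linarith) (hs _ (by linarith))
      have h1 : IntegrableOn (fun u => C * Real.exp (-(ε / 2) * u)) (Ioi 0) :=
        (exp_neg_integrableOn_Ioi 0 (by linarith)).const_mul C
      refine Integrable.mono' h1 (hβm.mul (by fun_prop)).aestronglyMeasurable ?_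
      refine Eventually.of_forall fun u => ?_
      rw [Real.norm_of_nonneg (mul_nonneg (mul_nonneg (Real.exp_pos _).le (hS0 _))
        (Real.exp_pos _).le)]
      have h2 : S (Real.exp u) ≤ C * Real.exp ((1 + ε / 2) * u) := by
        refine (hC _).trans (mul_le_mul_of_nonneg_left ?_ hC0)
        rw [mul_comm, Real.exp_mul]
        exact Real.rpow_le_rpow (Nat.cast_nonneg _) (Nat.floor_le (Real.exp_pos u).le) (by linarith)
      calc β u * Real.exp (-ε * u)
          ≤ Real.exp (-u) * (C * Real.exp ((1 + ε / 2) * u)) * Real.exp (-ε * u) :=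
            mul_le_mul_of_nonneg_right (mul_le_mul_of_nonneg_left h2 (Real.exp_pos _).le)
              (Real.exp_pos _).le
        _ = C * (Real.exp (-u) * Real.exp ((1 + ε / 2) * u) * Real.exp (-ε * u)) := by ring
        _ = _ := by
            rw [← Real.exp_add, ← Real.exp_add]
            congr 2
            ring
    · intro T hT
      obtain ⟨U, H, hU, hHd, hH1, hUT, hHs⟩ := hH T hT
      refine ⟨(fun z => 1 + z) ⁻¹' (U ∩ {0}ᶜ), fun z => H (1 + z) / (1 + z),
        (hU.inter isOpen_compl_singleton).preimage (by fun_prop), ?_, by simp [hH1], ?_, ?_⟩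
      · refine DifferentiableOn.div (hHd.comp (by fun_prop) fun z hz => hz.1) (by fun_prop) ?_
        exact fun z hz => hz.2
      · intro t ht
        refine ⟨hUT t ht, fun h => ?_⟩
        have := congrArg Complex.re h
        simp at this
      · intro z hz hz0
        have hs1 : 1 < (1 + z).re := by simpa using hz0
        have e1 := hHs (1 + z) hz.1 hs1
        obtain ⟨r, hr1, hr2⟩ := exists_between hs1
        have hr0 : 0 ≤ r := by linarith
        obtain ⟨C, hC0, hC⟩ := exists_sum_le_rpow_of_LSeriesSummable hf hr0 (hs r hr1)
        have hO : (fun n : ℕ => ∑ k ∈ Finset.Icc 1 n, f k) =O[atTop] fun n => (n : ℝ) ^ r := by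
          refine Asymptotics.IsBigO.of_bound C (Eventually.of_forall fun n => ?_)
          rw [Real.norm_of_nonneg (Finset.sum_nonneg fun k _ => hf k),
            Real.norm_of_nonneg (by positivity)]
          exact hC n
        have e2 := LSeries_eq_mul_integral_of_nonneg f hr0 hr2 hO hf
        have himg : Real.exp '' Ioi 0 = Ioi 1 := by
          ext y
          simp only [mem_image, mem_Ioi]
          constructor
          · rintro ⟨u, hu, rfl⟩
            exact Real.one_lt_exp_iff.2 hu
          · intro hy
            exact ⟨Real.log y, Real.log_pos hy, Real.exp_log (by linarith)⟩
        rw [← himg, integral_image_eq_integral_abs_deriv_smul measurableSet_Ioi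
          (fun u _ => (Real.hasDerivAt_exp u).hasDerivWithinAt) Real.exp_injective.injOn] at e2
        have e3 : ∫ u in Ioi (0 : ℝ), (β u : ℂ) * Complex.exp (-z * u) =
            LSeries (fun n => (f n : ℂ)) (1 + z) / (1 + z) := by
          rw [e2, mul_div_cancel_left₀ _ (show (1 + z) ≠ 0 from hz.2)]
          refine integral_congr_ae (Eventually.of_forall fun u => ?_)
          have hne : (Real.exp u : ℂ) ≠ 0 := by exact_mod_cast (Real.exp_pos u).ne'
          have h3 : ((Real.exp u : ℝ) : ℂ) ^ (-(1 + z + 1)) =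
              Complex.exp (-u) * Complex.exp (-u) * Complex.exp (-z * u) := by
            rw [Complex.cpow_def_of_ne_zero hne, ← Complex.ofReal_log (Real.exp_pos u).le,
              Real.log_exp, ← Complex.exp_add, ← Complex.exp_add]
            congr 1
            ring
          have h4 : (Real.exp u : ℂ) * Complex.exp (-u) = 1 := by
            rw [Complex.ofReal_exp, ← Complex.exp_add]
            simp
          simp only [hβ, hS, abs_of_pos (Real.exp_pos u), Complex.real_smul, h3]
          push_cast at h4 ⊢
          linear_combination (-Complex.exp (-u) * Complex.exp (-z * u) *
            (∑ k ∈ Finset.Icc 1 ⌊Real.exp u⌋₊, (f k : ℂ))) * h4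
        rw [e3, e1, add_sub_cancel_left, mul_div_assoc]
  refine (key.comp Real.tendsto_log_atTop).congr' ?_
  filter_upwards [eventually_gt_atTop 0] with x hx
  simp only [Function.comp_apply, hβ]
  rw [Real.exp_neg, Real.exp_log hx, inv_mul_eq_div]

end Tauberian

/-- The odd character modulo `2` on Gaussian integers: `1` on units congruent to `1`,
`-1` on units congruent to `i`. -/
def gaussCharTwo (a b : ZMod 2) : GaussianInt :=
  if a = b then 0 else if b = 0 then 1 else -1

/-- The quartic character modulo `3` on Gaussian integers sending `1 + i` to `i`. -/
def gaussCharThree (a b : ZMod 3) : GaussianInt :=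
  if b = 0 then (if a = 0 then 0 else 1) else if a = 0 then -1
  else if a = b then ⟨0, 1⟩ else ⟨0, -1⟩

/-- A Hecke character modulo `6` on Gaussian integers. -/
def gaussChar (z : GaussianInt) : GaussianInt :=
  gaussCharTwo (z.re : ZMod 2) (z.im : ZMod 2) * gaussCharThree (z.re : ZMod 3) (z.im : ZMod 3)

theorem gaussChar_mul (z w : GaussianInt) : gaussChar (z * w) = gaussChar z * gaussChar w := by
  have h2 : ∀ a b c d : ZMod 2, gaussCharTwo (a * c + -1 * b * d) (a * d + b * c) =
      gaussCharTwo a b * gaussCharTwo c d := by decide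
  have h3 : ∀ a b c d : ZMod 3, gaussCharThree (a * c + -1 * b * d) (a * d + b * c) =
      gaussCharThree a b * gaussCharThree c d := by decide
  simp only [gaussChar, Zsqrtd.re_mul, Zsqrtd.im_mul]
  push_cast
  rw [h2, h3]
  ring

theorem norm_gaussInt (z : GaussianInt) : z.norm = z.re ^ 2 + z.im ^ 2 := by
  rw [Zsqrtd.norm_def]; ring

theorem gaussChar_eq_zero_of_two_dvd {z : GaussianInt} (h : 2 ∣ z.norm) : gaussChar z = 0 := by
  have h2 : ∀ a b : ZMod 2, a ^ 2 + b ^ 2 = 0 → gaussCharTwo a b = 0 := by decide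
  have := (ZMod.intCast_zmod_eq_zero_iff_dvd z.norm 2).2 (by exact_mod_cast h)
  rw [norm_gaussInt] at this
  push_cast at this
  rw [gaussChar, h2 _ _ this, zero_mul]

theorem gaussChar_eq_zero_of_three_dvd {z : GaussianInt} (h : 3 ∣ z.norm) : gaussChar z = 0 := by
  have h2 : ∀ a b : ZMod 3, a ^ 2 + b ^ 2 = 0 → gaussCharThree a b = 0 := by decide
  have := (ZMod.intCast_zmod_eq_zero_iff_dvd z.norm 3).2 (by exact_mod_cast h)
  rw [norm_gaussInt] at this
  push_cast at this
  rw [gaussChar, h2 _ _ this, mul_zero]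

theorem gaussChar_star_of_norm_mod_one {z : GaussianInt} (h : z.norm % 12 = 1) :
    gaussChar (star z) = gaussChar z ∧ (gaussChar z = 1 ∨ gaussChar z = -1) := by
  have h2 : ∀ a b : ZMod 2, a ^ 2 + b ^ 2 = 1 →
    gaussCharTwo a b = 1 ∨ gaussCharTwo a b = -1 := by decide
  have h3 : ∀ a b : ZMod 3, a ^ 2 + b ^ 2 = 1 → gaussCharThree a (-b) = gaussCharThree a b ∧
    (gaussCharThree a b = 1 ∨ gaussCharThree a b = -1) := by decide
  have e2 : ((z.norm : ℤ) : ZMod 2) = ((1 : ℤ) : ZMod 2) := by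
    rw [ZMod.intCast_eq_intCast_iff]; unfold Int.ModEq; norm_num; omega
  have e3 : ((z.norm : ℤ) : ZMod 3) = ((1 : ℤ) : ZMod 3) := by
    rw [ZMod.intCast_eq_intCast_iff]; unfold Int.ModEq; norm_num; omega
  rw [norm_gaussInt] at e2 e3
  push_cast at e2 e3
  have b2 := h2 _ _ e2
  obtain ⟨a3, b3⟩ := h3 _ _ e3
  constructor
  · simp [gaussChar, Zsqrtd.re_star, Zsqrtd.im_star, a3]
  · rw [gaussChar]
    rcases b2 with b2 | b2 <;> rcases b3 with b3 | b3 <;> simp [b2, b3]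

theorem gaussChar_star_of_norm_mod_five {z : GaussianInt} (h : z.norm % 12 = 5) :
    gaussChar (star z) = -gaussChar z := by
  have h3 : ∀ a b : ZMod 3, a ^ 2 + b ^ 2 = 2 → gaussCharThree a (-b) = -gaussCharThree a b := by
    decide
  have e3 : ((z.norm : ℤ) : ZMod 3) = ((2 : ℤ) : ZMod 3) := by
    rw [ZMod.intCast_eq_intCast_iff]; unfold Int.ModEq; norm_num; omega
  rw [norm_gaussInt] at e3
  push_cast at e3
  simp [gaussChar, Zsqrtd.re_star, Zsqrtd.im_star, h3 _ _ e3]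

theorem gaussChar_natCast {p : ℕ} (h2 : ¬ 2 ∣ p) (h3 : ¬ 3 ∣ p) :
    gaussChar (p : GaussianInt) = 1 := by
  have k2 : ∀ a : ZMod 2, a ≠ 0 → gaussCharTwo a 0 = 1 := by decide
  have k3 : ∀ a : ZMod 3, a ≠ 0 → gaussCharThree a 0 = 1 := by decide
  rw [← ZMod.natCast_eq_zero_iff] at h2 h3
  simp [gaussChar, k2 _ h2, k3 _ h3]

/-- The Gaussian integers of norm `m`. -/
noncomputable def normSet (m : ℕ) : Finset GaussianInt :=
  ((Finset.Icc (-(m : ℤ)) m ×ˢ Finset.Icc (-(m : ℤ)) m).image fun x => ⟨x.1, x.2⟩).filter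
    fun z => z.norm = m

theorem mem_normSet {m : ℕ} {z : GaussianInt} : z ∈ normSet m ↔ z.norm = m := by
  simp only [normSet, Finset.mem_filter, Finset.mem_image, Finset.mem_product, Finset.mem_Icc,
    Prod.exists, and_iff_right_iff_imp]
  intro h
  rw [norm_gaussInt] at h
  refine ⟨z.re, z.im, ?_, rfl⟩
  refine ⟨⟨?_, ?_⟩, ?_, ?_⟩ <;> nlinarith [sq_nonneg (z.re + 1), sq_nonneg (z.re - 1),
    sq_nonneg (z.im + 1), sq_nonneg (z.im - 1), Int.le_self_sq z.re, Int.le_self_sq z.im,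
    Int.le_self_sq (-z.re), Int.le_self_sq (-z.im), sq_nonneg z.re, sq_nonneg z.im]

/-- The coefficients of the theta series of `gaussChar`. -/
noncomputable def normSum (m : ℕ) : GaussianInt := ∑ z ∈ normSet m, gaussChar z

theorem normSum_one : normSum 1 = 4 := by decide

theorem normSum_two_mul (m : ℕ) : normSum (2 * m) = 0 := by
  refine Finset.sum_eq_zero fun z hz => gaussChar_eq_zero_of_two_dvd ?_
  rw [mem_normSet.1 hz]; push_cast; exact dvd_mul_right _ _

theorem normSum_three_mul (m : ℕ) : normSum (3 * m) = 0 := by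
  refine Finset.sum_eq_zero fun z hz => gaussChar_eq_zero_of_three_dvd ?_
  rw [mem_normSet.1 hz]; push_cast; exact dvd_mul_right _ _

theorem sum_image_mul_left {w : GaussianInt} (hw : w ≠ 0) (s : Finset GaussianInt) :
    ∑ z ∈ s.image (w * ·), gaussChar z = gaussChar w * ∑ z ∈ s, gaussChar z := by
  rw [Finset.sum_image fun a _ b _ h => mul_left_cancel₀ hw h, Finset.mul_sum]
  simp only [gaussChar_mul]

theorem natCast_dvd_mul_star {p m : ℕ} {z : GaussianInt}
    (hz : z ∈ normSet (p * m)) : (p : GaussianInt) ∣ z * star z := by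
  rw [← Zsqrtd.norm_eq_mul_conj, mem_normSet.1 hz]
  push_cast
  exact dvd_mul_right _ _

theorem dvd_of_natCast_dvd_star {p : ℕ} {z : GaussianInt} (h : (p : GaussianInt) ∣ star z) :
    (p : GaussianInt) ∣ z := by
  obtain ⟨w, hw⟩ := h
  exact ⟨star w, by rw [← star_star z, hw, star_mul, star_natCast, mul_comm]⟩

theorem normSet_inert_of_not_dvd {p m : ℕ} (hp : Prime (p : GaussianInt)) (hp0 : 0 < p) (hm : ¬ p ∣ m) :
    normSet (p * m) = ∅ := by
  refine Finset.eq_empty_of_forall_notMem fun z hz => hm ?_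
  have h := natCast_dvd_mul_star hz
  have hz' : (p : GaussianInt) ∣ z := (hp.dvd_or_dvd h).elim id dvd_of_natCast_dvd_star
  obtain ⟨w, rfl⟩ := hz'
  have h1 := mem_normSet.1 hz
  rw [Zsqrtd.norm_mul, Zsqrtd.norm_natCast] at h1
  push_cast at h1
  have : (p : ℤ) ∣ m := ⟨w.norm, by
    have : (p : ℤ) ≠ 0 := by positivity
    apply mul_left_cancel₀ this
    linarith⟩
  exact_mod_cast this

theorem normSum_inert_sq {p m : ℕ} (hp : Prime (p : GaussianInt)) (hp0 : 0 < p) :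
    normSum (p * (p * m)) = gaussChar p * normSum m := by
  rw [normSum, normSum, ← sum_image_mul_left hp.ne_zero]
  congr 1
  ext z
  rw [Finset.mem_image]
  have hpz : (p : ℤ) ≠ 0 := by positivity
  constructor
  · intro hz
    have h := natCast_dvd_mul_star hz
    have hz' : (p : GaussianInt) ∣ z := (hp.dvd_or_dvd h).elim id dvd_of_natCast_dvd_star
    obtain ⟨w, rfl⟩ := hz'
    have h1 := mem_normSet.1 hz
    rw [Zsqrtd.norm_mul, Zsqrtd.norm_natCast] at h1
    push_cast at h1
    refine ⟨w, mem_normSet.2 ?_, rfl⟩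
    apply mul_left_cancel₀ hpz
    apply mul_left_cancel₀ hpz
    linarith
  · rintro ⟨w, hw, rfl⟩
    have := mem_normSet.1 hw
    rw [mem_normSet, Zsqrtd.norm_mul, Zsqrtd.norm_natCast, this]
    push_cast; ring

theorem prime_of_norm_eq_prime {p : ℕ} (hp : p.Prime) {π : GaussianInt} (hπ : π.norm = p) :
    Prime π := by
  refine Irreducible.prime ⟨fun h => ?_, fun a b hab => ?_⟩
  · rw [← Zsqrtd.norm_eq_one_iff, hπ] at h
    exact hp.one_lt.ne' (by simpa using h)
  · rw [← Zsqrtd.norm_eq_one_iff, ← Zsqrtd.norm_eq_one_iff]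
    have h : a.norm.natAbs * b.norm.natAbs = p := by
      rw [← Int.natAbs_mul, ← Zsqrtd.norm_mul, ← hab, hπ, Int.natAbs_natCast]
    rcases (Nat.prime_mul_iff (a := a.norm.natAbs) (b := b.norm.natAbs)).1 (h ▸ hp) with h | h
    · exact .inr h.2
    · exact .inl h.2

theorem not_dvd_star_of_norm_eq_prime {p : ℕ} (hp : p.Prime) (h2 : p ≠ 2) {π : GaussianInt}
    (hπ : π.norm = p) : ¬ π ∣ star π := by
  intro h
  have h1 : π ∣ π + star π := dvd_add dvd_rfl h
  obtain ⟨w, hw⟩ := h1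
  have h3 := congrArg Zsqrtd.norm hw
  rw [Zsqrtd.norm_mul, hπ] at h3
  have h4 : (π + star π).norm = 4 * π.re ^ 2 := by
    rw [norm_gaussInt]; simp; ring
  rw [h4] at h3
  have hpi : Prime (p : ℤ) := Nat.prime_iff_prime_int.1 hp
  have h5 : (p : ℤ) ∣ π.re := by
    have h6 : (p : ℤ) ∣ 4 * π.re ^ 2 := ⟨_, h3⟩
    rcases hpi.dvd_or_dvd h6 with h6 | h6
    · exfalso
      have : p ∣ 2 ^ 2 := by exact_mod_cast h6
      exact h2 ((Nat.prime_dvd_prime_iff_eq hp Nat.prime_two).1 (hp.dvd_of_dvd_pow this))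
    · exact hpi.dvd_of_dvd_pow h6
  have hn := norm_gaussInt π
  rw [hπ] at hn
  have h7 : (p : ℤ) ∣ π.im := by
    refine hpi.dvd_of_dvd_pow (n := 2) ?_
    have : π.im ^ 2 = p - π.re ^ 2 := by linarith
    rw [this]
    exact dvd_sub dvd_rfl (h5.trans (dvd_pow_self _ two_ne_zero))
  obtain ⟨x, hx⟩ := h5
  obtain ⟨y, hy⟩ := h7
  have h8 : (p : ℤ) * (p * (x ^ 2 + y ^ 2)) = p * 1 := by
    rw [hx, hy] at hn; linarith
  have h9 := mul_left_cancel₀ hpi.ne_zero h8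
  exact hpi.not_isUnit (isUnit_iff_exists_inv.2 ⟨_, h9⟩)

theorem exists_norm_eq_of_prime {p : ℕ} (hp : p.Prime) (h : p % 4 = 1) :
    ∃ π : GaussianInt, π.norm = p := by
  have := Fact.mk hp
  obtain ⟨a, b, hab⟩ := Nat.Prime.sq_add_sq (p := p) (by omega)
  exact ⟨⟨a, b⟩, by rw [norm_gaussInt, ← hab]; push_cast; ring⟩

theorem normSet_split {p : ℕ} (hp : p.Prime) {π : GaussianInt}
    (hπ : π.norm = p) (m : ℕ) :
    normSet (p * m) = (normSet m).image (π * ·) ∪ (normSet m).image (star π * ·) := by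
  have hpz : (p : ℤ) ≠ 0 := by exact_mod_cast hp.ne_zero
  have hs : (star π).norm = p := by rw [Zsqrtd.norm_conj, hπ]
  have key : ∀ {π w : GaussianInt}, π.norm = p → (π * w ∈ normSet (p * m) ↔ w ∈ normSet m) := by
    intro π w hπ
    rw [mem_normSet, mem_normSet, Zsqrtd.norm_mul, hπ]
    push_cast
    exact mul_right_inj' hpz
  ext z
  simp only [Finset.mem_union, Finset.mem_image]
  constructor
  · intro hz
    have h : π ∣ z * star z := by
      refine dvd_trans ⟨star π, ?_⟩ (natCast_dvd_mul_star hz)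
      rw [← Zsqrtd.norm_eq_mul_conj, hπ]; norm_cast
    rcases (prime_of_norm_eq_prime hp hπ).dvd_or_dvd h with ⟨w, rfl⟩ | ⟨w, hw⟩
    · exact .inl ⟨w, (key hπ).1 hz, rfl⟩
    · have : z = star π * star w := by rw [← star_star z, hw, star_mul, mul_comm]
      subst this
      exact .inr ⟨_, (key hs).1 hz, rfl⟩
  · rintro (⟨w, hw, rfl⟩ | ⟨w, hw, rfl⟩)
    · exact (key hπ).2 hw
    · exact (key hs).2 hw

theorem mem_image_inter_iff {p : ℕ} (hp : p.Prime) (h2 : p ≠ 2) {π : GaussianInt}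
    (hπ : π.norm = p) {m : ℕ} {z : GaussianInt} :
    z ∈ (normSet m).image (π * ·) ∩ (normSet m).image (star π * ·) ↔
      ∃ w : GaussianInt, z = p * w ∧ p * w.norm = m := by
  have hpz : (p : ℤ) ≠ 0 := by exact_mod_cast hp.ne_zero
  have hs : (star π).norm = p := by rw [Zsqrtd.norm_conj, hπ]
  have hps : (p : GaussianInt) = π * star π := by rw [← Zsqrtd.norm_eq_mul_conj, hπ]; norm_cast
  simp only [Finset.mem_inter, Finset.mem_image]
  constructor
  · rintro ⟨⟨w, hw, rfl⟩, v, -, hv⟩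
    have h : star π ∣ π * w := ⟨v, hv.symm⟩
    rcases (prime_of_norm_eq_prime hp hs).dvd_or_dvd h with h | ⟨u, rfl⟩
    · exact absurd (by simpa using h) (not_dvd_star_of_norm_eq_prime hp h2 hs)
    · refine ⟨u, by rw [hps, mul_assoc], ?_⟩
      rw [← mem_normSet.1 hw, Zsqrtd.norm_mul, hs]
  · rintro ⟨w, rfl, hw⟩
    refine ⟨⟨star π * w, mem_normSet.2 ?_, by rw [hps]; ring⟩, π * w, mem_normSet.2 ?_,
      by rw [hps]; ring⟩
    · rw [Zsqrtd.norm_mul, hs, hw]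
    · rw [Zsqrtd.norm_mul, hπ, hw]

theorem normSum_split {p : ℕ} (hp : p.Prime) {π : GaussianInt} (hπ : π.norm = p) (m : ℕ) :
    normSum (p * m) + ∑ z ∈ (normSet m).image (π * ·) ∩ (normSet m).image (star π * ·),
      gaussChar z = (gaussChar π + gaussChar (star π)) * normSum m := by
  have hs : (star π).norm = p := by rw [Zsqrtd.norm_conj, hπ]
  rw [normSum, normSet_split hp hπ, Finset.sum_union_inter,
    sum_image_mul_left (prime_of_norm_eq_prime hp hπ).ne_zero,
    sum_image_mul_left (prime_of_norm_eq_prime hp hs).ne_zero, add_mul, normSum]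

theorem normSum_split_of_not_dvd {p : ℕ} (hp : p.Prime) (h2 : p ≠ 2) {π : GaussianInt}
    (hπ : π.norm = p) {m : ℕ} (hm : ¬ p ∣ m) :
    normSum (p * m) = (gaussChar π + gaussChar (star π)) * normSum m := by
  rw [← normSum_split hp hπ, Finset.eq_empty_of_forall_notMem (s := _ ∩ _), Finset.sum_empty,
    add_zero]
  intro z hz
  obtain ⟨w, -, hw⟩ := (mem_image_inter_iff hp h2 hπ).1 hz
  exact hm (by exact_mod_cast Dvd.intro _ hw)

theorem normSum_split_mul {p : ℕ} (hp : p.Prime) (h2 : p ≠ 2) (h3 : p ≠ 3) {π : GaussianInt}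
    (hπ : π.norm = p) (m : ℕ) :
    normSum (p * (p * m)) =
      (gaussChar π + gaussChar (star π)) * normSum (p * m) - normSum m := by
  have hpz : (p : ℤ) ≠ 0 := by exact_mod_cast hp.ne_zero
  have h : (normSet (p * m)).image (π * ·) ∩ (normSet (p * m)).image (star π * ·) =
      (normSet m).image ((p : GaussianInt) * ·) := by
    ext z
    rw [mem_image_inter_iff hp h2 hπ, Finset.mem_image]
    refine exists_congr fun w => ?_
    rw [mem_normSet]
    push_cast
    rw [mul_right_inj' hpz, eq_comm (a := z), and_comm]
  rw [← normSum_split hp hπ, h, sum_image_mul_left (by exact_mod_cast hp.ne_zero),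
    gaussChar_natCast, one_mul, normSum, normSum, add_sub_cancel_right]
  · rwa [Nat.prime_dvd_prime_iff_eq Nat.prime_two hp, eq_comm]
  · rwa [Nat.prime_dvd_prime_iff_eq Nat.prime_three hp, eq_comm]

/-- The local factors of the absolute values of the coefficients. -/
def localWeight (p k : ℕ) : ℕ :=
  if k = 0 then 1 else if p % 12 = 1 then k + 1
  else if p % 12 = 5 ∨ p % 12 = 7 ∨ p % 12 = 11 then (if k % 2 = 0 then 1 else 0) else 0

theorem localWeight_of_mod {p : ℕ} (h : p % 12 = 5 ∨ p % 12 = 7 ∨ p % 12 = 11) (k : ℕ) :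
    localWeight p k = if k % 2 = 0 then 1 else 0 := by
  rcases eq_or_ne k 0 with rfl | hk
  · simp [localWeight]
  · rw [localWeight, if_neg hk, if_neg (by omega), if_pos h]

theorem norm_normSum_prime_pow_mul {p : ℕ} (hp : p.Prime) {m : ℕ} (hm : ¬ p ∣ m) (k : ℕ) :
    (normSum (p ^ k * m)).norm = (localWeight p k : ℤ) ^ 2 * (normSum m).norm := by
  rcases Nat.eq_zero_or_pos k with rfl | hk
  · simp [localWeight]
  have hp12 : p = 2 ∨ p = 3 ∨ p % 12 = 1 ∨ p % 12 = 5 ∨ p % 12 = 7 ∨ p % 12 = 11 := by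
    by_cases h2 : p = 2
    · exact .inl h2
    by_cases h3 : p = 3
    · exact .inr (.inl h3)
    have := mt (Nat.prime_dvd_prime_iff_eq Nat.prime_two hp).1 (Ne.symm h2)
    have := mt (Nat.prime_dvd_prime_iff_eq Nat.prime_three hp).1 (Ne.symm h3)
    omega
  rcases hp12 with rfl | rfl | h1 | h5 | h711
  · obtain ⟨k, rfl⟩ := Nat.exists_eq_succ_of_ne_zero hk.ne'
    rw [pow_succ', mul_assoc, normSum_two_mul]
    simp [localWeight]
  · obtain ⟨k, rfl⟩ := Nat.exists_eq_succ_of_ne_zero hk.ne'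
    rw [pow_succ', mul_assoc, normSum_three_mul]
    simp [localWeight]
  · obtain ⟨π, hπ⟩ := exists_norm_eq_of_prime hp (by omega)
    obtain ⟨hstar, hval⟩ := gaussChar_star_of_norm_mod_one (z := π) (by rw [hπ]; omega)
    have h2 : p ≠ 2 := by rintro rfl; omega
    have h3 : p ≠ 3 := by rintro rfl; omega
    have hsq : gaussChar π * gaussChar π = 1 := by rcases hval with h | h <;> rw [h] <;> rfl
    have main : ∀ k : ℕ, normSum (p ^ k * m) = gaussChar π ^ k * (k + 1) * normSum m ∧
        normSum (p ^ (k + 1) * m) = gaussChar π ^ (k + 1) * (k + 2) * normSum m := by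
      intro k
      induction k with
      | zero =>
        refine ⟨by simp, ?_⟩
        rw [zero_add, pow_one, normSum_split_of_not_dvd hp h2 hπ hm, hstar]
        push_cast; ring
      | succ k ih =>
        refine ⟨by rw [ih.2]; push_cast; ring, ?_⟩
        rw [pow_succ', pow_succ', mul_assoc, mul_assoc, normSum_split_mul hp h2 h3 hπ,
          ← mul_assoc p, ← pow_succ', ih.1, ih.2, hstar]
        push_cast
        linear_combination (gaussChar π ^ k * (k + 1) * normSum m) * hsq
    rw [(main k).1, Zsqrtd.norm_mul, Zsqrtd.norm_mul]
    have e1 : (gaussChar π ^ k).norm = 1 := by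
      rcases hval with h | h <;> rw [h]
      · simp
      · rcases neg_one_pow_eq_or GaussianInt k with h | h <;> rw [h] <;> rfl
    have e2 : ((k : GaussianInt) + 1).norm = ((k : ℤ) + 1) ^ 2 := by
      rw [norm_gaussInt]; simp
    rw [e1, e2, localWeight, if_neg hk.ne', if_pos h1]
    push_cast; ring
  · obtain ⟨π, hπ⟩ := exists_norm_eq_of_prime hp (by omega)
    have hstar := gaussChar_star_of_norm_mod_five (z := π) (by rw [hπ]; omega)
    have h2 : p ≠ 2 := by rintro rfl; omega
    have h3 : p ≠ 3 := by rintro rfl; omega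
    have main : ∀ k : ℕ,
        (normSum (p ^ k * m)).norm = (if k % 2 = 0 then 1 else 0) * (normSum m).norm ∧
        (normSum (p ^ (k + 1) * m)).norm =
          (if (k + 1) % 2 = 0 then 1 else 0) * (normSum m).norm := by
      intro k
      induction k with
      | zero =>
        refine ⟨by simp, ?_⟩
        rw [zero_add, pow_one, normSum_split_of_not_dvd hp h2 hπ hm, hstar]
        simp
      | succ k ih =>
        refine ⟨ih.2, ?_⟩
        rw [pow_succ', pow_succ', mul_assoc, mul_assoc, normSum_split_mul hp h2 h3 hπ, hstar,
          add_neg_cancel, zero_mul, zero_sub, Zsqrtd.norm_neg, ih.1, add_assoc, Nat.add_mod_right]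
    rw [(main k).1, localWeight_of_mod (by omega)]
    split_ifs <;> simp
  · have hpp : Prime (p : GaussianInt) := by
      have := Fact.mk hp
      exact GaussianInt.prime_of_nat_prime_of_mod_four_eq_three p (by omega)
    have main : ∀ k : ℕ,
        (normSum (p ^ k * m)).norm = (if k % 2 = 0 then 1 else 0) * (normSum m).norm ∧
        (normSum (p ^ (k + 1) * m)).norm =
          (if (k + 1) % 2 = 0 then 1 else 0) * (normSum m).norm := by
      intro k
      induction k with
      | zero =>
        refine ⟨by simp, ?_⟩
        rw [zero_add, pow_one, normSum, normSet_inert_of_not_dvd hpp hp.pos hm]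
        simp
      | succ k ih =>
        refine ⟨ih.2, ?_⟩
        rw [pow_succ', pow_succ', mul_assoc, mul_assoc, normSum_inert_sq hpp hp.pos,
          gaussChar_natCast (by omega) (by omega), one_mul, ih.1, add_assoc, Nat.add_mod_right]
    rw [(main k).1, localWeight_of_mod (by omega)]
    split_ifs <;> simp

/-- The multiplicative function with local factors `localWeight`. -/
def absCoeff (n : ℕ) : ℕ := if n = 0 then 0 else n.factorization.prod localWeight

theorem absCoeff_prime_pow {p : ℕ} (hp : p.Prime) (k : ℕ) :
    absCoeff (p ^ k) = localWeight p k := by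
  rw [absCoeff, if_neg (pow_ne_zero _ hp.ne_zero), hp.factorization_pow,
    Finsupp.prod_single_index (by simp [localWeight])]

theorem absCoeff_mul {m n : ℕ} (h : m.Coprime n) : absCoeff (m * n) = absCoeff m * absCoeff n := by
  rcases eq_or_ne m 0 with rfl | hm
  · simp [absCoeff]
  rcases eq_or_ne n 0 with rfl | hn
  · simp [absCoeff]
  rw [absCoeff, absCoeff, absCoeff, if_neg hm, if_neg hn, if_neg (mul_ne_zero hm hn),
    Nat.factorization_mul_of_coprime h,
    Finsupp.prod_add_index_of_disjoint h.disjoint_primeFactors]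

theorem norm_normSum_mul (a : ℕ) : ∀ m : ℕ, m ≠ 0 → a.Coprime m →
    (normSum (a * m)).norm = (absCoeff a : ℤ) ^ 2 * (normSum m).norm := by
  induction a using Nat.recOnPosPrimePosCoprime with
  | zero => 
    intro m hm h
    have : m = 1 := by simpa using h
    subst this
    have := normSum_two_mul 0
    simp only [mul_zero] at this
    simp [this, absCoeff]
  | one => intro m hm h; simp [absCoeff]
  | prime_pow p n hp hn =>
    intro m hm h
    rw [absCoeff_prime_pow hp, norm_normSum_prime_pow_mul hp]
    exact (hp.coprime_iff_not_dvd).1 (Nat.Coprime.coprime_dvd_left (dvd_pow_self _ hn.ne') h)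
  | coprime a b ha hb hab iha ihb =>
    intro m hm h
    rw [mul_assoc, iha (b * m) (by positivity) (Nat.Coprime.mul_right hab (Nat.Coprime.coprime_mul_right h)),
      ihb m hm (Nat.Coprime.coprime_mul_left h), absCoeff_mul hab]
    push_cast; ring

theorem norm_normSum (m : ℕ) : (normSum m).norm = 16 * (absCoeff m : ℤ) ^ 2 := by
  have := norm_normSum_mul m 1 one_ne_zero (Nat.coprime_one_right m)
  rw [mul_one, normSum_one] at this
  rw [this, mul_comm]
  rfl

theorem coeff_prod_Icc_one_sub_X_pow {n N M : ℕ} (hn : n ≤ N) (hM : N ≤ M) :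
    (∏ m ∈ Finset.Icc 1 M, ((1 : Polynomial ℤ) - Polynomial.X ^ m)).coeff n =
      (∏ m ∈ Finset.Icc 1 N, ((1 : Polynomial ℤ) - Polynomial.X ^ m)).coeff n := by
  induction M, hM using Nat.le_induction with
  | base => rfl
  | succ M hM ih =>
    rw [Finset.prod_Icc_succ_top (by omega), mul_sub, mul_one, Polynomial.coeff_sub, ih,
      Polynomial.coeff_mul_X_pow', if_neg (by omega), sub_zero]

theorem coeff_prod_Icc_eq_coeff_pentagonalSeries {n N : ℕ} (hn : n ≤ N) :
    (∏ m ∈ Finset.Icc 1 N, ((1 : Polynomial ℤ) - Polynomial.X ^ m)).coeff n =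
      (PowerSeries.pentagonalSeries ℤ).coeff n := by
  obtain ⟨s, hs⟩ := eventually_atTop.1
    (PowerSeries.coeff_prod_one_sub_X_pow_eventually_eq (R := ℤ) n)
  obtain ⟨K, hK⟩ := s.exists_nat_subset_range
  have hsub : s ≤ Finset.range (max K N) :=
    hK.trans (Finset.range_mono (le_max_left _ _))
  rw [← hs _ hsub, ← coeff_prod_Icc_one_sub_X_pow hn (le_max_right K N), ← Polynomial.coeff_coe]
  congr 1
  rw [Finset.range_eq_Ico, Finset.prod_Ico_add' (fun m => (1 : PowerSeries ℤ) - PowerSeries.X ^ m),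
    ← Polynomial.coeToPowerSeries.ringHom_apply, map_prod]
  refine Finset.prod_congr ?_ fun m _ => by simp
  ext m
  simp only [Finset.mem_Icc, Finset.mem_Ico]
  omega

/-- The even quadratic character modulo `12` as an integer function. -/
def chiTwelve (a : ZMod 12) : ℤ :=
  if a = 1 ∨ a = -1 then 1 else if a = 5 ∨ a = -5 then -1 else 0

/-- The square roots of `24 n + 1` in the integers. -/
noncomputable def sqrtSet (n : ℕ) : Finset ℤ :=
  (Finset.Icc (-(24 * n + 1 : ℤ)) (24 * n + 1)).filter fun x => x ^ 2 = 24 * n + 1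

theorem mem_sqrtSet {n : ℕ} {x : ℤ} : x ∈ sqrtSet n ↔ x ^ 2 = 24 * n + 1 := by
  simp only [sqrtSet, Finset.mem_filter, Finset.mem_Icc, and_iff_right_iff_imp]
  intro h
  constructor <;> nlinarith [sq_nonneg x, Int.le_self_sq x, Int.le_self_sq (-x)]

theorem negOnePow_eq_chiTwelve (k : ℤ) : (k.negOnePow : ℤ) = chiTwelve ((6 * k - 1 : ℤ)) := by
  rcases Int.even_or_odd k with h | h
  · rw [Int.negOnePow_even k h]
    obtain ⟨j, rfl⟩ := h
    have : (((6 * (j + j) - 1 : ℤ)) : ZMod 12) = ((-1 : ℤ) : ZMod 12) := by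
      rw [ZMod.intCast_eq_intCast_iff]; unfold Int.ModEq; push_cast; omega
    rw [this]; decide
  · rw [Int.negOnePow_odd k h]
    obtain ⟨j, rfl⟩ := h
    have : (((6 * (2 * j + 1) - 1 : ℤ)) : ZMod 12) = ((5 : ℤ) : ZMod 12) := by
      rw [ZMod.intCast_eq_intCast_iff]; unfold Int.ModEq; push_cast; omega
    rw [this]; decide

theorem sum_sqrtSet (n : ℕ) :
    ∑ x ∈ sqrtSet n, chiTwelve x = 2 * (PowerSeries.pentagonalSeries ℤ).coeff n := by
  by_cases h : n ∈ Set.range pentagonal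
  · obtain ⟨k, rfl⟩ := h
    have hk := two_mul_natCast_pentagonal k
    have hset : sqrtSet (pentagonal k) = {6 * k - 1, -(6 * k - 1)} := by
      ext x
      rw [mem_sqrtSet, Finset.mem_insert, Finset.mem_singleton, ← sq_eq_sq_iff_eq_or_eq_neg]
      have : (6 * k - 1) ^ 2 = 24 * (pentagonal k : ℤ) + 1 := by linear_combination (-12) * hk
      rw [this]
    have hneg : ∀ a : ZMod 12, chiTwelve (-a) = chiTwelve a := by decide
    rw [hset, Finset.sum_pair (by omega), PowerSeries.coeff_pentagonalSeries_pentagonal,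
      Int.cast_neg, hneg, ← negOnePow_eq_chiTwelve]
    rw [Int.cast_id, two_mul]
  · rw [PowerSeries.coeff_pentagonalSeries_eq_zero ℤ h, mul_zero,
      Finset.eq_empty_of_forall_notMem (s := sqrtSet n), Finset.sum_empty]
    intro x hx
    rw [mem_sqrtSet] at hx
    apply h
    have hmod : x % 6 = 1 ∨ x % 6 = 5 := by
      have h1 : x ^ 2 % 6 = 1 := by omega
      have h2 : x % 6 = 0 ∨ x % 6 = 1 ∨ x % 6 = 2 ∨ x % 6 = 3 ∨ x % 6 = 4 ∨ x % 6 = 5 := by omega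
      rcases h2 with h | h | h | h | h | h <;> rw [pow_two, Int.mul_emod, h] at h1 <;> omega
    have key : ∀ k : ℤ, (6 * k - 1) ^ 2 = 24 * (n : ℤ) + 1 → pentagonal k = n := by
      intro k hk
      have := two_mul_natCast_pentagonal k
      have : (pentagonal k : ℤ) = n := by linarith
      exact_mod_cast this
    rcases hmod with h | h
    · refine ⟨-(x / 6), key _ ?_⟩
      rw [← hx]
      have : x = 6 * (x / 6) + 1 := by omega
      generalize x / 6 = y at this
      subst this; ring
    · refine ⟨x / 6 + 1, key _ ?_⟩
      rw [← hx]
      have : x = 6 * (x / 6) + 5 := by omega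
      generalize x / 6 = y at this
      subst this; ring

theorem gaussChar_eq_chiTwelve {z : GaussianInt} (h : z.norm % 12 = 1) :
    gaussChar z = (chiTwelve ((z.re + z.im : ℤ)) * chiTwelve ((z.re - z.im : ℤ)) : ℤ) := by
  have key : ∀ u v : ZMod 12, u ^ 2 + v ^ 2 = 1 →
      gaussCharTwo (ZMod.castHom (by norm_num : 2 ∣ 12) (ZMod 2) u)
        (ZMod.castHom (by norm_num : 2 ∣ 12) (ZMod 2) v) *
      gaussCharThree (ZMod.castHom (by norm_num : 3 ∣ 12) (ZMod 3) u)
        (ZMod.castHom (by norm_num : 3 ∣ 12) (ZMod 3) v) =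
      (chiTwelve (u + v) * chiTwelve (u - v) : ℤ) := by decide +kernel
  have e : ((z.norm : ℤ) : ZMod 12) = ((1 : ℤ) : ZMod 12) := by
    rw [ZMod.intCast_eq_intCast_iff]; unfold Int.ModEq; norm_num; omega
  rw [norm_gaussInt] at e
  push_cast at e
  have := key _ _ e
  simp only [map_intCast] at this
  rw [gaussChar, this]
  push_cast
  rfl

theorem odd_of_sq_eq {x : ℤ} {n : ℕ} (h : x ^ 2 = 24 * n + 1) : Odd x := by
  have : Odd (x ^ 2) := ⟨12 * n, by rw [h]; ring⟩
  exact Int.odd_pow.1 this |>.resolve_right two_ne_zero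

theorem normSum_eq_sum_antidiagonal (n : ℕ) :
    normSum (12 * n + 1) = ((∑ x ∈ Finset.HasAntidiagonal.antidiagonal n,
      (∑ u ∈ sqrtSet x.1, chiTwelve u) * ∑ v ∈ sqrtSet x.2, chiTwelve v : ℤ) : GaussianInt) := by
  have h1 : normSum (12 * n + 1) = ((∑ z ∈ normSet (12 * n + 1),
      chiTwelve ((z.re + z.im : ℤ)) * chiTwelve ((z.re - z.im : ℤ)) : ℤ) : GaussianInt) := by
    rw [normSum, Int.cast_sum]
    refine Finset.sum_congr rfl fun z hz => gaussChar_eq_chiTwelve ?_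
    rw [mem_normSet.1 hz]; push_cast; omega
  rw [h1]
  congr 1
  simp_rw [Finset.sum_mul_sum, ← Finset.sum_product']
  rw [Finset.sum_sigma']
  have hdiv : ∀ x : ℤ, x ^ 2 % 24 = 1 → x ^ 2 = 24 * (((x ^ 2 - 1) / 24).toNat : ℤ) + 1 := by
    intro x h
    have := sq_nonneg x
    omega
  have hmod : ∀ z ∈ normSet (12 * n + 1),
      (z.re + z.im) ^ 2 % 24 = 1 ∧ (z.re - z.im) ^ 2 % 24 = 1 := by
    intro z hz
    have key : ∀ u v : ZMod 24, (u ^ 2 + v ^ 2 = 1 ∨ u ^ 2 + v ^ 2 = 13) →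
        (u + v) ^ 2 = 1 ∧ (u - v) ^ 2 = 1 := by
      decide +kernel
    have e : ((z.norm : ℤ) : ZMod 24) = ((1 : ℤ) : ZMod 24) ∨
        ((z.norm : ℤ) : ZMod 24) = ((13 : ℤ) : ZMod 24) := by
      rw [ZMod.intCast_eq_intCast_iff, ZMod.intCast_eq_intCast_iff, mem_normSet.1 hz]
      unfold Int.ModEq; push_cast; omega
    rw [norm_gaussInt] at e
    push_cast at e
    obtain ⟨h1, h2⟩ := key _ _ e
    constructor
    · have : (((z.re + z.im) ^ 2 : ℤ) : ZMod 24) = ((1 : ℤ) : ZMod 24) := by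
        push_cast; exact h1
      rw [ZMod.intCast_eq_intCast_iff] at this
      exact this
    · have : (((z.re - z.im) ^ 2 : ℤ) : ZMod 24) = ((1 : ℤ) : ZMod 24) := by
        push_cast; exact h2
      rw [ZMod.intCast_eq_intCast_iff] at this
      exact this
  refine Finset.sum_nbij'
    (fun z => ⟨((((z.re + z.im) ^ 2 - 1) / 24).toNat, (((z.re - z.im) ^ 2 - 1) / 24).toNat),
      (z.re + z.im, z.re - z.im)⟩)
    (fun y => ⟨(y.2.1 + y.2.2) / 2, (y.2.1 - y.2.2) / 2⟩) ?_ ?_ ?_ ?_ ?_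
  · intro z hz
    obtain ⟨h1, h2⟩ := hmod z hz
    have h3 := hdiv _ h1
    have h4 := hdiv _ h2
    have h5 := mem_normSet.1 hz
    rw [norm_gaussInt] at h5
    simp only [Finset.mem_sigma, Finset.mem_product, mem_sqrtSet,
      Finset.HasAntidiagonal.mem_antidiagonal]
    refine ⟨?_, h3, h4⟩
    push_cast at h5
    have : (z.re + z.im) ^ 2 + (z.re - z.im) ^ 2 = 24 * n + 2 := by linear_combination 2 * h5
    omega
  · rintro ⟨⟨i, j⟩, x, y⟩ h
    simp only [Finset.mem_sigma, Finset.mem_product, mem_sqrtSet,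
      Finset.HasAntidiagonal.mem_antidiagonal] at h
    obtain ⟨hij, hx, hy⟩ := h
    obtain ⟨a, rfl⟩ := odd_of_sq_eq hx
    obtain ⟨b, rfl⟩ := odd_of_sq_eq hy
    rw [mem_normSet, norm_gaussInt]
    have e1 : (2 * a + 1 + (2 * b + 1)) / 2 = a + b + 1 := by omega
    have e2 : (2 * a + 1 - (2 * b + 1)) / 2 = a - b := by omega
    simp only [e1, e2]
    subst hij
    push_cast
    linarith
  · intro z hz
    ext <;> simp <;> omega
  · rintro ⟨⟨i, j⟩, x, y⟩ h
    simp only [Finset.mem_sigma, Finset.mem_product, mem_sqrtSet,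
      Finset.HasAntidiagonal.mem_antidiagonal] at h
    obtain ⟨hij, hx, hy⟩ := h
    obtain ⟨a, ha⟩ := odd_of_sq_eq hx
    obtain ⟨b, hb⟩ := odd_of_sq_eq hy
    have e1 : (x + y) / 2 + (x - y) / 2 = x := by omega
    have e2 : (x + y) / 2 - (x - y) / 2 = y := by omega
    simp only [e1, e2, hx, hy]
    have e3 : ∀ i : ℕ, ((24 * (i : ℤ) + 1 - 1) / 24).toNat = i := by intro i; omega
    rw [e3, e3]
  · intro z _
    rfl

theorem sq_coeff_eq_absCoeff_sq {a : ℕ → ℤ}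
    (ha : ∀ n N : ℕ, n ≤ N →
      a n = (((∏ m ∈ Finset.Icc 1 N, ((1 : Polynomial ℤ) - Polynomial.X ^ m)) ^ 2).coeff n))
    (n : ℕ) : a n ^ 2 = (absCoeff (12 * n + 1) : ℤ) ^ 2 := by
  have h1 : normSum (12 * n + 1) = ((4 * a n : ℤ) : GaussianInt) := by
    rw [normSum_eq_sum_antidiagonal, ha n n le_rfl, pow_two, Polynomial.coeff_mul]
    congr 1
    rw [Finset.mul_sum]
    refine Finset.sum_congr rfl fun x hx => ?_
    rw [Finset.HasAntidiagonal.mem_antidiagonal] at hx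
    rw [coeff_prod_Icc_eq_coeff_pentagonalSeries (by omega),
      coeff_prod_Icc_eq_coeff_pentagonalSeries (by omega), sum_sqrtSet, sum_sqrtSet]
    ring
  have h2 := norm_normSum (12 * n + 1)
  rw [h1, Zsqrtd.norm_intCast] at h2
  linarith

theorem abs_coeff_eq_absCoeff {a : ℕ → ℤ}
    (ha : ∀ n N : ℕ, n ≤ N →
      a n = (((∏ m ∈ Finset.Icc 1 N, ((1 : Polynomial ℤ) - Polynomial.X ^ m)) ^ 2).coeff n))
    (n : ℕ) : |a n| = absCoeff (12 * n + 1) := by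
  rw [← Nat.abs_cast (absCoeff _), ← sq_eq_sq_iff_abs_eq_abs]
  exact sq_coeff_eq_absCoeff_sq ha n

theorem mod_eq_one_of_absCoeff_ne_zero (m : ℕ) : absCoeff m ≠ 0 → m % 12 = 1 := by
  induction m using Nat.recOnPosPrimePosCoprime with
  | zero => simp [absCoeff]
  | one => simp
  | prime_pow p n hp hn =>
    intro h
    rw [absCoeff_prime_pow hp, localWeight, if_neg hn.ne'] at h
    split_ifs at h with h1 h2 h3
    · rw [Nat.pow_mod, h1, one_pow]; norm_num
    · obtain ⟨k, rfl⟩ := Nat.dvd_of_mod_eq_zero h3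
      rw [pow_mul, Nat.pow_mod]
      have : p ^ 2 % 12 = 1 := by rw [Nat.pow_mod]; rcases h2 with h | h | h <;> rw [h]
      rw [this, one_pow]; norm_num
    all_goals exact absurd rfl h
  | coprime a b ha hb hab iha ihb =>
    intro h
    rw [absCoeff_mul hab, mul_ne_zero_iff] at h
    rw [Nat.mul_mod, iha h.1, ihb h.2]

theorem sum_range_absCoeff (N : ℕ) :
    ∑ n ∈ Finset.range (N + 1), absCoeff (12 * n + 1) =
      ∑ m ∈ Finset.Icc 1 (12 * N + 1), absCoeff m := by
  refine Finset.sum_of_injOn (fun n => 12 * n + 1) (fun a _ b _ h => by simpa using h) ?_ ?_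
    fun _ _ => rfl
  · intro n hn
    simp only [Finset.coe_range, Set.mem_Iio, Finset.coe_Icc, Set.mem_Icc] at *
    omega
  · intro m hm hm'
    by_contra h
    have := mod_eq_one_of_absCoeff_ne_zero m h
    apply hm'
    refine ⟨m / 12, ?_, by simp only []; omega⟩
    simp only [Finset.coe_range, Set.mem_Iio, Finset.mem_Icc] at *
    omega

/-- The odd quadratic character modulo `3`, as a function modulo `12`. -/
def chiThree (a : ZMod 12) : ℤ :=
  if a = 1 ∨ a = 7 then 1 else if a = 5 ∨ a = 11 then -1 else 0

/-- The odd quadratic character modulo `4`, as a function modulo `12`. -/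
def chiFour (a : ZMod 12) : ℤ :=
  if a = 1 ∨ a = 5 then 1 else if a = 7 ∨ a = 11 then -1 else 0

/-- The Dirichlet character modulo `12` attached to a multiplicative integer function. -/
def charOfInt (g : ZMod 12 → ℤ) (h1 : g 1 = 1) (hm : ∀ a b, g (a * b) = g a * g b)
    (h0 : ∀ a, (∀ b, a * b ≠ 1) → g a = 0) : DirichletCharacter ℂ 12 where
  toFun a := g a
  map_one' := by simp [h1]
  map_mul' a b := by simp [hm]
  map_nonunit' a ha := by
    have : g a = 0 := h0 a fun b hb => ha (IsUnit.of_mul_eq_one b hb)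
    simp [this]

/-- The even quadratic Dirichlet character modulo `12`. -/
def charTwelve : DirichletCharacter ℂ 12 :=
  charOfInt chiTwelve (by decide) (by decide) (by decide)

/-- The Dirichlet character modulo `12` induced by the quadratic character modulo `3`. -/
def charThree : DirichletCharacter ℂ 12 :=
  charOfInt chiThree (by decide) (by decide) (by decide)

/-- The Dirichlet character modulo `12` induced by the quadratic character modulo `4`. -/
def charFour : DirichletCharacter ℂ 12 :=
  charOfInt chiFour (by decide) (by decide) (by decide)

theorem charTwelve_apply (a : ZMod 12) : charTwelve a = chiTwelve a := rfl

theorem charThree_apply (a : ZMod 12) : charThree a = chiThree a := rfl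

theorem charFour_apply (a : ZMod 12) : charFour a = chiFour a := rfl

theorem charTwelve_ne_one : charTwelve ≠ 1 := by
  intro h
  have h1 : charTwelve 5 = 1 := by rw [h]; exact MulChar.one_apply (by decide)
  rw [charTwelve_apply, show chiTwelve 5 = -1 by decide] at h1
  norm_num at h1

theorem charThree_ne_one : charThree ≠ 1 := by
  intro h
  have h1 : charThree 5 = 1 := by rw [h]; exact MulChar.one_apply (by decide)
  rw [charThree_apply, show chiThree 5 = -1 by decide] at h1
  norm_num at h1

theorem charFour_ne_one : charFour ≠ 1 := by
  intro h
  have h1 : charFour 7 = 1 := by rw [h]; exact MulChar.one_apply (by decide)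
  rw [charFour_apply, show chiFour 7 = -1 by decide] at h1
  norm_num at h1

theorem prime_mod_twelve {p : ℕ} (hp : p.Prime) :
    p = 2 ∨ p = 3 ∨ p % 12 = 1 ∨ p % 12 = 5 ∨ p % 12 = 7 ∨ p % 12 = 11 := by
  by_cases h2 : p = 2
  · exact .inl h2
  by_cases h3 : p = 3
  · exact .inr (.inl h3)
  have := mt (Nat.prime_dvd_prime_iff_eq Nat.prime_two hp).1 (Ne.symm h2)
  have := mt (Nat.prime_dvd_prime_iff_eq Nat.prime_three hp).1 (Ne.symm h3)
  omega

theorem char_values_of_mod {p r : ℕ} (h : p % 12 = r) : (p : ZMod 12) = (r : ZMod 12) := by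
  rw [ZMod.natCast_eq_natCast_iff]; unfold Nat.ModEq; omega

theorem hasSum_even_geometric {z : ℂ} (hz : ‖z‖ < 1) :
    HasSum (fun k : ℕ => ((if k % 2 = 0 then 1 else 0 : ℕ) : ℂ) * z ^ k) (1 - z ^ 2)⁻¹ := by
  have hz2 : ‖z ^ 2‖ < 1 := by
    rw [norm_pow]; exact pow_lt_one₀ (norm_nonneg _) hz two_ne_zero
  have hinj : Function.Injective fun k : ℕ => 2 * k := fun a b h => by simpa using h
  rw [← hinj.hasSum_iff]
  · refine (hasSum_geometric_of_norm_lt_one hz2).congr_fun ?_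
    intro k
    simp [pow_mul]
  · intro k hk
    rw [if_neg, Nat.cast_zero, zero_mul]
    intro h
    exact hk ⟨k / 2, by simp only []; omega⟩

theorem tsum_localWeight_sq {p : ℕ} (hp : p.Prime) {z : ℂ} (hz : ‖z‖ < 1) :
    (∑' k : ℕ, (localWeight p k : ℂ) * z ^ k) ^ 2 =
      (1 - (1 : DirichletCharacter ℂ 12) p * z)⁻¹ * (1 - charTwelve p * z)⁻¹ *
        (1 - charThree p * z)⁻¹ * (1 - charFour p * z)⁻¹ := by
  have hnon : ∀ {p : ℕ}, ¬ IsUnit (p : ZMod 12) → (∀ k, localWeight p k = if k = 0 then 1 else 0) →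
      (∑' k : ℕ, (localWeight p k : ℂ) * z ^ k) ^ 2 =
      (1 - (1 : DirichletCharacter ℂ 12) p * z)⁻¹ * (1 - charTwelve p * z)⁻¹ *
        (1 - charThree p * z)⁻¹ * (1 - charFour p * z)⁻¹ := by
    intro p hu h
    rw [MulChar.map_nonunit _ hu, MulChar.map_nonunit _ hu, MulChar.map_nonunit _ hu,
      MulChar.map_nonunit _ hu, tsum_eq_single 0]
    · simp [h]
    · intro k hk; simp [h, hk]
  have hinert : p % 12 = 5 ∨ p % 12 = 7 ∨ p % 12 = 11 →
      (∑' k : ℕ, (localWeight p k : ℂ) * z ^ k) = ((1 - z) * (1 + z))⁻¹ := by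
    intro h
    simp only [localWeight_of_mod h]
    rw [(hasSum_even_geometric hz).tsum_eq]
    congr 1; ring
  rcases prime_mod_twelve hp with rfl | rfl | h | h | h | h
  · exact hnon (by decide) fun k => by simp [localWeight]
  · exact hnon (by decide) fun k => by simp [localWeight]
  · have hw : ∀ k, localWeight p k = k + 1 := by
      intro k; rw [localWeight]; split_ifs <;> omega
    have := (hasSum_choose_mul_geometric_of_norm_lt_one 1 hz).tsum_eq
    simp only [Nat.choose_one_right] at this
    simp only [hw, this]
    rw [char_values_of_mod h, charTwelve_apply, charThree_apply, charFour_apply]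
    have e1 : (1 : DirichletCharacter ℂ 12) ((1 : ℕ) : ZMod 12) = 1 := MulChar.one_apply (by decide)
    rw [e1, show chiTwelve ((1 : ℕ) : ZMod 12) = 1 by decide,
      show chiThree ((1 : ℕ) : ZMod 12) = 1 by decide,
      show chiFour ((1 : ℕ) : ZMod 12) = 1 by decide]
    simp only [one_div, Int.cast_one, one_mul, ← mul_inv]
    rw [inv_pow]; ring_nf
  · rw [hinert (by omega), char_values_of_mod h, charTwelve_apply, charThree_apply, charFour_apply]
    have e1 : (1 : DirichletCharacter ℂ 12) ((5 : ℕ) : ZMod 12) = 1 := MulChar.one_apply (by decide)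
    rw [e1, show chiTwelve ((5 : ℕ) : ZMod 12) = -1 by decide,
      show chiThree ((5 : ℕ) : ZMod 12) = -1 by decide,
      show chiFour ((5 : ℕ) : ZMod 12) = 1 by decide]
    simp only [Int.cast_one, one_mul, ← mul_inv, Int.cast_neg, neg_mul, sub_neg_eq_add]
    rw [inv_pow]; ring_nf
  · rw [hinert (by omega), char_values_of_mod h, charTwelve_apply, charThree_apply, charFour_apply]
    have e1 : (1 : DirichletCharacter ℂ 12) ((7 : ℕ) : ZMod 12) = 1 := MulChar.one_apply (by decide)
    rw [e1, show chiTwelve ((7 : ℕ) : ZMod 12) = -1 by decide,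
      show chiThree ((7 : ℕ) : ZMod 12) = 1 by decide,
      show chiFour ((7 : ℕ) : ZMod 12) = -1 by decide]
    simp only [Int.cast_one, one_mul, ← mul_inv, Int.cast_neg, neg_mul, sub_neg_eq_add]
    rw [inv_pow]; ring_nf
  · rw [hinert (by omega), char_values_of_mod h, charTwelve_apply, charThree_apply, charFour_apply]
    have e1 : (1 : DirichletCharacter ℂ 12) ((11 : ℕ) : ZMod 12) = 1 :=
      MulChar.one_apply (by decide)
    rw [e1, show chiTwelve ((11 : ℕ) : ZMod 12) = 1 by decide,
      show chiThree ((11 : ℕ) : ZMod 12) = -1 by decide,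
      show chiFour ((11 : ℕ) : ZMod 12) = -1 by decide]
    simp only [Int.cast_one, one_mul, ← mul_inv, Int.cast_neg, neg_mul, sub_neg_eq_add]
    rw [inv_pow]; ring_nf

theorem absCoeff_le_card_divisors (n : ℕ) : absCoeff n ≤ n.divisors.card := by
  induction n using Nat.recOnPosPrimePosCoprime with
  | zero => simp [absCoeff]
  | one => simp [absCoeff]
  | prime_pow p n hp hn =>
    rw [absCoeff_prime_pow hp, Nat.divisors_prime_pow hp, Finset.card_map, Finset.card_range,
      localWeight]
    split_ifs <;> omega
  | coprime a b ha hb hab iha ihb =>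
    rw [absCoeff_mul hab, hab.card_divisors_mul]
    exact Nat.mul_le_mul iha ihb

theorem LSeriesSummable_absCoeff {s : ℂ} (hs : 1 < s.re) :
    LSeriesSummable (fun n => (absCoeff n : ℂ)) s := by
  have h := DirichletCharacter.LSeriesSummable_zetaMul (1 : DirichletCharacter ℂ 1) hs
  refine Summable.of_norm_bounded h.norm fun n => LSeries.norm_term_le s ?_
  have : (DirichletCharacter.zetaMul (1 : DirichletCharacter ℂ 1)) n = n.divisors.card := by
    rw [DirichletCharacter.zetaMul, ArithmeticFunction.coe_zeta_mul_apply]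
    rw [Finset.cast_card]
    refine Finset.sum_congr rfl fun d hd => ?_
    have : ((d : ℕ) : ZMod 1) = 1 := Subsingleton.elim _ _
    simp [toArithmeticFunction, this, (Nat.pos_of_mem_divisors hd).ne']
  rw [this]
  simp only [Complex.norm_natCast]
  exact_mod_cast absCoeff_le_card_divisors n

theorem LSeries_absCoeff_sq {s : ℂ} (hs : 1 < s.re) :
    LSeries (fun n => (absCoeff n : ℂ)) s ^ 2 =
      DirichletCharacter.LFunction (1 : DirichletCharacter ℂ 12) s * DirichletCharacter.LFunction charTwelve s *
        DirichletCharacter.LFunction charThree s * DirichletCharacter.LFunction charFour s := by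
  have hterm : ∀ n : ℕ, LSeries.term (fun n => (absCoeff n : ℂ)) s n =
      (absCoeff n : ℂ) * (n : ℂ) ^ (-s) := by
    intro n
    rcases eq_or_ne n 0 with rfl | hn
    · simp [absCoeff]
    · rw [LSeries.term_of_ne_zero hn, Complex.cpow_neg, div_eq_mul_inv]
  have h1 := EulerProduct.eulerProduct_hasProd (f := LSeries.term (fun n => (absCoeff n : ℂ)) s)
    (by rw [hterm]; simp [absCoeff])
    (fun {m n} hmn => by
      rw [hterm, hterm, hterm, absCoeff_mul hmn, Nat.cast_mul, Nat.cast_mul,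
        Complex.natCast_mul_natCast_cpow]
      ring)
    (LSeriesSummable_absCoeff hs).norm (by simp)
  have h2 := h1.mul h1
  have hL := ((((1 : DirichletCharacter ℂ 12).LSeries_eulerProduct_hasProd hs).mul
    (charTwelve.LSeries_eulerProduct_hasProd hs)).mul
    (charThree.LSeries_eulerProduct_hasProd hs)).mul
    (charFour.LSeries_eulerProduct_hasProd hs)
  simp only [← DirichletCharacter.LFunction_eq_LSeries _ hs] at hL
  rw [LSeries, pow_two]
  refine h2.unique ?_
  convert hL using 2 with p
  have hz : ‖((p : ℕ) : ℂ) ^ (-s)‖ < 1 := by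
    rw [Complex.norm_natCast_cpow_of_pos p.2.pos]
    apply Real.rpow_lt_one_of_one_lt_of_neg (by exact_mod_cast p.2.one_lt)
    simp; linarith
  rw [← tsum_localWeight_sq p.2 hz, pow_two]
  have : ∀ e : ℕ, LSeries.term (fun n => (absCoeff n : ℂ)) s ((p : ℕ) ^ e) =
      (localWeight p e : ℂ) * (((p : ℕ) : ℂ) ^ (-s)) ^ e := by
    intro e
    rw [hterm, absCoeff_prime_pow p.2, Nat.cast_pow, ← Complex.natCast_cpow_natCast_mul,
      mul_comm (e : ℂ), Complex.cpow_mul_nat]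
  simp only [this]

section MeanValue

open MeasureTheory Set

theorem exists_differentiableOn_sq_eq {G : ℂ → ℂ} {c : ℂ} {r : ℝ}
    (hG : DifferentiableOn ℂ G (Metric.ball c r)) (h0 : ∀ s ∈ Metric.ball c r, G s ≠ 0) :
    ∃ H : ℂ → ℂ, DifferentiableOn ℂ H (Metric.ball c r) ∧ ∀ s ∈ Metric.ball c r, H s ^ 2 = G s := by
  rcases le_or_gt r 0 with hr | hr
  · exact ⟨G, hG, fun s hs => by rw [Metric.ball_eq_empty.2 hr] at hs; exact hs.elim⟩
  have hd : DifferentiableOn ℂ (fun s => deriv G s / G s) (Metric.ball c r) :=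
    (hG.deriv Metric.isOpen_ball).div hG h0
  obtain ⟨h, hh⟩ := hd.isExactOn_ball
  have hc : c ∈ Metric.ball c r := Metric.mem_ball_self hr
  have hconst : ∀ s ∈ Metric.ball c r,
      G s * Complex.exp (-h s) = G c * Complex.exp (-h c) := by
    have hder : ∀ s ∈ Metric.ball c r,
        HasDerivAt (fun s => G s * Complex.exp (-h s)) 0 s := by
      intro s hs
      have h1 := (hG.differentiableAt (Metric.isOpen_ball.mem_nhds hs)).hasDerivAt
      refine (h1.mul (hh s hs).neg.cexp).congr_deriv ?_
      have := h0 s hs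
      simp only [Pi.neg_apply]
      field_simp
      ring
    intro s hs
    refine Metric.isOpen_ball.is_const_of_fderiv_eq_zero (𝕜 := ℂ)
      (convex_ball c r).isPreconnected (f := fun s => G s * Complex.exp (-h s))
      (fun z hz => (hder z hz).differentiableAt.differentiableWithinAt) ?_ hs hc
    intro z hz
    ext
    simp [(hder z hz).deriv]
  set K := G c * Complex.exp (-h c) with hK
  refine ⟨fun s => K ^ (1 / 2 : ℂ) * Complex.exp (h s / 2), fun s hs => ?_, fun s hs => ?_⟩
  · exact (((hh s hs).div_const 2).cexp.const_mul _).differentiableAt.differentiableWithinAt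
  · rw [mul_pow, ← Complex.cpow_nat_mul, ← Complex.exp_nat_mul]
    push_cast
    rw [mul_one_div_cancel two_ne_zero, Complex.cpow_one, mul_div_cancel₀ _ two_ne_zero,
      ← hconst s hs, mul_assoc, ← Complex.exp_add]
    simp

theorem exists_ball_subset_ne_zero {G : ℂ → ℂ} (hG : Continuous G)
    (h0 : ∀ s : ℂ, 1 ≤ s.re → G s ≠ 0) {T : ℝ} (hT : 0 < T) :
    ∃ R r : ℝ, 0 < R ∧ (∀ s ∈ Metric.ball ((1 + R : ℝ) : ℂ) r, G s ≠ 0) ∧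
      ∀ t : ℝ, |t| ≤ T → 1 + (t : ℂ) * Complex.I ∈ Metric.ball ((1 + R : ℝ) : ℂ) r := by
  have hK : IsCompact ((fun t : ℝ => 1 + (t : ℂ) * Complex.I) '' Icc (-(T + 1)) (T + 1)) :=
    isCompact_Icc.image (by fun_prop)
  have hopen : IsOpen {s | G s ≠ 0} := isOpen_ne.preimage hG
  obtain ⟨δ, hδ, hsub⟩ := hK.exists_thickening_subset_open hopen (by
    rintro _ ⟨t, -, rfl⟩
    exact h0 _ (by simp))
  set R := (T ^ 2 + 1) / δ with hR
  have hRpos : 0 < R := by positivity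
  have hdist : ∀ s : ℂ, dist s ((1 + R : ℝ) : ℂ) ^ 2 = (1 + R - s.re) ^ 2 + s.im ^ 2 := by
    intro s
    rw [Complex.dist_eq, ← Complex.normSq_eq_norm_sq, Complex.normSq_apply]
    simp; ring
  have hmem : ∀ s : ℂ, s ∈ Metric.ball ((1 + R : ℝ) : ℂ) (Real.sqrt (R ^ 2 + T ^ 2 + 1)) ↔
      (1 + R - s.re) ^ 2 + s.im ^ 2 < R ^ 2 + T ^ 2 + 1 := by
    intro s
    rw [Metric.mem_ball, Real.lt_sqrt dist_nonneg, hdist]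
  refine ⟨R, Real.sqrt (R ^ 2 + T ^ 2 + 1), hRpos, fun s hs => ?_, fun t ht => ?_⟩
  · rw [hmem] at hs
    rcases le_or_gt 1 s.re with h | h
    · exact h0 s h
    · apply hsub
      rw [Metric.mem_thickening_iff]
      refine ⟨_, ⟨s.im, ?_, rfl⟩, ?_⟩
      · have : |s.im| ≤ T + 1 := abs_le_of_sq_le_sq (by nlinarith) (by positivity)
        exact abs_le.1 this
      · have hd : dist s (1 + (s.im : ℂ) * Complex.I) = 1 - s.re := by
          rw [Complex.dist_of_im_eq (by simp), Real.dist_eq, abs_of_nonpos (by simp; linarith)]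
          simp
        rw [hd]
        have hRδ : R * δ = T ^ 2 + 1 := by rw [hR]; field_simp
        by_contra! hge
        nlinarith [sq_nonneg s.im, sq_nonneg (1 - s.re)]
  · rw [hmem]
    have := sq_le_sq' (abs_le.1 ht).1 (abs_le.1 ht).2
    simp
    nlinarith

/-- The product of the `L`-functions modulo `12`, with the pole at `1` removed. -/
noncomputable def prodLFunction (s : ℂ) : ℂ :=
  DirichletCharacter.LFunctionTrivChar₁ 12 s * DirichletCharacter.LFunction charTwelve s *
    DirichletCharacter.LFunction charThree s * DirichletCharacter.LFunction charFour s

theorem differentiable_prodLFunction : Differentiable ℂ prodLFunction :=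
  (((DirichletCharacter.differentiable_LFunctionTrivChar₁ 12).mul
    (DirichletCharacter.differentiable_LFunction charTwelve_ne_one)).mul
    (DirichletCharacter.differentiable_LFunction charThree_ne_one)).mul
    (DirichletCharacter.differentiable_LFunction charFour_ne_one)

theorem prodLFunction_ne_zero {s : ℂ} (hs : 1 ≤ s.re) : prodLFunction s ≠ 0 := by
  refine mul_ne_zero (mul_ne_zero (mul_ne_zero ?_ ?_) ?_) ?_
  · rcases eq_or_ne s 1 with rfl | h1
    · exact DirichletCharacter.LFunctionTrivChar₁_apply_one_ne_zero 12
    · rw [DirichletCharacter.LFunctionTrivChar₁, Function.update_of_ne h1]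
      exact mul_ne_zero (sub_ne_zero.2 h1)
        (DirichletCharacter.LFunction_ne_zero_of_one_le_re _ (.inr h1) hs)
  · exact DirichletCharacter.LFunction_ne_zero_of_one_le_re _ (.inl charTwelve_ne_one) hs
  · exact DirichletCharacter.LFunction_ne_zero_of_one_le_re _ (.inl charThree_ne_one) hs
  · exact DirichletCharacter.LFunction_ne_zero_of_one_le_re _ (.inl charFour_ne_one) hs

theorem prodLFunction_eq {s : ℂ} (hs : 1 < s.re) :
    prodLFunction s = (LSeries (fun n => (absCoeff n : ℂ)) s * (s - 1) ^ (1 / 2 : ℂ)) ^ 2 := by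
  have h1 : s ≠ 1 := by rintro rfl; simp at hs
  rw [prodLFunction, DirichletCharacter.LFunctionTrivChar₁, Function.update_of_ne h1, mul_pow,
    LSeries_absCoeff_sq hs, ← Complex.cpow_nat_mul, DirichletCharacter.LFunctionTrivChar]
  push_cast
  rw [mul_one_div_cancel two_ne_zero, Complex.cpow_one]
  ring

theorem prodLFunction_one : prodLFunction 1 = 1 / 3 *
    (DirichletCharacter.LFunction charTwelve 1 *
    DirichletCharacter.LFunction charThree 1 * DirichletCharacter.LFunction charFour 1) := by
  have h12 : Nat.primeFactors 12 = {2, 3} := by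
    rw [show 12 = 2 ^ 2 * 3 by norm_num, Nat.primeFactors_mul (by norm_num) (by norm_num),
      Nat.primeFactors_prime_pow two_ne_zero Nat.prime_two, Nat.prime_three.primeFactors]
    rfl
  rw [prodLFunction, DirichletCharacter.LFunctionTrivChar₁, Function.update_self, h12,
    Finset.prod_pair (by norm_num)]
  push_cast
  ring

theorem LSeries_absCoeff_ofReal (x : ℝ) :
    ∃ y : ℝ, 0 ≤ y ∧ LSeries (fun n => (absCoeff n : ℂ)) x = y := by
  refine ⟨∑' n : ℕ, (absCoeff n : ℝ) * (n : ℝ) ^ (-x), tsum_nonneg fun n => by positivity, ?_⟩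
  rw [LSeries, Complex.ofReal_tsum]
  refine tsum_congr fun n => ?_
  rcases eq_or_ne n 0 with rfl | hn
  · simp [absCoeff]
  · rw [LSeries.term_of_ne_zero hn, div_eq_mul_inv, ← Complex.cpow_neg]
    push_cast
    rw [Complex.ofReal_cpow (by positivity)]
    simp

theorem differentiableOn_LSeries_absCoeff :
    DifferentiableOn ℂ (LSeries fun n => (absCoeff n : ℂ)) {s | 1 < s.re} := by
  refine (LSeries_differentiableOn _).mono fun s hs => ?_
  have h : LSeries.abscissaOfAbsConv (fun n => (absCoeff n : ℂ)) ≤ (1 : ℝ) :=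
    LSeries.abscissaOfAbsConv_le_of_forall_lt_LSeriesSummable fun y hy =>
      LSeriesSummable_absCoeff (by simpa using hy)
  exact lt_of_le_of_lt h (by exact_mod_cast hs)

theorem exists_continuation {g : ℝ} (hg : prodLFunction 1 = g) {T : ℝ} (hT : 0 < T) :
    ∃ (U : Set ℂ) (H : ℂ → ℂ), IsOpen U ∧ DifferentiableOn ℂ H U ∧
      H 1 = (Real.sqrt g : ℝ) ∧ (∀ t : ℝ, |t| ≤ T → 1 + (t : ℂ) * Complex.I ∈ U) ∧
      ∀ s ∈ U, 1 < s.re → LSeries (fun n => (absCoeff n : ℂ)) s =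
        (s - 1) ^ (-(1 / 2) : ℂ) * H s := by
  obtain ⟨R, r, hR, hball, hT'⟩ := exists_ball_subset_ne_zero
    differentiable_prodLFunction.continuous (fun s hs => prodLFunction_ne_zero hs) hT
  obtain ⟨H₀, hH₀, hsq⟩ := exists_differentiableOn_sq_eq
    differentiable_prodLFunction.differentiableOn hball
  set B := Metric.ball ((1 + R : ℝ) : ℂ) r with hB
  set Q : ℂ → ℂ := fun s => LSeries (fun n => (absCoeff n : ℂ)) s * (s - 1) ^ (1 / 2 : ℂ) with hQ
  set D := B ∩ {s : ℂ | 1 < s.re} with hD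
  have hDconv : Convex ℝ D := (convex_ball _ _).inter (convex_halfSpace_re_gt 1)
  have hQc : ContinuousOn Q D := by
    refine (differentiableOn_LSeries_absCoeff.continuousOn.mono inter_subset_right).mul ?_
    refine ContinuousOn.cpow_const (by fun_prop) fun s hs => ?_
    left
    simpa using hs.2
  have hcases : EqOn Q H₀ D ∨ EqOn Q (-H₀) D := by
    refine hDconv.isPreconnected.eq_or_eq_neg_of_sq_eq hQc (hH₀.continuousOn.mono inter_subset_left)
      (fun s hs => ?_) fun {s} hs h => ?_
    · simp only [Pi.pow_apply]
      rw [hsq s hs.1, prodLFunction_eq hs.2]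
    · have := hsq s hs.1
      rw [h] at this
      exact hball s hs.1 (by rw [← this]; simp)
  obtain ⟨H, hHd, hHsq, hHQ⟩ : ∃ H : ℂ → ℂ, DifferentiableOn ℂ H B ∧
      (∀ s ∈ B, H s ^ 2 = prodLFunction s) ∧ EqOn Q H D := by
    rcases hcases with h | h
    · exact ⟨H₀, hH₀, hsq, h⟩
    · exact ⟨-H₀, hH₀.neg, fun s hs => by rw [Pi.neg_apply, neg_sq, hsq s hs], h⟩
  have h1B : (1 : ℂ) ∈ B := by simpa using hT' 0 (by simpa using hT.le)
  refine ⟨B, H, Metric.isOpen_ball, hHd, ?_, hT', fun s hs hs1 => ?_⟩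
  · have hlim : Tendsto (fun x : ℝ => H (x : ℂ)) (nhdsWithin 1 (Ioi 1)) (nhds (H 1)) := by
      have hc : ContinuousAt H ((1 : ℝ) : ℂ) := by
        rw [Complex.ofReal_one]
        exact (hHd.differentiableAt (Metric.isOpen_ball.mem_nhds h1B)).continuousAt
      have := hc.comp (f := fun x : ℝ => (x : ℂ)) Complex.continuous_ofReal.continuousAt
      simpa [Function.comp_def] using this.tendsto.mono_left nhdsWithin_le_nhds
    have hcl : IsClosed {z : ℂ | 0 ≤ z.re ∧ z.im = 0} :=
      (isClosed_le continuous_const Complex.continuous_re).inter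
        (isClosed_eq Complex.continuous_im continuous_const)
    have hmem : H 1 ∈ {z : ℂ | 0 ≤ z.re ∧ z.im = 0} := by
      refine hcl.mem_of_tendsto hlim ?_
      have hB' : ∀ᶠ x : ℝ in nhdsWithin 1 (Ioi 1), (x : ℂ) ∈ B := by
        have := Complex.continuous_ofReal.tendsto 1
        rw [Complex.ofReal_one] at this
        exact (this.mono_left nhdsWithin_le_nhds).eventually (Metric.isOpen_ball.mem_nhds h1B)
      filter_upwards [hB', self_mem_nhdsWithin] with x hxB hx
      have hx1 : (1 : ℝ) < x := hx
      rw [← hHQ ⟨hxB, by simpa using hx1⟩]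
      obtain ⟨y, hy, hLy⟩ := LSeries_absCoeff_ofReal x
      have : Q x = ((y * (x - 1) ^ (1 / 2 : ℝ) : ℝ) : ℂ) := by
        simp only [hQ, hLy]
        push_cast
        rw [Complex.ofReal_cpow (by linarith)]
        push_cast
        rfl
      rw [this]
      refine ⟨?_, Complex.ofReal_im _⟩
      rw [Complex.ofReal_re]
      exact mul_nonneg hy (Real.rpow_nonneg (by linarith) _)
    obtain ⟨hre, him⟩ := hmem
    have heq : H 1 = ((H 1).re : ℂ) := Complex.ext rfl (by simpa using him)
    have hsq1 := hHsq 1 h1B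
    rw [hg, heq] at hsq1
    have : (H 1).re ^ 2 = g := by exact_mod_cast hsq1
    rw [heq, ← this, Real.sqrt_sq hre]
  · have h1 : s - 1 ≠ 0 := by
      intro h
      rw [sub_eq_zero] at h
      rw [h] at hs1
      simp at hs1
    rw [← hHQ ⟨hs, hs1⟩, hQ, mul_left_comm, ← Complex.cpow_add _ _ h1]
    simp

theorem tendsto_sum_absCoeff {g : ℝ} (hg : prodLFunction 1 = g) :
    Tendsto (fun x : ℝ => Real.sqrt (Real.log x) *
      ((∑ k ∈ Finset.Icc 1 ⌊x⌋₊, (absCoeff k : ℝ)) / x)) atTop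
      (nhds (Real.sqrt g / Real.sqrt Real.pi)) := by
  refine tendsto_sqrt_log_mul_sum (f := fun n => (absCoeff n : ℝ)) (fun n => Nat.cast_nonneg _)
    (fun s hs => ?_) fun T hT => ?_
  · simpa using LSeriesSummable_absCoeff (s := (s : ℂ)) (by simpa using hs)
  · simpa using exists_continuation hg hT

end MeanValue

theorem norm_sum_Ico_mul_le {f : ℕ → ℝ} {z : ℕ → ℂ} {m : ℕ} {b : ℝ}
    (hf0 : ∀ n, m ≤ n → 0 ≤ f n) (hf : ∀ n, m ≤ n → f (n + 1) ≤ f n)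
    (hz : ∀ n, ‖∑ i ∈ Finset.Ico m n, z i‖ ≤ b) {n : ℕ} (hn : m ≤ n) :
    ‖∑ i ∈ Finset.Ico m n, (f i : ℂ) * z i‖ ≤ b * f m := by
  have key : ∀ n, m ≤ n →
      ‖∑ i ∈ Finset.Ico m n, (f i : ℂ) * z i - (f n : ℂ) * ∑ i ∈ Finset.Ico m n, z i‖
        ≤ b * (f m - f n) := by
    intro n hn
    induction n, hn using Nat.le_induction with
    | base => simp
    | succ n hn ih =>
      have hsplit : ∑ i ∈ Finset.Ico m (n + 1), (f i : ℂ) * z i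
            - (f (n + 1) : ℂ) * ∑ i ∈ Finset.Ico m (n + 1), z i =
          (∑ i ∈ Finset.Ico m n, (f i : ℂ) * z i - (f n : ℂ) * ∑ i ∈ Finset.Ico m n, z i)
            + ((f n - f (n + 1) : ℝ) : ℂ) * ∑ i ∈ Finset.Ico m (n + 1), z i := by
        rw [Finset.sum_Ico_succ_top hn, Finset.sum_Ico_succ_top hn]
        push_cast
        ring
      have h2 : ‖((f n - f (n + 1) : ℝ) : ℂ) * ∑ i ∈ Finset.Ico m (n + 1), z i‖
          ≤ (f n - f (n + 1)) * b := by
        rw [norm_mul, Complex.norm_real, Real.norm_of_nonneg (sub_nonneg.2 (hf n hn))]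
        exact mul_le_mul_of_nonneg_left (hz _) (sub_nonneg.2 (hf n hn))
      rw [hsplit]
      refine (norm_add_le _ _).trans ?_
      linarith
  have h3 : ‖(f n : ℂ) * ∑ i ∈ Finset.Ico m n, z i‖ ≤ f n * b := by
    rw [norm_mul, Complex.norm_real, Real.norm_of_nonneg (hf0 n hn)]
    exact mul_le_mul_of_nonneg_left (hz _) (hf0 n hn)
  have h4 := norm_add_le
    (∑ i ∈ Finset.Ico m n, (f i : ℂ) * z i - (f n : ℂ) * ∑ i ∈ Finset.Ico m n, z i)
    ((f n : ℂ) * ∑ i ∈ Finset.Ico m n, z i)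
  rw [sub_add_cancel] at h4
  linarith [key n hn]

theorem sum_range_sub_sum_range_eq {z : ℕ → ℂ} {m n : ℕ} (h : m ≤ n) :
    ∑ i ∈ Finset.range n, z i - ∑ i ∈ Finset.range m, z i = ∑ i ∈ Finset.Ico m n, z i :=
  (Finset.sum_Ico_eq_sub _ h).symm

/-- Dirichlet's test with a bound for the tail. -/
theorem exists_tendsto_sum_mul {f : ℕ → ℝ} {z : ℕ → ℂ} {k : ℕ} {b : ℝ}
    (hf0 : ∀ n, k ≤ n → 0 ≤ f n) (hf : ∀ n, k ≤ n → f (n + 1) ≤ f n)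
    (hlim : Tendsto f atTop (nhds 0))
    (hz : ∀ m n, ‖∑ i ∈ Finset.Ico m n, z i‖ ≤ b) :
    ∃ l : ℂ, Tendsto (fun n => ∑ i ∈ Finset.range n, (f i : ℂ) * z i) atTop (nhds l) ∧
      ∀ m, k ≤ m → ‖l - ∑ i ∈ Finset.range m, (f i : ℂ) * z i‖ ≤ b * f m := by
  have key : ∀ m n, k ≤ m → m ≤ n → ‖∑ i ∈ Finset.range n, (f i : ℂ) * z i
      - ∑ i ∈ Finset.range m, (f i : ℂ) * z i‖ ≤ b * f m := by
    intro m n hk hmn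
    rw [sum_range_sub_sum_range_eq hmn]
    exact norm_sum_Ico_mul_le (fun i hi => hf0 i (hk.trans hi)) (fun i hi => hf i (hk.trans hi))
      (hz m) hmn
  have hlim2 : Tendsto (fun m => b * f m) atTop (nhds 0) := by simpa using hlim.const_mul b
  have hc : CauchySeq (fun n => ∑ i ∈ Finset.range n, (f i : ℂ) * z i) := by
    rw [Metric.cauchySeq_iff']
    intro ε hε
    obtain ⟨m, hm, hkm⟩ := ((hlim2.eventually (gt_mem_nhds hε)).and (eventually_ge_atTop k)).exists
    exact ⟨m, fun n hn => by
      rw [dist_eq_norm]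
      exact (key m n hkm hn).trans_lt hm⟩
  obtain ⟨l, hl⟩ := cauchySeq_tendsto_of_complete hc
  refine ⟨l, hl, fun m hm => ?_⟩
  refine le_of_tendsto ((hl.sub_const _).norm) ?_
  filter_upwards [eventually_ge_atTop m] with n hn
  exact key m n hm hn

/-- If `∑ b n` converges to `l`, then the Dirichlet series `∑ b n / n ^ δ` tends to `l` as
`δ → 0+`. -/
theorem tendsto_tsum_rpow_neg_mul {b : ℕ → ℂ} {l : ℂ}
    (hb : Tendsto (fun n => ∑ i ∈ Finset.range n, b i) atTop (nhds l))
    (hs : ∀ δ : ℝ, 0 < δ → Summable fun n : ℕ => (((n : ℝ) ^ (-δ) : ℝ) : ℂ) * b n)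
    (hb0 : b 0 = 0) :
    Tendsto (fun δ : ℝ => ∑' n : ℕ, (((n : ℝ) ^ (-δ) : ℝ) : ℂ) * b n)
      (nhdsWithin 0 (Set.Ioi 0)) (nhds l) := by
  rw [Metric.tendsto_nhds]
  intro ε hε
  have hε8 : 0 < ε / 8 := by positivity
  obtain ⟨m, hm⟩ := Metric.tendsto_atTop.1 hb (ε / 8) hε8
  set M := m + 1 with hM
  have hfin : Tendsto (fun δ : ℝ => ∑ i ∈ Finset.range M, (((i : ℝ) ^ (-δ) : ℝ) : ℂ) * b i)
      (nhdsWithin 0 (Set.Ioi 0)) (nhds (∑ i ∈ Finset.range M, b i)) := by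
    refine Tendsto.mono_left ?_ nhdsWithin_le_nhds
    refine tendsto_finsetSum _ fun i _ => ?_
    rcases Nat.eq_zero_or_pos i with rfl | hi
    · simp [hb0]
    · have hc : Continuous fun δ : ℝ => (((i : ℝ) ^ (-δ) : ℝ) : ℂ) * b i := by
        refine (Complex.continuous_ofReal.comp ?_).mul continuous_const
        exact Continuous.rpow continuous_const continuous_neg fun _ => Or.inl (by positivity)
      simpa using hc.tendsto 0
  have hIco : ∀ n, ‖∑ i ∈ Finset.Ico M n, b i‖ ≤ ε / 4 := by
    intro n
    rcases le_or_gt M n with h | h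
    · rw [← sum_range_sub_sum_range_eq h, ← dist_eq_norm]
      refine (dist_triangle_right _ _ l).trans ?_
      linarith [hm n (by omega), hm M (by omega)]
    · rw [Finset.Ico_eq_empty (by omega)]
      simp only [Finset.sum_empty, norm_zero]
      positivity
  filter_upwards [Metric.tendsto_nhds.1 hfin (ε / 8) hε8, self_mem_nhdsWithin] with δ h1 hδ
  have hδ0 : 0 < δ := hδ
  have htail : ‖∑' n : ℕ, (((n : ℝ) ^ (-δ) : ℝ) : ℂ) * b n
      - ∑ i ∈ Finset.range M, (((i : ℝ) ^ (-δ) : ℝ) : ℂ) * b i‖ ≤ ε / 4 := by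
    refine le_of_tendsto (((hs δ hδ0).hasSum.tendsto_sum_nat.sub_const _).norm) ?_
    filter_upwards [eventually_ge_atTop M] with n hn
    rw [sum_range_sub_sum_range_eq hn]
    have hpos : ∀ i, M ≤ i → (0 : ℝ) < i := fun i hi => by
      have : 0 < i := by omega
      exact_mod_cast this
    refine (norm_sum_Ico_mul_le (fun i _ => by positivity) (fun i hi => ?_) hIco hn).trans ?_
    · exact Real.rpow_le_rpow_of_nonpos (hpos i hi) (by push_cast; linarith) (by linarith)
    · have : (M : ℝ) ^ (-δ) ≤ 1 :=
        Real.rpow_le_one_of_one_le_of_nonpos (by simp [hM]) (by linarith)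
      nlinarith
  rw [dist_eq_norm] at *
  have h2 : ‖∑ i ∈ Finset.range M, b i - l‖ < ε / 8 := by
    rw [← dist_eq_norm]; exact hm M (by omega)
  have h3 := norm_add₃_le (a := ∑' n : ℕ, (((n : ℝ) ^ (-δ) : ℝ) : ℂ) * b n
      - ∑ i ∈ Finset.range M, (((i : ℝ) ^ (-δ) : ℝ) : ℂ) * b i)
    (b := ∑ i ∈ Finset.range M, (((i : ℝ) ^ (-δ) : ℝ) : ℂ) * b i - ∑ i ∈ Finset.range M, b i)
    (c := ∑ i ∈ Finset.range M, b i - l)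
  rw [sub_add_sub_cancel, sub_add_sub_cancel] at h3
  linarith

theorem norm_sum_range_dirichletCharacter_le {N : ℕ} [NeZero N] {χ : DirichletCharacter ℂ N}
    (hχ : χ ≠ 1) (n : ℕ) : ‖∑ i ∈ Finset.range n, χ (i : ZMod N)‖ ≤ N := by
  induction n using Nat.strong_induction_on with
  | _ n ih =>
    rcases lt_or_ge n N with h | h
    · refine (norm_sum_le _ _).trans ?_
      refine (Finset.sum_le_card_nsmul _ _ 1 fun i _ => χ.norm_le_one _).trans ?_
      simp only [Finset.card_range, nsmul_eq_mul, mul_one]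
      exact_mod_cast h.le
    · have hper : ∑ i ∈ Finset.range N, χ (i : ZMod N) = 0 := by
        rw [← MulChar.sum_eq_zero_of_ne_one hχ]
        refine Finset.sum_bij' (fun i _ => (i : ZMod N)) (fun a _ => a.val) ?_ ?_ ?_ ?_ ?_
        · simp
        · intro a _
          simpa using ZMod.val_lt a
        · intro i hi
          exact ZMod.val_cast_of_lt (by simpa using hi)
        · intro a _
          exact ZMod.natCast_zmod_val a
        · simp
      have hN : 0 < N := Nat.pos_of_ne_zero (NeZero.ne N)
      obtain ⟨k, rfl⟩ := Nat.exists_eq_add_of_le h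
      rw [Finset.sum_range_add, hper, zero_add]
      simpa using ih k (by omega)

theorem norm_sum_Ico_dirichletCharacter_le {N : ℕ} [NeZero N] {χ : DirichletCharacter ℂ N}
    (hχ : χ ≠ 1) (m n : ℕ) : ‖∑ i ∈ Finset.Ico m n, χ (i : ZMod N)‖ ≤ 2 * N := by
  rcases le_or_gt m n with h | h
  · rw [← sum_range_sub_sum_range_eq h]
    refine (norm_sub_le _ _).trans ?_
    linarith [norm_sum_range_dirichletCharacter_le hχ n,
      norm_sum_range_dirichletCharacter_le hχ m]
  · rw [Finset.Ico_eq_empty (by omega)]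
    simp

theorem sum_log_eq_sum_vonMangoldt {N : ℕ} (χ : DirichletCharacter ℂ N) (x : ℕ) :
    ∑ i ∈ Finset.Ioc 0 x, ((Real.log i / i : ℝ) : ℂ) * χ (i : ZMod N) =
      ∑ d ∈ Finset.Ioc 0 x, ((ArithmeticFunction.vonMangoldt d / d : ℝ) : ℂ) * χ (d : ZMod N) *
        ∑ n ∈ Finset.range (x / d + 1), (((n : ℝ)⁻¹ : ℝ) : ℂ) * χ (n : ZMod N) := by
  let F : ArithmeticFunction ℂ :=
    ⟨fun d => ((ArithmeticFunction.vonMangoldt d / d : ℝ) : ℂ) * χ (d : ZMod N), by simp⟩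
  let G : ArithmeticFunction ℂ := ⟨fun n => (((n : ℝ)⁻¹ : ℝ) : ℂ) * χ (n : ZMod N), by simp⟩
  have hFG : ∀ i : ℕ, (F * G) i = ((Real.log i / i : ℝ) : ℂ) * χ (i : ZMod N) := by
    intro i
    have hterm : ∀ x ∈ i.divisorsAntidiagonal, F x.1 * G x.2 =
        ((ArithmeticFunction.vonMangoldt x.1 : ℝ) : ℂ) * ((i : ℂ)⁻¹ * χ (i : ZMod N)) := by
      intro x hx
      obtain ⟨h, -⟩ := Nat.mem_divisorsAntidiagonal.1 hx
      simp only [F, G, ArithmeticFunction.coe_mk, ← h]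
      push_cast
      rw [map_mul, mul_inv, div_eq_mul_inv]
      ring
    rw [ArithmeticFunction.mul_apply, Finset.sum_congr rfl hterm, ← Finset.sum_mul,
      Nat.sum_divisorsAntidiagonal
        (fun a _ => ((ArithmeticFunction.vonMangoldt a : ℝ) : ℂ)),
      ← ArithmeticFunction.vonMangoldt_sum]
    push_cast
    ring
  have hrange : ∀ k : ℕ, ∑ n ∈ Finset.range (k + 1), (((n : ℝ)⁻¹ : ℝ) : ℂ) * χ (n : ZMod N)
      = ∑ n ∈ Finset.Ioc 0 k, G n := by
    intro k
    rw [Finset.range_eq_Ico, Finset.sum_eq_sum_Ico_succ_bot (by omega)]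
    simp only [Nat.cast_zero, inv_zero, Complex.ofReal_zero, zero_mul, zero_add]
    rfl
  simp only [hrange, ← hFG]
  exact ArithmeticFunction.sum_Ioc_mul_eq_sum_sum F G x

theorem dirichletCharacter_LSeries_term {N : ℕ} (χ : DirichletCharacter ℂ N) (δ : ℝ)
    (n : ℕ) :
    LSeries.term (fun n : ℕ => χ (n : ZMod N)) ((1 + δ : ℝ) : ℂ) n =
      (((n : ℝ) ^ (-δ) : ℝ) : ℂ) * ((((n : ℝ)⁻¹ : ℝ) : ℂ) * χ (n : ZMod N)) := by
  rcases Nat.eq_zero_or_pos n with rfl | hn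
  · simp
  · have hn0 : (0 : ℝ) < n := by exact_mod_cast hn
    rw [LSeries.term_of_ne_zero hn.ne', div_eq_mul_inv, ← Complex.cpow_neg,
      ← Complex.ofReal_neg, ← Complex.ofReal_natCast, ← Complex.ofReal_cpow hn0.le,
      ← mul_assoc, ← Complex.ofReal_mul, neg_add, Real.rpow_add hn0, Real.rpow_neg_one]
    push_cast
    ring

section CharacterSums

variable {N : ℕ} [NeZero N] {χ : DirichletCharacter ℂ N}

theorem tendsto_LFunction_one_add (hχ : χ ≠ 1) :
    Tendsto (fun δ : ℝ => χ.LFunction ((1 + δ : ℝ) : ℂ)) (nhdsWithin 0 (Set.Ioi 0))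
      (nhds (χ.LFunction 1)) := by
  have hc : Continuous fun δ : ℝ => χ.LFunction ((1 + δ : ℝ) : ℂ) :=
    (DirichletCharacter.differentiable_LFunction hχ).continuous.comp
      (Complex.continuous_ofReal.comp (continuous_const.add continuous_id))
  have := hc.tendsto 0
  simp only [add_zero, Complex.ofReal_one] at this
  exact this.mono_left nhdsWithin_le_nhds

theorem norm_LFunction_one_sub_sum_le (hχ : χ ≠ 1) {m : ℕ} (hm : 1 ≤ m) :
    ‖χ.LFunction 1 - ∑ n ∈ Finset.range m, (((n : ℝ)⁻¹ : ℝ) : ℂ) * χ (n : ZMod N)‖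
      ≤ 2 * N * (m : ℝ)⁻¹ := by
  have hanti : ∀ n : ℕ, 1 ≤ n → ((n + 1 : ℕ) : ℝ)⁻¹ ≤ (n : ℝ)⁻¹ := fun n hn => by
    have : (0 : ℝ) < n := by exact_mod_cast hn
    exact inv_anti₀ this (by push_cast; linarith)
  obtain ⟨l, hl, hbd⟩ := exists_tendsto_sum_mul (f := fun n : ℕ => (n : ℝ)⁻¹) (k := 1)
    (fun n _ => by positivity) hanti tendsto_inv_atTop_nhds_zero_nat
    (norm_sum_Ico_dirichletCharacter_le hχ)
  suffices hL : χ.LFunction 1 = l by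
    rw [hL]; exact hbd m hm
  refine tendsto_nhds_unique (tendsto_LFunction_one_add hχ) ?_
  have h1 : ∀ δ : ℝ, 0 < δ → 1 < (((1 + δ : ℝ) : ℂ)).re := fun δ hδ => by
    rw [Complex.ofReal_re]; linarith
  refine (tendsto_tsum_rpow_neg_mul hl (fun δ hδ => ?_) (by simp)).congr' ?_
  · refine (DirichletCharacter.LSeriesSummable_of_one_lt_re χ (h1 δ hδ)).congr fun n => ?_
    exact dirichletCharacter_LSeries_term χ δ n
  · filter_upwards [self_mem_nhdsWithin] with δ hδ
    rw [DirichletCharacter.LFunction_eq_LSeries χ (h1 δ hδ), LSeries]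
    exact tsum_congr fun n => (dirichletCharacter_LSeries_term χ δ n).symm

theorem exists_norm_sum_log_le (hχ : χ ≠ 1) : ∃ B : ℝ, ∀ n : ℕ,
    ‖∑ i ∈ Finset.range n, ((Real.log i / i : ℝ) : ℂ) * χ (i : ZMod N)‖ ≤ B := by
  have hpos : ∀ n : ℕ, 3 ≤ n → 0 ≤ Real.log n / n := fun n _ => by positivity
  have hanti : ∀ n : ℕ, 3 ≤ n → Real.log ((n + 1 : ℕ) : ℝ) / ((n + 1 : ℕ) : ℝ)
      ≤ Real.log n / n := fun n hn => by
    have h3 : (3 : ℝ) ≤ n := by exact_mod_cast hn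
    have he : Real.exp 1 ≤ n := Real.exp_one_lt_three.le.trans h3
    refine Real.log_div_self_antitoneOn he ?_ ?_
    · exact he.trans (by push_cast; linarith)
    · push_cast; linarith
  have hlim : Tendsto (fun n : ℕ => Real.log n / n) atTop (nhds 0) :=
    (Real.isLittleO_log_id_atTop.tendsto_div_nhds_zero).comp tendsto_natCast_atTop_atTop
  obtain ⟨l, hl, -⟩ := exists_tendsto_sum_mul (f := fun n : ℕ => Real.log n / n) hpos hanti hlim
    (norm_sum_Ico_dirichletCharacter_le hχ)
  obtain ⟨B, hB⟩ := (Metric.isBounded_range_of_tendsto _ hl).exists_norm_le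
  exact ⟨B, fun n => hB _ ⟨n, rfl⟩⟩

theorem exists_norm_sum_vonMangoldt_le (hχ : χ ≠ 1) : ∃ B : ℝ, ∀ x : ℕ,
    ‖∑ d ∈ Finset.Ioc 0 x, ((ArithmeticFunction.vonMangoldt d / d : ℝ) : ℂ) * χ (d : ZMod N)‖
      ≤ B := by
  obtain ⟨B, hB⟩ := exists_norm_sum_log_le hχ
  have hL : χ.LFunction 1 ≠ 0 := DirichletCharacter.LFunction_apply_one_ne_zero hχ
  have hLpos : 0 < ‖χ.LFunction 1‖ := norm_pos_iff.2 hL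
  set c : ℝ := Real.log 4 + 4 with hc
  refine ⟨(B + 2 * N * c) / ‖χ.LFunction 1‖, fun x => ?_⟩
  rw [le_div_iff₀ hLpos, ← norm_mul]
  rcases Nat.eq_zero_or_pos x with rfl | hx
  · have hB0 := hB 0
    simp only [Finset.range_zero, Finset.sum_empty, norm_zero] at hB0
    simp only [Finset.Ioc_self, Finset.sum_empty, zero_mul, norm_zero]
    positivity
  have hx0 : (0 : ℝ) < x := by exact_mod_cast hx
  set T : ℕ → ℂ := fun m => ∑ n ∈ Finset.range m, (((n : ℝ)⁻¹ : ℝ) : ℂ) * χ (n : ZMod N) with hT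
  set A : ℕ → ℂ := fun d =>
    ((ArithmeticFunction.vonMangoldt d / d : ℝ) : ℂ) * χ (d : ZMod N) with hA
  have hsplit : (∑ d ∈ Finset.Ioc 0 x, A d) * χ.LFunction 1 =
      ∑ d ∈ Finset.Ioc 0 x, A d * T (x / d + 1)
        + ∑ d ∈ Finset.Ioc 0 x, A d * (χ.LFunction 1 - T (x / d + 1)) := by
    rw [Finset.sum_mul, ← Finset.sum_add_distrib]
    refine Finset.sum_congr rfl fun d _ => ?_
    ring
  have h1 : ‖∑ d ∈ Finset.Ioc 0 x, A d * T (x / d + 1)‖ ≤ B := by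
    rw [hA, hT, ← sum_log_eq_sum_vonMangoldt]
    have h := hB (x + 1)
    rw [Finset.range_eq_Ico, Finset.sum_eq_sum_Ico_succ_bot (by omega)] at h
    simp only [Nat.cast_zero, div_zero, Complex.ofReal_zero, zero_mul, zero_add] at h
    exact h
  have h2 : ‖∑ d ∈ Finset.Ioc 0 x, A d * (χ.LFunction 1 - T (x / d + 1))‖ ≤ 2 * N * c := by
    have hterm : ∀ d ∈ Finset.Ioc 0 x, ‖A d * (χ.LFunction 1 - T (x / d + 1))‖ ≤
        2 * N * (x : ℝ)⁻¹ * ArithmeticFunction.vonMangoldt d := by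
      intro d hd
      have hd0 : (0 : ℝ) < d := by exact_mod_cast (Finset.mem_Ioc.1 hd).1
      have hA1 : ‖A d‖ ≤ ArithmeticFunction.vonMangoldt d / d := by
        rw [hA, norm_mul, Complex.norm_real, Real.norm_of_nonneg (by positivity)]
        exact mul_le_of_le_one_right (by positivity) (χ.norm_le_one _)
      have hT1 := norm_LFunction_one_sub_sum_le hχ (m := x / d + 1) (Nat.le_add_left 1 _)
      have hlt : (x : ℝ) / d ≤ ((x / d + 1 : ℕ) : ℝ) := by
        rw [div_le_iff₀ hd0]
        have : x ≤ (x / d + 1) * d := by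
          have := Nat.lt_div_mul_add (a := x) (Finset.mem_Ioc.1 hd).1
          linarith [Nat.add_mul (x / d) 1 d]
        exact_mod_cast this
      have hT2 : (((x / d + 1 : ℕ) : ℝ))⁻¹ ≤ d / x := by
        rw [← inv_div]
        exact inv_anti₀ (by positivity) hlt
      rw [norm_mul]
      calc ‖A d‖ * ‖χ.LFunction 1 - T (x / d + 1)‖
          ≤ ArithmeticFunction.vonMangoldt d / d * (2 * N * (d / x)) := by
            refine mul_le_mul hA1 (hT1.trans ?_) (norm_nonneg _) (by positivity)
            exact mul_le_mul_of_nonneg_left hT2 (by positivity)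
        _ = _ := by field_simp
    refine (norm_sum_le _ _).trans ((Finset.sum_le_sum hterm).trans ?_)
    rw [← Finset.mul_sum]
    have hpsi := Chebyshev.psi_le_const_mul_self hx0.le
    rw [Chebyshev.psi, Nat.floor_natCast] at hpsi
    calc 2 * N * (x : ℝ)⁻¹ * ∑ d ∈ Finset.Ioc 0 x, ArithmeticFunction.vonMangoldt d
        ≤ 2 * N * (x : ℝ)⁻¹ * (c * x) := mul_le_mul_of_nonneg_left hpsi (by positivity)
      _ = _ := by field_simp
  rw [hsplit]
  exact (norm_add_le _ _).trans (add_le_add h1 h2)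

end CharacterSums

theorem summable_vonMangoldt_non_primes_div :
    Summable fun n : ℕ => (if n.Prime then 0 else ArithmeticFunction.vonMangoldt n) / (n : ℝ) := by
  refine (ArithmeticFunction.vonMangoldt.summable_residueClass_non_primes_div
    (a := (0 : ZMod 1))).congr fun n => ?_
  have : ArithmeticFunction.vonMangoldt.residueClass (0 : ZMod 1) n =
      ArithmeticFunction.vonMangoldt n := by
    rw [ArithmeticFunction.vonMangoldt.residueClass]
    exact Set.indicator_of_mem (s := {n : ℕ | (n : ZMod 1) = 0}) (Subsingleton.elim _ _) _
  rw [this]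

section PrimeSums

variable {N : ℕ} [NeZero N] {χ : DirichletCharacter ℂ N}

theorem exists_norm_sum_prime_log_le (hχ : χ ≠ 1) : ∃ B : ℝ, ∀ n : ℕ,
    ‖∑ i ∈ Finset.range n, (if i.Prime then ((Real.log i / i : ℝ) : ℂ) * χ (i : ZMod N) else 0)‖
      ≤ B := by
  obtain ⟨B, hB⟩ := exists_norm_sum_vonMangoldt_le hχ
  set r : ℕ → ℝ := fun n => (if n.Prime then 0 else ArithmeticFunction.vonMangoldt n) / (n : ℝ)
    with hr
  have hr0 : ∀ n, 0 ≤ r n := fun n => by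
    rw [hr]
    refine div_nonneg ?_ n.cast_nonneg
    split_ifs
    · exact le_rfl
    · exact ArithmeticFunction.vonMangoldt_nonneg
  have hsplit : ∀ i : ℕ,
      (if i.Prime then ((Real.log i / i : ℝ) : ℂ) * χ (i : ZMod N) else 0) =
        ((ArithmeticFunction.vonMangoldt i / i : ℝ) : ℂ) * χ (i : ZMod N)
          - (r i : ℂ) * χ (i : ZMod N) := by
    intro i
    rw [hr]
    by_cases hi : i.Prime
    · simp [hi, ArithmeticFunction.vonMangoldt_apply_prime hi]
    · simp [hi]
  refine ⟨B + ∑' n, r n, fun n => ?_⟩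
  simp only [hsplit, Finset.sum_sub_distrib]
  refine (norm_sub_le _ _).trans (add_le_add ?_ ?_)
  · rcases n with _ | n
    · simpa using (norm_nonneg _).trans (hB 0)
    · have h := hB n
      rw [Finset.range_eq_Ico, Finset.sum_eq_sum_Ico_succ_bot (by omega)]
      simp only [Nat.cast_zero, div_zero, Complex.ofReal_zero, zero_mul, zero_add]
      exact h
  · refine (norm_sum_le _ _).trans ((Finset.sum_le_sum fun i _ => ?_).trans
      (summable_vonMangoldt_non_primes_div.sum_le_tsum _ fun i _ => hr0 i))
    rw [norm_mul, Complex.norm_real, Real.norm_of_nonneg (hr0 i)]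
    exact mul_le_of_le_one_right (hr0 i) (χ.norm_le_one _)

theorem exists_tendsto_sum_prime (hχ : χ ≠ 1) : ∃ l : ℂ,
    Tendsto (fun n => ∑ i ∈ Finset.range n,
      (if i.Prime then (((i : ℝ)⁻¹ : ℝ) : ℂ) * χ (i : ZMod N) else 0)) atTop (nhds l) := by
  obtain ⟨B, hB⟩ := exists_norm_sum_prime_log_le hχ
  have hlog : ∀ n : ℕ, 2 ≤ n → 0 < Real.log n := fun n hn =>
    Real.log_pos (by exact_mod_cast hn)
  have hlim : Tendsto (fun n : ℕ => (Real.log n)⁻¹) atTop (nhds 0) :=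
    (Real.tendsto_log_atTop.comp tendsto_natCast_atTop_atTop).inv_tendsto_atTop
  have hz : ∀ m n : ℕ, ‖∑ i ∈ Finset.Ico m n,
      (if i.Prime then ((Real.log i / i : ℝ) : ℂ) * χ (i : ZMod N) else 0)‖ ≤ B + B := by
    intro m n
    rcases le_or_gt m n with h | h
    · rw [← sum_range_sub_sum_range_eq h]
      exact (norm_sub_le _ _).trans (add_le_add (hB n) (hB m))
    · rw [Finset.Ico_eq_empty (by omega)]
      have := (norm_nonneg _).trans (hB 0)
      simpa using this
  obtain ⟨l, hl, -⟩ := exists_tendsto_sum_mul (f := fun n : ℕ => (Real.log n)⁻¹) (k := 2)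
    (fun n hn => (inv_pos.2 (hlog n hn)).le)
    (fun n hn => inv_anti₀ (hlog n hn) (Real.log_le_log (by positivity) (by push_cast; linarith)))
    hlim hz
  refine ⟨l, hl.congr fun n => Finset.sum_congr rfl fun i _ => ?_⟩
  by_cases hi : i.Prime
  · have := (hlog i hi.two_le).ne'
    simp only [hi, if_true]
    rw [← mul_assoc, ← Complex.ofReal_mul]
    congr 2
    field_simp
  · simp [hi]

theorem norm_neg_log_one_sub_sub_le {z : ℂ} (hz : ‖z‖ ≤ 1 / 2) :
    ‖-Complex.log (1 - z) - z‖ ≤ ‖z‖ ^ 2 := by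
  have h1 : ‖-z‖ < 1 := by rw [norm_neg]; linarith
  have h := Complex.norm_log_one_add_sub_self_le h1
  rw [norm_neg, ← sub_eq_add_neg] at h
  rw [← norm_neg, show -(-Complex.log (1 - z) - z) = Complex.log (1 - z) - -z by ring]
  refine h.trans ?_
  have : (1 - ‖z‖)⁻¹ ≤ 2 := by
    rw [inv_le_comm₀ (by linarith) (by norm_num)]
    linarith
  nlinarith [sq_nonneg ‖z‖]

theorem tendsto_prod_eulerFactor (hχ : χ ≠ 1) :
    Tendsto (fun x : ℕ => ∏ p ∈ (Finset.range (x + 1)).filter Nat.Prime,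
      (1 - χ (p : ZMod N) * (p : ℂ)⁻¹)⁻¹) atTop (nhds (χ.LFunction 1)) := by
  obtain ⟨l, hl⟩ := exists_tendsto_sum_prime hχ
  set b : ℕ → ℂ := fun i => if i.Prime then (((i : ℝ)⁻¹ : ℝ) : ℂ) * χ (i : ZMod N) else 0 with hb
  set w : ℝ → ℕ → ℂ := fun δ n => (((n : ℝ) ^ (-δ) : ℝ) : ℂ) * b n with hw
  set E : ℂ → ℂ := fun z => -Complex.log (1 - z) - z with hE
  have hbn : ∀ n, ‖b n‖ ≤ 1 / 2 ∧ ‖b n‖ ≤ (n : ℝ)⁻¹ := by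
    intro n
    by_cases hn : n.Prime
    · have h2 : (2 : ℝ) ≤ n := by exact_mod_cast hn.two_le
      have h3 : ‖b n‖ ≤ (n : ℝ)⁻¹ := by
        simp only [hb, hn, if_true]
        rw [norm_mul, Complex.norm_real, Real.norm_of_nonneg (by positivity)]
        exact mul_le_of_le_one_right (by positivity) (χ.norm_le_one _)
      refine ⟨h3.trans ?_, h3⟩
      rw [one_div]
      exact inv_anti₀ (by norm_num) h2
    · simp [hb, hn]
  have hwn : ∀ δ : ℝ, 0 ≤ δ → ∀ n, ‖w δ n‖ ≤ ‖b n‖ := by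
    intro δ hδ n
    rcases Nat.eq_zero_or_pos n with rfl | hn
    · simp [hw, hb, Nat.not_prime_zero]
    · rw [hw, norm_mul, Complex.norm_real, Real.norm_of_nonneg (by positivity)]
      refine mul_le_of_le_one_left (norm_nonneg _) ?_
      exact Real.rpow_le_one_of_one_le_of_nonpos (by exact_mod_cast hn) (by linarith)
  have hEn : ∀ δ : ℝ, 0 ≤ δ → ∀ n, ‖E (w δ n)‖ ≤ ((n : ℝ) ^ 2)⁻¹ := by
    intro δ hδ n
    have h := hwn δ hδ n
    refine (norm_neg_log_one_sub_sub_le (h.trans (hbn n).1)).trans ?_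
    rw [← inv_pow]
    exact pow_le_pow_left₀ (norm_nonneg _) (h.trans (hbn n).2) 2
  have hsum2 : Summable fun n : ℕ => ((n : ℝ) ^ 2)⁻¹ :=
    Real.summable_nat_pow_inv.2 (by norm_num)
  have hw0 : ∀ n, w 0 n = b n := fun n => by simp [hw]
  have hEsum : ∀ δ : ℝ, 0 ≤ δ → Summable fun n => E (w δ n) := fun δ hδ =>
    Summable.of_norm_bounded hsum2 (hEn δ hδ)
  have hwsum : ∀ δ : ℝ, 0 < δ → Summable (w δ) := by
    intro δ hδ
    have hs : Summable fun n : ℕ => (n : ℝ) ^ (-(1 + δ)) :=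
      Real.summable_nat_rpow.2 (by linarith)
    refine Summable.of_norm_bounded hs fun n => ?_
    rcases Nat.eq_zero_or_pos n with rfl | hn
    · simp only [hw, hb, Nat.not_prime_zero, if_false, mul_zero, norm_zero]
      positivity
    · have hn0 : (0 : ℝ) < n := by exact_mod_cast hn
      rw [hw, norm_mul, Complex.norm_real, Real.norm_of_nonneg (by positivity), neg_add,
        Real.rpow_add hn0, Real.rpow_neg_one, mul_comm]
      exact mul_le_mul_of_nonneg_right (hbn n).2 (by positivity)
  have hlim1 : Tendsto (fun δ : ℝ => ∑' n, w δ n) (nhdsWithin 0 (Set.Ioi 0)) (nhds l) :=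
    tendsto_tsum_rpow_neg_mul hl hwsum (by simp [hb, Nat.not_prime_zero])
  have hlim2 : Tendsto (fun δ : ℝ => ∑' n, E (w δ n)) (nhdsWithin 0 (Set.Ioi 0))
      (nhds (∑' n, E (b n))) := by
    refine tendsto_tsum_of_dominated_convergence hsum2 (fun n => ?_) ?_
    · rw [← hw0 n]
      refine Tendsto.mono_left ?_ nhdsWithin_le_nhds
      have hcw : ContinuousAt (fun δ : ℝ => w δ n) 0 := by
        rcases Nat.eq_zero_or_pos n with rfl | hn
        · simp only [hw, hb, Nat.not_prime_zero, if_false, mul_zero]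
          exact continuousAt_const
        · refine Continuous.continuousAt ((Complex.continuous_ofReal.comp ?_).mul continuous_const)
          exact Continuous.rpow continuous_const continuous_neg fun _ => Or.inl (by positivity)
      have hslit : 1 - w 0 n ∈ Complex.slitPlane := by
        refine Complex.mem_slitPlane_of_norm_lt_one (z := -w 0 n) ?_ |> fun h => by
          rwa [← sub_eq_add_neg] at h
        rw [norm_neg, hw0]
        linarith [(hbn n).1]
      have : ContinuousAt (fun δ : ℝ => -Complex.log (1 - w δ n) - w δ n) 0 :=
        (((continuousAt_const.sub hcw).clog hslit).neg).sub hcw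
      exact this.tendsto
    · filter_upwards [self_mem_nhdsWithin] with δ hδ n
      exact hEn δ (le_of_lt hδ) n
  have hexp : ∀ δ : ℝ, 0 < δ →
      Complex.exp (∑' n, w δ n + ∑' n, E (w δ n)) = χ.LFunction ((1 + δ : ℝ) : ℂ) := by
    intro δ hδ
    have hre : 1 < (((1 + δ : ℝ) : ℂ)).re := by rw [Complex.ofReal_re]; linarith
    rw [DirichletCharacter.LFunction_eq_LSeries χ hre,
      ← DirichletCharacter.LSeries_eulerProduct_exp_log χ hre,
      ← (hwsum δ hδ).tsum_add (hEsum δ hδ.le)]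
    congr 1
    have h1 : ∀ n : ℕ, w δ n + E (w δ n) = -Complex.log (1 - w δ n) := fun n => by
      simp only [hE]; ring
    simp only [h1]
    rw [← tsum_subtype_eq_of_support_subset (s := {p : ℕ | p.Prime})]
    · refine tsum_congr fun p => ?_
      have hp : (p : ℕ).Prime := p.2
      have hp0 : (0 : ℝ) < (p : ℕ) := by exact_mod_cast hp.pos
      congr 3
      simp only [hw, hb, hp, if_true]
      rw [← mul_assoc, ← Complex.ofReal_mul, ← Real.rpow_neg_one, ← Real.rpow_add hp0,
        Complex.ofReal_cpow hp0.le, mul_comm]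
      congr 2
      push_cast
      ring
    · intro n hn
      by_contra h
      have h' : ¬ n.Prime := h
      simp [hw, hb, h'] at hn
  have hLval : Complex.exp (l + ∑' n, E (b n)) = χ.LFunction 1 := by
    refine tendsto_nhds_unique ?_ (tendsto_LFunction_one_add hχ)
    refine ((Complex.continuous_exp.tendsto _).comp (hlim1.add hlim2)).congr' ?_
    filter_upwards [self_mem_nhdsWithin] with δ hδ
    exact hexp δ hδ
  have hEb : Summable fun n => E (b n) := by simpa only [hw0] using hEsum 0 le_rfl
  have hpart : Tendsto (fun n => ∑ i ∈ Finset.range n, (b i + E (b i))) atTop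
      (nhds (l + ∑' n, E (b n))) := by
    simp only [Finset.sum_add_distrib]
    exact hl.add hEb.hasSum.tendsto_sum_nat
  rw [← hLval]
  refine ((Complex.continuous_exp.tendsto _).comp
    (hpart.comp (tendsto_add_atTop_nat 1))).congr fun x => ?_
  simp only [Function.comp_apply]
  rw [Complex.exp_sum, Finset.prod_filter]
  refine Finset.prod_congr rfl fun p _ => ?_
  by_cases hp : p.Prime
  · have hne : 1 - b p ≠ 0 := by
      intro h
      have h2 := (hbn p).1
      rw [← sub_eq_zero.1 h] at h2
      norm_num at h2
    rw [show b p + E (b p) = -Complex.log (1 - b p) by simp only [hE]; ring, Complex.exp_neg,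
      Complex.exp_log hne]
    simp only [hb, hp, if_true]
    push_cast
    rw [mul_comm]
  · simp [hb, hE, hp]

end PrimeSums

/-- The local factor at `p` of the square root of the product of the three `L`-values at `1`. -/
noncomputable def rootEulerFactor (p : ℕ) : ℝ :=
  if p % 12 = 5 ∨ p % 12 = 7 ∨ p % 12 = 11 then
    (1 + (p : ℝ)⁻¹)⁻¹ * (1 - (p : ℝ)⁻¹) ^ (-(1 / 2) : ℝ)
  else if p % 12 = 1 then (1 - (p : ℝ)⁻¹) ^ (-(3 / 2) : ℝ)
  else 1

theorem one_sub_inv_prime_pos {p : ℕ} (hp : p.Prime) : 0 < 1 - (p : ℝ)⁻¹ := by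
  have : (1 : ℝ) < p := by exact_mod_cast hp.one_lt
  exact sub_pos.2 (inv_lt_one_of_one_lt₀ this)

theorem rootEulerFactor_pos {p : ℕ} (hp : p.Prime) : 0 < rootEulerFactor p := by
  have h1 := one_sub_inv_prime_pos hp
  rw [rootEulerFactor]
  split_ifs <;> positivity

theorem rootEulerFactor_sq {p : ℕ} (hp : p.Prime) :
    ((rootEulerFactor p ^ 2 : ℝ) : ℂ) =
      (1 - charTwelve (p : ZMod 12) * (p : ℂ)⁻¹)⁻¹ * (1 - charThree (p : ZMod 12) * (p : ℂ)⁻¹)⁻¹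
        * (1 - charFour (p : ZMod 12) * (p : ℂ)⁻¹)⁻¹ := by
  have h1 := one_sub_inv_prime_pos hp
  have hhalf : ((1 - (p : ℝ)⁻¹) ^ (-(1 / 2) : ℝ)) ^ 2 = (1 - (p : ℝ)⁻¹)⁻¹ := by
    rw [← Real.rpow_natCast, ← Real.rpow_mul h1.le,
      ← Real.rpow_neg_one (1 - (p : ℝ)⁻¹)]
    norm_num
  have hthree : ((1 - (p : ℝ)⁻¹) ^ (-(3 / 2) : ℝ)) ^ 2 = ((1 - (p : ℝ)⁻¹) ^ 3)⁻¹ := by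
    rw [← Real.rpow_natCast, ← Real.rpow_mul h1.le, ← Real.rpow_natCast,
      ← Real.rpow_neg h1.le]
    norm_num
  rw [charTwelve_apply, charThree_apply, charFour_apply, rootEulerFactor]
  rcases prime_mod_twelve hp with rfl | rfl | h | h | h | h
  · rw [show chiTwelve ((2 : ℕ) : ZMod 12) = 0 by decide,
      show chiThree ((2 : ℕ) : ZMod 12) = 0 by decide,
      show chiFour ((2 : ℕ) : ZMod 12) = 0 by decide]
    norm_num
  · rw [show chiTwelve ((3 : ℕ) : ZMod 12) = 0 by decide,
      show chiThree ((3 : ℕ) : ZMod 12) = 0 by decide,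
      show chiFour ((3 : ℕ) : ZMod 12) = 0 by decide]
    norm_num
  · rw [char_values_of_mod h,
      show chiTwelve ((1 : ℕ) : ZMod 12) = 1 by decide,
      show chiThree ((1 : ℕ) : ZMod 12) = 1 by decide,
      show chiFour ((1 : ℕ) : ZMod 12) = 1 by decide, if_neg (by omega), if_pos h, hthree]
    push_cast
    rw [one_mul, ← mul_inv, ← mul_inv]
    ring
  · rw [char_values_of_mod h,
      show chiTwelve ((5 : ℕ) : ZMod 12) = -1 by decide,
      show chiThree ((5 : ℕ) : ZMod 12) = -1 by decide,
      show chiFour ((5 : ℕ) : ZMod 12) = 1 by decide, if_pos (by omega), mul_pow, hhalf]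
    push_cast
    rw [neg_one_mul, one_mul, sub_neg_eq_add]
    ring
  · rw [char_values_of_mod h,
      show chiTwelve ((7 : ℕ) : ZMod 12) = -1 by decide,
      show chiThree ((7 : ℕ) : ZMod 12) = 1 by decide,
      show chiFour ((7 : ℕ) : ZMod 12) = -1 by decide, if_pos (by omega), mul_pow, hhalf]
    push_cast
    rw [neg_one_mul, one_mul, sub_neg_eq_add]
    ring
  · rw [char_values_of_mod h,
      show chiTwelve ((11 : ℕ) : ZMod 12) = 1 by decide,
      show chiThree ((11 : ℕ) : ZMod 12) = -1 by decide,
      show chiFour ((11 : ℕ) : ZMod 12) = -1 by decide, if_pos (by omega), mul_pow, hhalf]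
    push_cast
    rw [neg_one_mul, one_mul, sub_neg_eq_add]
    ring

theorem exists_tendsto_prod_rootEulerFactor : ∃ L : ℝ, 0 < L ∧
    Tendsto (fun x : ℕ => ∏ p ∈ (Finset.range (x + 1)).filter Nat.Prime, rootEulerFactor p)
      atTop (nhds L) ∧ prodLFunction 1 = ((L ^ 2 / 3 : ℝ) : ℂ) := by
  set P : ℕ → ℝ := fun x =>
    ∏ p ∈ (Finset.range (x + 1)).filter Nat.Prime, rootEulerFactor p with hP
  have hPpos : ∀ x, 0 < P x := fun x =>
    Finset.prod_pos fun p hp => rootEulerFactor_pos (Finset.mem_filter.1 hp).2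
  set G : ℂ := charTwelve.LFunction 1 * charThree.LFunction 1 * charFour.LFunction 1 with hG
  have hG0 : G ≠ 0 := mul_ne_zero (mul_ne_zero
    (DirichletCharacter.LFunction_apply_one_ne_zero charTwelve_ne_one)
    (DirichletCharacter.LFunction_apply_one_ne_zero charThree_ne_one))
    (DirichletCharacter.LFunction_apply_one_ne_zero charFour_ne_one)
  have hlim : Tendsto (fun x => ((P x ^ 2 : ℝ) : ℂ)) atTop (nhds G) := by
    refine (((tendsto_prod_eulerFactor charTwelve_ne_one).mul
      (tendsto_prod_eulerFactor charThree_ne_one)).mul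
      (tendsto_prod_eulerFactor charFour_ne_one)).congr fun x => ?_
    rw [hP, ← Finset.prod_mul_distrib, ← Finset.prod_mul_distrib, ← Finset.prod_pow,
      Complex.ofReal_prod]
    exact Finset.prod_congr rfl fun p hp => (rootEulerFactor_sq (Finset.mem_filter.1 hp).2).symm
  have hre : Tendsto (fun x => P x ^ 2) atTop (nhds G.re) := by
    have := (Complex.continuous_re.tendsto _).comp hlim
    simpa only [Function.comp_def, Complex.ofReal_re] using this
  have hGre : G = (G.re : ℂ) :=
    tendsto_nhds_unique hlim ((Complex.continuous_ofReal.tendsto _).comp hre)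
  have hGpos : 0 < G.re := by
    refine lt_of_le_of_ne (ge_of_tendsto' hre fun x => sq_nonneg _) fun h => hG0 ?_
    rw [hGre, ← h, Complex.ofReal_zero]
  refine ⟨Real.sqrt G.re, Real.sqrt_pos.2 hGpos, ?_, ?_⟩
  · refine ((Real.continuous_sqrt.tendsto _).comp hre).congr fun x => ?_
    exact Real.sqrt_sq (hPpos x).le
  · rw [prodLFunction_one, Real.sq_sqrt hGpos.le, ← hG]
    push_cast
    rw [← hGre]
    ring

theorem tendsto_log_twelve_mul_add_one_div_log :
    Tendsto (fun N : ℕ => Real.log (12 * N + 1) / Real.log N) atTop (nhds 1) := by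
  have hlog : Tendsto (fun N : ℕ => Real.log N) atTop atTop :=
    Real.tendsto_log_atTop.comp tendsto_natCast_atTop_atTop
  have hinv : Tendsto (fun N : ℕ => ((N : ℝ))⁻¹) atTop (nhds 0) := tendsto_inv_atTop_nhds_zero_nat
  have h12 : Tendsto (fun N : ℕ => Real.log (12 + (N : ℝ)⁻¹)) atTop (nhds (Real.log 12)) := by
    have h : Tendsto (fun N : ℕ => 12 + (N : ℝ)⁻¹) atTop (nhds 12) := by
      simpa using hinv.const_add 12
    exact h.log (by norm_num)
  have h := (h12.div_atTop hlog).const_add 1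
  rw [add_zero] at h
  refine h.congr' ?_
  filter_upwards [eventually_ge_atTop 2] with N hN
  have hN0 : (0 : ℝ) < N := by positivity
  have hl : 0 < Real.log N := Real.log_pos (by exact_mod_cast hN)
  rw [show (12 * N + 1 : ℝ) = (12 + (N : ℝ)⁻¹) * N by field_simp,
    Real.log_mul (by positivity) hN0.ne']
  field_simp
  ring

theorem tendsto_sum_abs_coeff_div {S : ℕ → ℝ} {L : ℝ} (hL : 0 < L)
    (h : Tendsto (fun N : ℕ => Real.sqrt (Real.log (12 * N + 1)) * (S N / (12 * N + 1)))
      atTop (nhds (Real.sqrt (L ^ 2 / 3) / Real.sqrt Real.pi))) :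
    Tendsto (fun N : ℕ => S N /
      (12 / Real.sqrt (3 * Real.pi) * L * N / Real.sqrt (Real.log N))) atTop (nhds 1) := by
  have hconst : Real.sqrt (L ^ 2 / 3) / Real.sqrt Real.pi = L / Real.sqrt (3 * Real.pi) := by
    rw [Real.sqrt_div (sq_nonneg L), Real.sqrt_sq hL.le, Real.sqrt_mul (by norm_num), div_div]
  have hpi : 0 < Real.sqrt (3 * Real.pi) := Real.sqrt_pos.2 (by positivity)
  have hsq : Tendsto (fun N : ℕ => Real.sqrt (Real.log (12 * N + 1) / Real.log N)) atTop
      (nhds 1) := by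
    simpa [Function.comp_def] using
      (Real.continuous_sqrt.tendsto _).comp tendsto_log_twelve_mul_add_one_div_log
  have hlin : Tendsto (fun N : ℕ => 12 + (N : ℝ)⁻¹) atTop (nhds 12) := by
    simpa using tendsto_inv_atTop_nhds_zero_nat (𝕜 := ℝ).const_add 12
  rw [hconst] at h
  have hall := ((h.div hsq one_ne_zero).mul hlin).mul_const
    (Real.sqrt (3 * Real.pi) / (12 * L))
  have hval : L / Real.sqrt (3 * Real.pi) / 1 * 12 * (Real.sqrt (3 * Real.pi) / (12 * L)) = 1 := by
    field_simp
  rw [hval] at hall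
  refine hall.congr' ?_
  filter_upwards [eventually_ge_atTop 2] with N hN
  have hN0 : (0 : ℝ) < N := by positivity
  have hN2 : (1 : ℝ) < N := by exact_mod_cast hN
  have hl : 0 < Real.sqrt (Real.log N) := Real.sqrt_pos.2 (Real.log_pos hN2)
  have hl' : 0 < Real.sqrt (Real.log (12 * N + 1)) :=
    Real.sqrt_pos.2 (Real.log_pos (by linarith))
  rw [Pi.div_apply, Real.sqrt_div (Real.log_nonneg (by linarith))]
  field_simp

/-- With `a n` the coefficient of `q^n` in `∏ (1 - q^m)^2`, there is `C > 0`
such that `∑_{n ≤ N} |a n| ~ C N / (log N)^{1/2}`, where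
`C = (12/√(3π)) · L` and `L` is the limit of the stated partial Euler products. -/
theorem stmt_4 (a : ℕ → ℤ)
    (ha : ∀ n N : ℕ, n ≤ N →
      a n = (((∏ m ∈ Finset.Icc 1 N, ((1 : Polynomial ℤ) - Polynomial.X ^ m)) ^ 2).coeff n)) :
    ∃ C L : ℝ, 0 < C ∧ 0 < L ∧
      Tendsto
        (fun x : ℕ => ∏ p ∈ (Finset.range (x + 1)).filter Nat.Prime,
          (if p % 12 = 5 ∨ p % 12 = 7 ∨ p % 12 = 11 then
            (1 + (p : ℝ)⁻¹)⁻¹ * (1 - (p : ℝ)⁻¹) ^ (-(1 / 2) : ℝ)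
          else if p % 12 = 1 then (1 - (p : ℝ)⁻¹) ^ (-(3 / 2) : ℝ)
          else 1))
        atTop (nhds L) ∧
      C = 12 / Real.sqrt (3 * Real.pi) * L ∧
      Tendsto
        (fun N : ℕ => (∑ n ∈ Finset.range (N + 1), (|a n| : ℝ)) /
          (C * N / Real.sqrt (Real.log N)))
        atTop (nhds 1) := by
  obtain ⟨L, hL, hprod, hone⟩ := exists_tendsto_prod_rootEulerFactor
  refine ⟨12 / Real.sqrt (3 * Real.pi) * L, L, by positivity, hL, hprod, rfl, ?_⟩
  refine tendsto_sum_abs_coeff_div hL ?_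
  have hx : Tendsto (fun N : ℕ => ((12 * N + 1 : ℕ) : ℝ)) atTop atTop :=
    tendsto_natCast_atTop_atTop.comp
      (tendsto_atTop_mono (fun N => by simp only [id]; omega) tendsto_id)
  refine ((tendsto_sum_absCoeff hone).comp hx).congr fun N => ?_
  have hS : ∑ k ∈ Finset.Icc 1 (12 * N + 1), (absCoeff k : ℝ) =
      ∑ n ∈ Finset.range (N + 1), (|a n| : ℝ) := by
    have h1 : ∀ n : ℕ, (|a n| : ℝ) = (absCoeff (12 * n + 1) : ℝ) := fun n => by
      have := abs_coeff_eq_absCoeff ha n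
      exact_mod_cast this
    simp only [h1]
    exact_mod_cast (sum_range_absCoeff N).symm
  simp only [Function.comp_apply, Nat.floor_natCast, hS]
  push_cast
  rfl
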